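/- Let K be an algebraically closed field of characteristic zero, let n ≥ 1, and let e be an integer with 1 ≤ e < n. Then the ideal of all polynomials in A = K[Φ_{i,j} : 1 ≤ i,j ≤ n] vanishing at every matrix M ∈ Mat_n(K) with M^e = 0 is equal to the ideal of A generated by the invariants T_1, …, T_{e−1} together with the n² entries of the matrix power Φ^e of the generic matrix Φ. -/

import Mathlib

open MvPolynomial

/-- The generic `n × n` matrix whose `(i,j)` entry is the variable `Φ_{i,j}`. -/
noncomputable def genericMatrix (K : Type*) [CommRing K] (n : ℕ) :
    Matrix (Fin n) (Fin n) (MvPolynomial (Fin n × Fin n) K) :=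
  Matrix.of fun i j => X (i, j)

/-- `T_i`, the sum of all principal `i × i` minors of the generic matrix. -/
noncomputable def principalMinorSum (K : Type*) [CommRing K] (n i : ℕ) :
    MvPolynomial (Fin n × Fin n) K :=
  ∑ I ∈ Finset.univ.powersetCard i,
    Matrix.det ((genericMatrix K n).submatrix
      (fun x : {x : Fin n // x ∈ I} => (x : Fin n)) (fun x : {x : Fin n // x ∈ I} => (x : Fin n)))

set_option linter.all false


namespace Polynomial
section P5
open Matrix

theorem nilp_derivative_det {R : Type*} [CommRing R] {n : Type*} [Fintype n] [DecidableEq n]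
    (M : Matrix n n R[X]) :
    derivative M.det = ∑ i, (M.updateRow i (fun j => derivative (M i j))).det := by
  have h1 : ∀ i, (M.updateRow i (fun j => derivative (M i j))).det
      = ∑ σ : Equiv.Perm n, (Equiv.Perm.sign σ : ℤ) • ((∏ k ∈ Finset.univ.erase i, M k (σ k)) * derivative (M i (σ i))) := by
    intro i
    rw [← det_transpose, det_apply]
    refine Finset.sum_congr rfl fun σ _ => ?_
    rw [← Finset.mul_prod_erase _ _ (Finset.mem_univ i), mul_comm]
    have : ∏ x ∈ Finset.univ.erase i, (M.updateRow i fun j ↦ derivative (M i j))ᵀ (σ x) x = ∏ x ∈ Finset.univ.erase i, M x (σ x) := by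
      refine Finset.prod_congr rfl fun x hx => ?_
      rw [transpose_apply, updateRow_ne (Finset.ne_of_mem_erase hx)]
    rw [this]
    simp [Units.smul_def]
  simp_rw [h1]
  rw [Finset.sum_comm, ← det_transpose, det_apply]
  simp only [derivative_sum, transpose_apply]
  refine Finset.sum_congr rfl fun σ _ => ?_
  rw [Units.smul_def, zsmul_eq_mul, derivative_mul, derivative_prod_finset]
  simp [Finset.mul_sum]

theorem nilp_derivative_charpoly {R : Type*} [CommRing R] {n : Type*} [Fintype n] [DecidableEq n]
    (M : Matrix n n R) : derivative M.charpoly = (adjugate (charmatrix M)).trace := by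
  rw [charpoly, nilp_derivative_det, trace]
  refine Finset.sum_congr rfl fun i _ => ?_
  rw [diag_apply, adjugate_apply]
  congr 2
  ext1 j
  by_cases h : i = j
  · subst h; simp [charmatrix_apply]
  · simp [charmatrix_apply, h, Ne.symm h]

theorem charmatrix_mul_geom {R : Type*} [CommRing R] {n : Type*} [Fintype n] [DecidableEq n]
    (M : Matrix n n R) (e : ℕ) (hM : M ^ e = 0) :
    charmatrix M * (∑ i ∈ Finset.range e, (scalar n (X : R[X])) ^ i * (M.map C) ^ (e - 1 - i))
      = (scalar n (X : R[X])) ^ e := by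
  have hc : Commute (scalar n (X : R[X])) (M.map C) := scalar_commute _ (fun _ => Commute.all _ _) _
  have := hc.mul_geom_sum₂ e
  rw [charmatrix, RingHom.mapMatrix_apply, this]
  have h0 : (M.map (C : R →+* R[X])) ^ e = 0 := by
    have := congrArg (fun A => A.map (C : R →+* R[X])) hM
    simpa [Matrix.map_pow] using this
  rw [h0, sub_zero]

theorem charpoly_of_coeff {R : Type*} [CommRing R] [Algebra ℚ R] {N : ℕ}
    (M : Matrix (Fin N) (Fin N) R) (e : ℕ) (he : 1 ≤ e) (hM : M ^ e = 0)
    (hc : ∀ j, 1 ≤ j → j < e → j ≤ N → M.charpoly.coeff (N - j) = 0) :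
    M.charpoly = X ^ N ∧ ∀ k, 1 ≤ k → (M ^ k).trace = 0 := by
  nontriviality R
  haveI : CharZero R := algebraRat.charZero R
  set p := M.charpoly with hp
  have hmon : p.Monic := M.charpoly_monic
  have hdeg : p.natDegree = N := by simp [hp, M.charpoly_natDegree_eq_dim]
  have hcN : p.coeff N = 1 := by rw [← hdeg]; exact hmon
  have hcgt : ∀ k, N < k → p.coeff k = 0 := fun k hk => coeff_eq_zero_of_natDegree_lt (by omega)
  -- main identity
  have key : X ^ e * derivative p = p * ∑ i ∈ Finset.range e, X ^ i * C ((M ^ (e - 1 - i)).trace) := by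
    have h1 := congrArg (fun A => (adjugate (charmatrix M) * A).trace) (charmatrix_mul_geom M e hM)
    beta_reduce at h1
    rw [← mul_assoc, adjugate_mul] at h1
    have h2 : ∀ k : ℕ, (scalar (Fin N) (X : R[X])) ^ k = (X ^ k : R[X]) • (1 : Matrix (Fin N) (Fin N) R[X]) := by
      intro k; rw [← map_pow]; simp [smul_one_eq_diagonal]
    simp only [h2, smul_mul_assoc, one_mul, mul_smul_comm, mul_one, trace_smul, trace_sum] at h1
    rw [nilp_derivative_charpoly, ← smul_eq_mul, ← h1, smul_eq_mul]
    rw [hp, charpoly]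
    congr 1
    refine Finset.sum_congr rfl fun i _ => ?_
    rw [smul_eq_mul]
    congr 1
    rw [← Matrix.map_pow]
    simp only [trace, diag_apply, map_apply]
    rw [map_sum]
  obtain ⟨e', rfl⟩ : ∃ e', e = e' + 1 := ⟨e - 1, by omega⟩
  rw [Finset.sum_range_succ] at key
  simp only [Nat.add_sub_cancel, Nat.sub_self, pow_zero, trace_one, Fintype.card_fin] at key
  set u : R[X] := ∑ i ∈ Finset.range e', X ^ i * C ((M ^ (e' - i)).trace) with hu
  have key2 : X ^ e' * (X * derivative p - C (N : R) * p) = p * u := by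
    linear_combination key
  have hco : ∀ k : ℕ, (X * derivative p - C (N : R) * p).coeff k = ((k : R) - N) * p.coeff k := by
    intro k
    rcases k with _ | k
    · simp
    · simp [coeff_X_mul, coeff_derivative]; ring
  have hz : ∀ k, N ≤ k + e' → (X * derivative p - C (N : R) * p).coeff k = 0 := by
    intro k hk
    rw [hco]
    rcases lt_trichotomy k N with h | h | h
    · rcases Nat.eq_zero_or_pos e' with h0 | h0
      · omega
      · have := hc (N - k) (by omega) (by omega) (by omega)
        rw [show N - (N - k) = k by omega] at this
        rw [this, mul_zero]
    · subst h; simp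
    · rw [hcgt k h, mul_zero]
  have hu0 : u = 0 := by
    by_contra hne
    have h1 : (p * u).natDegree = N + u.natDegree := by
      rw [hmon.natDegree_mul' hne, hdeg]
    have h2 : (p * u).coeff (N + u.natDegree) ≠ 0 := by
      rw [← h1]; 
      simpa using (hmon.mul_right_ne_zero hne)
    apply h2
    rw [← key2, coeff_X_pow_mul']
    split_ifs with h
    · apply hz; omega
    · rfl
  have htr : ∀ i, i < e' → (M ^ (e' - i)).trace = 0 := by
    intro i hi
    have := congrArg (fun q => coeff q i) hu0
    simp only [hu, finsetSum_coeff, coeff_zero] at this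
    rw [Finset.sum_eq_single i] at this
    · simpa [coeff_X_pow_mul'] using this
    · intro b _ hb
      rw [coeff_mul_C, coeff_X_pow, if_neg (Ne.symm hb), zero_mul]
    · intro h; exact absurd (Finset.mem_range.2 hi) h
  constructor
  · have h3 : X * derivative p - C (N : R) * p = 0 := by
      have : X ^ e' * (X * derivative p - C (N : R) * p) = 0 := by rw [key2, hu0, mul_zero]
      exact (isRegular_X_pow e').left (by simpa using this)
    ext k
    rw [coeff_X_pow]
    split_ifs with h
    · rw [h, hcN]
    · have := hco k
      rw [h3, coeff_zero] at this
      rcases lt_or_gt_of_ne h with h' | h'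
      · have hk : ((k : R) - N) = algebraMap ℚ R ((k : ℚ) - N) := by simp
        have hk2 : (((k : ℚ) - N)⁻¹ * ((k : ℚ) - N)) = 1 := by
          apply inv_mul_cancel₀
          rw [sub_ne_zero]; exact_mod_cast h
        have h4 := congrArg (fun x => algebraMap ℚ R (((k : ℚ) - N)⁻¹) * x) this.symm
        simp only [mul_zero] at h4
        rw [hk, ← mul_assoc, ← map_mul, hk2, map_one, one_mul] at h4
        exact h4
      · exact hcgt k h'
  · intro k hk
    by_cases hke : k ≤ e'
    · have := htr (e' - k) (by omega)
      rwa [show e' - (e' - k) = k by omega] at this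
    · rw [show k = (e' + 1) + (k - (e' + 1)) by omega, pow_add, hM, zero_mul, trace_zero]
end P5
end Polynomial

namespace Polynomial
section P4
open Matrix
theorem nilp_det_add {R : Type*} [CommRing R] {N j : ℕ} (M : Matrix (Fin N) (Fin N) R) (e : ℕ)
    (he : 1 ≤ e) (hM : M ^ e = 0) (hp : M.charpoly = X ^ N) (hj : j * e < N)
    (U : Matrix (Fin N) (Fin j) R) (W : Matrix (Fin j) (Fin N) R) : (M + U * W).det = 0 := by
  set G : Matrix (Fin N) (Fin N) R[X] :=
    ∑ i ∈ Finset.range e, (scalar (Fin N) (X : R[X])) ^ i * (M.map C) ^ (e - 1 - i) with hG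
  have h0 := charmatrix_mul_geom M e hM
  rw [← hG, ← map_pow] at h0
  have hjN : j ≤ N := by nlinarith
  have h1 : charmatrix M * (scalar (Fin N) (X ^ e : R[X]) - (G * U.map C) * W.map C)
      = scalar (Fin N) (X ^ e : R[X]) * charmatrix (M + U * W) := by
    have hc : Commute (scalar (Fin N) (X ^ e : R[X])) (charmatrix M) :=
      scalar_commute _ (fun _ => Commute.all _ _) _
    have : charmatrix (M + U * W) = charmatrix M - U.map C * W.map C := by
      simp only [charmatrix, map_add, RingHom.mapMatrix_apply, Matrix.map_mul]
      abel
    rw [this, mul_sub, mul_sub, hc.eq, Matrix.mul_assoc, ← Matrix.mul_assoc, h0]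
  have h2 := congrArg det h1
  rw [det_mul, det_mul] at h2
  have h3 : (scalar (Fin N) (X ^ e : R[X]) - (G * U.map C) * W.map C).det
     = (X ^ e) ^ (N - j) * (scalar (Fin j) (X ^ e : R[X]) - W.map C * (G * U.map C)).det := by
    rw [← eval_charpoly, charpoly_mul_comm_of_le _ _ (by simpa using hjN)]
    simp [eval_charpoly]
  rw [h3] at h2
  have h4 : (charmatrix M).det = X ^ N := hp
  have h5 : (scalar (Fin N) (X ^ e : R[X])).det = X ^ (e * N) := by
    simp [pow_mul]
  rw [h4, h5] at h2
  change _ = _ * (M + U * W).charpoly at h2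
  set q := (scalar (Fin j) (X ^ e : R[X]) - W.map C * (G * U.map C)).det
  have h6 : (X : R[X]) ^ (e * N) * (X ^ (N - j * e) * q) = X ^ (e * N) * (M + U * W).charpoly := by
    rw [← h2, ← mul_assoc, ← mul_assoc, ← pow_mul, ← pow_add, ← pow_add]
    congr 2
    have : e * j ≤ e * N := Nat.mul_le_mul_left _ hjN
    rw [Nat.mul_sub, mul_comm j e]
    rw [mul_comm] at hj
    omega
  have h7 := (isRegular_X_pow (e * N)).left h6
  rw [det_eq_sign_charpoly_coeff, ← h7, coeff_X_pow_mul', if_neg (by omega), mul_zero]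

theorem nilp_det_submatrix_eq_zero {R : Type*} [CommRing R] {ι κ : Type*} [Fintype ι] [DecidableEq ι]
    [Fintype κ] [DecidableEq κ] (A : Matrix ι ι R) (hA : A.det = 0) (F G : κ ≃ ι) :
    (A.submatrix F G).det = 0 := by
  have : A.submatrix F G = (A.submatrix F F).submatrix id (G.trans F.symm) := by
    ext a b; simp
  rw [this, det_permute', det_submatrix_equiv_self, hA, mul_zero]

theorem nilp_exists_equiv {N k j : ℕ} (h : k + j = N) (f : Fin k → Fin N)
    (hf : Function.Injective f) : ∃ F : Fin k ⊕ Fin j ≃ Fin N, ∀ i, F (Sum.inl i) = f i := by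
  have hc : Fintype.card (↥(Set.range f)ᶜ) = j := by
    rw [Fintype.card_compl_set, Set.card_range_of_injective hf]; simp; omega
  let g : Fin j ≃ ↥(Set.range f)ᶜ := (Fintype.equivFinOfCardEq hc).symm
  refine ⟨(Equiv.sumCongr (Equiv.ofInjective f hf) g).trans (Equiv.Set.sumCompl _), fun i => ?_⟩
  simp

theorem nilp_minors {R : Type*} [CommRing R] {N k j : ℕ} (M : Matrix (Fin N) (Fin N) R) (e : ℕ)
    (he : 1 ≤ e) (hM : M ^ e = 0) (hp : M.charpoly = X ^ N) (hj : j * e < N) (hk : k + j = N)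
    (f g : Fin k → Fin N) : (M.submatrix f g).det = 0 := by
  by_cases hf : Function.Injective f
  swap
  · obtain ⟨a, b, hab, hne⟩ : ∃ a b, f a = f b ∧ a ≠ b := by
      simpa [Function.Injective] using hf
    exact det_zero_of_row_eq hne (by ext c; simp [hab])
  by_cases hg : Function.Injective g
  swap
  · obtain ⟨a, b, hab, hne⟩ : ∃ a b, g a = g b ∧ a ≠ b := by
      simpa [Function.Injective] using hg
    exact det_zero_of_column_eq hne (by intro c; simp [hab])
  obtain ⟨F, hF⟩ := nilp_exists_equiv hk f hf
  obtain ⟨G, hG⟩ := nilp_exists_equiv hk g hg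
  set M' := M.submatrix F G with hM'
  set U' : Matrix (Fin k ⊕ Fin j) (Fin j) R := Matrix.fromRows 0 1
  set W' : Matrix (Fin j) (Fin k ⊕ Fin j) R := Matrix.fromCols (-M'.toBlocks₂₁) (1 - M'.toBlocks₂₂)
  have h0 := nilp_det_add M e he hM hp hj (U'.submatrix F.symm id) (W'.submatrix id G.symm)
  have h1 := nilp_det_submatrix_eq_zero _ h0 F G
  have h2 : (M + U'.submatrix F.symm id * W'.submatrix id G.symm).submatrix F G
      = fromBlocks M'.toBlocks₁₁ M'.toBlocks₁₂ 0 1 := by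
    have : (M + U'.submatrix F.symm id * W'.submatrix id G.symm).submatrix F G = M' + U' * W' := by
      ext a b; simp [Matrix.mul_apply, hM']
    rw [this]
    conv_lhs => rw [← fromBlocks_toBlocks M']
    rw [fromRows_mul_fromCols, fromBlocks_add]
    simp
  rw [h2, det_fromBlocks_zero₂₁, det_one, mul_one] at h1
  rw [← h1]
  congr 1
  ext a b
  simp [hM', toBlocks₁₁, hF, hG]
end P4
end Polynomial

namespace NilpPf
section P1a

/-- homogeneous ideals, elementary form -/
def HomI {σ K : Type*} [Field K] (I : Ideal (MvPolynomial σ K)) : Prop :=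
  ∀ f ∈ I, ∀ d, homogeneousComponent d f ∈ I

theorem homI_span {σ K : Type*} [Field K] (s : Set (MvPolynomial σ K))
    (h : ∀ x ∈ s, ∃ d, x.IsHomogeneous d) : HomI (Ideal.span s) := by
  letI := MvPolynomial.gradedAlgebra (σ := σ) (R := K)
  intro f hf d
  refine homogeneousComponent_mem_of_mem (Ideal.homogeneous_span _ _ ?_) hf d
  intro x hx
  obtain ⟨d, hd⟩ := h x hx
  exact ⟨d, hd⟩

theorem mem_of_components {σ K : Type*} [Field K] (I : Ideal (MvPolynomial σ K))
    (f : MvPolynomial σ K) (h : ∀ d, d ≤ f.totalDegree → homogeneousComponent d f ∈ I) : f ∈ I := by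
  rw [← sum_homogeneousComponent f]
  refine Ideal.sum_mem _ fun d hd => h d ?_
  simpa [Nat.lt_succ_iff] using hd

theorem homogeneousComponent_mul_homog {σ K : Type*} [Field K] (b F : MvPolynomial σ K) (δ d : ℕ)
    (hF : F.IsHomogeneous δ) :
    homogeneousComponent d (b * F) = if δ ≤ d then homogeneousComponent (d - δ) b * F else 0 := by
  conv_lhs => rw [← sum_homogeneousComponent b, Finset.sum_mul, map_sum]
  have : ∀ i, homogeneousComponent d (homogeneousComponent i b * F)
      = if i + δ = d then homogeneousComponent i b * F else 0 := by
    intro i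
    rw [homogeneousComponent_of_mem ((homogeneousComponent_isHomogeneous i b).mul hF)]
    simp [eq_comm]
  simp_rw [this]
  split_ifs with h
  · rw [Finset.sum_eq_single (d - δ)]
    · rw [if_pos (by omega)]
    · intro i _ hi
      rw [if_neg (by omega)]
    · intro hi
      have : b.totalDegree < d - δ := by
        have : b.totalDegree + δ < d := by simpa using hi
        omega
      rw [homogeneousComponent_eq_zero _ _ this]; simp
  · refine Finset.sum_eq_zero fun i _ => ?_
    rw [if_neg (by omega)]

theorem mem_span_pair_iff' {R : Type*} [CommRing R] (I : Ideal R) (x a : R) :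
    a ∈ I ⊔ Ideal.span {x} ↔ ∃ b ∈ I, ∃ c, a = b + c * x := by
  rw [Submodule.mem_sup]
  constructor
  · rintro ⟨b, hb, z, hz, rfl⟩
    obtain ⟨c, rfl⟩ := Ideal.mem_span_singleton'.1 hz
    exact ⟨b, hb, c, rfl⟩
  · rintro ⟨b, hb, c, rfl⟩
    exact ⟨b, hb, c * x, Ideal.mem_span_singleton'.2 ⟨c, rfl⟩, rfl⟩

/-- ideal generated by the first `k` members -/
def Ik {R : Type*} [CommRing R] (F : ℕ → R) (k : ℕ) : Ideal R := Ideal.span (F '' Set.Iio k)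

theorem Ik_zero {R : Type*} [CommRing R] (F : ℕ → R) : Ik F 0 = ⊥ := by
  simp [Ik]

theorem Ik_succ {R : Type*} [CommRing R] (F : ℕ → R) (k : ℕ) :
    Ik F (k + 1) = Ik F k ⊔ Ideal.span {F k} := by
  rw [Ik, Ik, ← Ideal.span_union]
  congr 1
  ext x
  simp only [Set.mem_image, Set.mem_Iio, Set.mem_union, Set.mem_singleton_iff]
  constructor
  · rintro ⟨i, hi, rfl⟩
    rcases Nat.lt_succ_iff_lt_or_eq.1 hi with h | rfl
    · exact Or.inl ⟨i, h, rfl⟩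
    · exact Or.inr rfl
  · rintro (⟨i, hi, rfl⟩ | rfl)
    · exact ⟨i, by omega, rfl⟩
    · exact ⟨k, by omega, rfl⟩

theorem Ik_map {R S : Type*} [CommRing R] [CommRing S] (π : R →+* S) (F : ℕ → R) (k : ℕ) :
    (Ik F k).map π = Ik (fun i => π (F i)) k := by
  rw [Ik, Ik, Ideal.map_span, Set.image_image]

/-- substitution killing a linear form -/
theorem exists_subst {σ : Type*} [Fintype σ] [DecidableEq σ] {K : Type*} [Field K]
    (ℓ : MvPolynomial σ K) (hℓ : ℓ.IsHomogeneous 1) (h0 : ℓ ≠ 0) :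
    ∃ (j : σ) (π : MvPolynomial σ K →ₐ[K] MvPolynomial {i // i ≠ j} K),
      (∀ i : {i // i ≠ j}, π (X i.1) = X i) ∧ (∀ f d, f.IsHomogeneous d → (π f).IsHomogeneous d) ∧
      π ℓ = 0 ∧ (∀ f, π f = 0 → ∃ c, f = c * ℓ) ∧ Function.Surjective π := by
  obtain ⟨c, hc⟩ : ∃ c : σ → K, ℓ = ∑ i, C (c i) * X i := by
    have : ℓ ∈ homogeneousSubmodule σ K 1 := hℓ
    rw [homogeneousSubmodule_one_eq_span_X, Submodule.mem_span_range_iff_exists_fun] at this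
    obtain ⟨c, hc⟩ := this
    exact ⟨c, by rw [← hc]; simp [smul_eq_C_mul]⟩
  obtain ⟨j, hj⟩ : ∃ j, c j ≠ 0 := by
    by_contra h
    push Not at h
    apply h0; rw [hc]; simp [h]
  let sub : MvPolynomial {i // i ≠ j} K := - C (c j)⁻¹ * ∑ i : {i // i ≠ j}, C (c i.1) * X i
  let g : σ → MvPolynomial {i // i ≠ j} K := fun i => if h : i ≠ j then X ⟨i, h⟩ else sub
  let π : MvPolynomial σ K →ₐ[K] MvPolynomial {i // i ≠ j} K := aeval g
  have hg : ∀ i, (g i).IsHomogeneous 1 := by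
    intro i
    simp only [g]
    split_ifs with h
    · exact isHomogeneous_X _ _
    · have h1 : (∑ i : {i // i ≠ j}, C (c i.1) * X i : MvPolynomial {i // i ≠ j} K).IsHomogeneous 1 := by
        refine IsHomogeneous.sum _ _ _ fun i _ => ?_
        simpa using (isHomogeneous_C _ (c i.1)).mul (isHomogeneous_X K i)
      have h2 := (isHomogeneous_C {i // i ≠ j} (-(c j)⁻¹)).mul h1
      simpa [sub] using h2
  have hX : ∀ i : {i // i ≠ j}, π (X i.1) = X i := by
    intro i; simp [π, g, i.2]
  have hsplit : ∀ f : σ → MvPolynomial σ K, ∑ i, f i = f j + ∑ i : {i // i ≠ j}, f i.1 := by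
    intro f
    rw [← Finset.add_sum_erase _ _ (Finset.mem_univ j)]
    congr 1
    rw [← Finset.sum_subtype (Finset.univ.erase j) (by simp)]
  have hsum : ℓ = C (c j) * X j + ∑ i : {i // i ≠ j}, C (c i.1) * X i.1 := by
    rw [hc, hsplit]
  let ι : MvPolynomial {i // i ≠ j} K →ₐ[K] MvPolynomial σ K := rename Subtype.val
  have hker : ∀ f, f - ι (π f) ∈ Ideal.span {ℓ} := by
    intro f
    have : (Ideal.Quotient.mkₐ K (Ideal.span {ℓ})) = (Ideal.Quotient.mkₐ K (Ideal.span {ℓ})).comp (ι.comp π) := by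
      apply algHom_ext
      intro i
      simp only [AlgHom.comp_apply]
      by_cases h : i ≠ j
      · rw [hX ⟨i, h⟩]; simp [ι]
      · push Not at h; subst h
        rw [Ideal.Quotient.mkₐ_eq_mk, Ideal.Quotient.eq, Ideal.mem_span_singleton]
        refine ⟨C (c i)⁻¹, ?_⟩
        have e1 : ι (π (X i)) = - C (c i)⁻¹ * ∑ k : {k // k ≠ i}, C (c k.1) * X k.1 := by
          simp [π, g, sub, ι]
        rw [e1, hsum]
        have e2 : C (c i) * C (c i)⁻¹ = (1 : MvPolynomial σ K) := by
          rw [← C_mul, mul_inv_cancel₀ hj, C_1]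
        linear_combination (-X i) * e2
    have h2 := DFunLike.congr_fun this f
    simp only [AlgHom.comp_apply, Ideal.Quotient.mkₐ_eq_mk] at h2
    exact (Ideal.Quotient.eq).1 h2
  refine ⟨j, π, hX, ?_, ?_, ?_, ?_⟩
  · intro f d hf
    have := hf.aeval g hg
    rw [one_mul] at this
    exact this
  · rw [hsum, map_add, map_mul, map_sum]
    have e1 : π (X j) = sub := by simp [π, g]
    rw [e1]
    simp only [map_mul, hX]
    have e3 : ∀ a, π (C a) = C a := fun a => by simp [π]
    simp only [e3, sub]
    have e2 : C (c j) * C (c j)⁻¹ = (1 : MvPolynomial {i // i ≠ j} K) := by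
      rw [← C_mul, mul_inv_cancel₀ hj, C_1]
    linear_combination (-∑ i : {i // i ≠ j}, C (c i.1) * X i) * e2
  · intro f hf
    have := hker f
    rw [hf, map_zero, sub_zero] at this
    obtain ⟨a, ha⟩ := Ideal.mem_span_singleton'.1 this
    exact ⟨a, ha.symm⟩
  · have hid : ∀ f, π (ι f) = f := by
      intro f
      have : π.comp ι = AlgHom.id K _ := by
        apply algHom_ext
        intro i
        simp [ι, hX i]
      exact DFunLike.congr_fun this f
    intro f; exact ⟨ι f, hid f⟩

end P1a
end NilpPf

namespace NilpPf
section P1b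

theorem rel_step {σ : Type*} {K : Type*} [Field K] [Infinite K] {t : ℕ}
    (y : Fin (t + 1) → MvPolynomial σ K) (hy : ∀ i, (y i).IsHomogeneous 1)
    (Q : MvPolynomial (Fin (t + 1)) K) (d : ℕ) (hd : 0 < d) (hQ : Q.IsHomogeneous d) (hQ0 : Q ≠ 0) :
    ∃ z : Fin t → MvPolynomial σ K, (∀ i, (z i).IsHomogeneous 1) ∧
      ∀ i, y i ∈ (Ideal.span {aeval y Q} ⊔ Ideal.span (Set.range z)).radical := by
  obtain ⟨c, hc⟩ : ∃ c : Fin (t + 1) → K, eval c Q ≠ 0 := by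
    by_contra h
    push Not at h
    exact hQ0 (MvPolynomial.funext (by simpa using h))
  obtain ⟨j, hj⟩ : ∃ j, c j ≠ 0 := by
    by_contra h
    push Not at h
    have hc0 : c = 0 := _root_.funext h
    apply hc
    rw [hc0]
    have : constantCoeff Q = 0 := by
      have := hQ.coeff_eq_zero (d := 0) (by simpa using hd.ne)
      simpa [constantCoeff_eq] using this
    rw [← this, ← eval_zero]
  let a : Fin (t + 1) → K := fun i => c i / c j
  let w : Fin (t + 1) → MvPolynomial σ K := fun i => y i - C (a i) * y j
  let z : Fin t → MvPolynomial σ K := fun i => w (j.succAbove i)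
  have hw : ∀ i, w i ∈ Ideal.span (Set.range z) := by
    intro i
    by_cases h : i = j
    · subst h
      simp [w, a, div_self hj]
    · obtain ⟨k, rfl⟩ := Fin.exists_succAbove_eq h
      exact Ideal.subset_span ⟨k, rfl⟩
  set J := Ideal.span {aeval y Q} ⊔ Ideal.span (Set.range z) with hJ
  have hwJ : ∀ i, w i ∈ J := fun i => Ideal.mem_sup_right (hw i)
  have hpow : y j ^ d ∈ J := by
    have h1 : (Ideal.Quotient.mkₐ K J) (aeval y Q) = (Ideal.Quotient.mkₐ K J) (aeval (fun i => C (a i) * y j) Q) := by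
      rw [← AlgHom.comp_apply, ← AlgHom.comp_apply, comp_aeval, comp_aeval]
      congr 2
      funext i
      rw [Ideal.Quotient.mkₐ_eq_mk, Ideal.Quotient.eq]
      exact hwJ i
    have h2 : (Ideal.Quotient.mkₐ K J) (aeval y Q) = 0 := by
      rw [Ideal.Quotient.mkₐ_eq_mk, Ideal.Quotient.eq_zero_iff_mem]
      exact Ideal.mem_sup_left (Ideal.subset_span rfl)
    have h3 : aeval (fun i => C (a i) * y j) Q = C (eval a Q) * y j ^ d := by
      rw [MvPolynomial.aeval_def, eval₂_eq, eval_eq, map_sum, Finset.sum_mul]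
      refine Finset.sum_congr rfl fun m hm => ?_
      have hdeg : ∑ i ∈ m.support, m i = d := by
        have := hQ (mem_support_iff.1 hm)
        rw [← this]
        simp [Finsupp.weight_apply, Finsupp.sum]
      simp only [mul_pow, Finset.prod_mul_distrib, map_mul, map_prod, map_pow]
      rw [Finset.prod_pow_eq_pow_sum, hdeg, algebraMap_eq, mul_assoc]
    have h4 : eval a Q ≠ 0 := by
      have h5 : eval c Q = (c j) ^ d * eval a Q := by
        rw [eval_eq, eval_eq, Finset.mul_sum]
        refine Finset.sum_congr rfl fun m hm => ?_
        have hdeg : ∑ i ∈ m.support, m i = d := by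
          have := hQ (mem_support_iff.1 hm)
          rw [← this]
          simp [Finsupp.weight_apply, Finsupp.sum]
        rw [← hdeg, ← Finset.prod_pow_eq_pow_sum, mul_left_comm, ← Finset.prod_mul_distrib]
        congr 1
        refine Finset.prod_congr rfl fun i _ => ?_
        rw [← mul_pow]; simp only [a]
        rw [mul_div_cancel₀ _ hj]
      intro h; exact hc (by rw [h5, h, mul_zero])
    rw [h1, h3, Ideal.Quotient.mkₐ_eq_mk, Ideal.Quotient.eq_zero_iff_mem] at h2
    have h6 := J.mul_mem_left (C (eval a Q)⁻¹) h2
    rwa [← mul_assoc, ← C_mul, inv_mul_cancel₀ h4, C_1, one_mul] at h6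
  have hyj : y j ∈ J.radical := ⟨d, hpow⟩
  refine ⟨z, fun i => ?_, fun i => ?_⟩
  · refine (hy _).sub ?_
    simpa using (isHomogeneous_C σ (a (j.succAbove i))).mul (hy j)
  · have : y i = w i + C (a i) * y j := by simp [w]
    rw [this]
    exact Ideal.add_mem _ (Ideal.le_radical (hwJ i)) (Ideal.mul_mem_left _ _ hyj)

theorem exists_nn {σ : Type*} [Fintype σ] {K : Type*} [Field K] [Infinite K]
    (I : Ideal (MvPolynomial σ K)) :
    ∃ (s : ℕ) (y : Fin s → MvPolynomial σ K), (∀ i, (y i).IsHomogeneous 1) ∧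
      (∀ i, X i ∈ (I ⊔ Ideal.span (Set.range y)).radical) ∧
      ∀ d, 0 < d → ∀ Q : MvPolynomial (Fin s) K, Q.IsHomogeneous d → aeval y Q ∈ I → Q = 0 := by
  classical
  let P : ℕ → Prop := fun s => ∃ y : Fin s → MvPolynomial σ K, (∀ i, (y i).IsHomogeneous 1) ∧
      (∀ i, X i ∈ (I ⊔ Ideal.span (Set.range y)).radical)
  have hP : ∃ s, P s := by
    refine ⟨Fintype.card σ, fun i => X ((Fintype.equivFin σ).symm i), fun i => isHomogeneous_X _ _, fun i => ?_⟩
    refine Ideal.le_radical (Ideal.mem_sup_right (Ideal.subset_span ⟨Fintype.equivFin σ i, by simp⟩))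
  obtain ⟨y, hy, hrad⟩ := Nat.find_spec hP
  have hmin := fun m => Nat.find_min hP (m := m)
  generalize Nat.find hP = s at *
  refine ⟨s, y, hy, hrad, ?_⟩
  intro d hd Q hQ hQI
  by_contra hQ0
  rcases s with _ | t
  · apply hQ0
    have := hQ.coeff_eq_zero (d := 0) (by simpa using hd.ne)
    ext m
    rw [Subsingleton.elim m 0, this, coeff_zero]
  · obtain ⟨z, hz, hyz⟩ := rel_step y hy Q d hd hQ hQ0
    refine hmin t (Nat.lt_succ_self t) ⟨z, hz, fun i => ?_⟩
    have h1 : I ⊔ Ideal.span (Set.range y) ≤ (I ⊔ Ideal.span (Set.range z)).radical := by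
      refine sup_le (le_trans le_sup_left Ideal.le_radical) ?_
      rw [Ideal.span_le]
      rintro _ ⟨k, rfl⟩
      refine Ideal.radical_mono ?_ (hyz k)
      refine sup_le_sup_right ?_ _
      rw [Ideal.span_singleton_le_iff_mem]; exact hQI
    have h2 := Ideal.radical_mono h1 (hrad i)
    rwa [Ideal.radical_idem] at h2

theorem exists_degree_bound {σ : Type*} [Fintype σ] {K : Type*} [Field K]
    (I : Ideal (MvPolynomial σ K)) (h : ∀ i, X i ∈ I.radical) :
    ∃ N, ∀ M, N ≤ M → ∀ f : MvPolynomial σ K, f.IsHomogeneous M → f ∈ I := by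
  have h1 : Ideal.span (Set.range (X : σ → MvPolynomial σ K)) ≤ I.radical := by
    rw [Ideal.span_le]; rintro _ ⟨i, rfl⟩; exact h i
  obtain ⟨N, hN⟩ := Ideal.exists_pow_le_of_le_radical_of_fg h1 (Submodule.fg_span (Set.finite_range _))
  refine ⟨N, fun M hM f hf => hN (Ideal.pow_le_pow_right hM ?_)⟩
  rw [Ideal.mem_span_pow_iff_exists_isHomogeneous]
  refine ⟨MvPolynomial.map C f, hf.map _, ?_⟩
  rw [eval_map]
  exact eval₂_eta f

theorem exists_linear {σ : Type*} [Fintype σ] [Nonempty σ] {K : Type*} [Field K] [Infinite K]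
    (I : Ideal (MvPolynomial σ K)) (hI : HomI I) (F : MvPolynomial σ K) (δ : ℕ) (hδ : 0 < δ)
    (hF : F.IsHomogeneous δ) (hrad : ∀ i, X i ∈ (I ⊔ Ideal.span {F}).radical) :
    ∃ ℓ : MvPolynomial σ K, ℓ.IsHomogeneous 1 ∧ ℓ ≠ 0 ∧ ∀ i, X i ∈ (I ⊔ Ideal.span {ℓ}).radical := by
  obtain ⟨s, y, hy, hyr, hind⟩ := exists_nn I
  rcases s with _ | _ | s
  · let i := Classical.arbitrary σ
    refine ⟨X i, isHomogeneous_X _ _, X_ne_zero i, fun k => Ideal.radical_mono ?_ (hyr k)⟩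
    refine sup_le le_sup_left ?_
    rw [Ideal.span_le]; rintro _ ⟨k, _⟩; exact k.elim0
  · refine ⟨y 0, hy 0, ?_, fun k => Ideal.radical_mono ?_ (hyr k)⟩
    · intro h
      exact X_ne_zero (R := K) (0 : Fin 1) (hind 1 one_pos (X 0) (isHomogeneous_X _ _) (by simp [h]))
    · refine sup_le_sup_left ?_ _
      rw [Ideal.span_le]; rintro _ ⟨k, rfl⟩
      rw [show k = 0 from Fin.ext (by omega)]; exact Ideal.subset_span rfl
  · exfalso
    obtain ⟨N, hN⟩ := exists_degree_bound _ hrad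
    -- reduction of degree
    have red : ∀ k, ∀ f : MvPolynomial σ K, f.IsHomogeneous (N + k * δ) →
        ∃ b : MvPolynomial σ K, b.IsHomogeneous N ∧ f - b * F ^ k ∈ I := by
      intro k
      induction k with
      | zero => intro f hf; exact ⟨f, by simpa using hf, by simp⟩
      | succ k ih =>
        intro f hf
        have h1 := hN _ (by omega) f hf
        rw [mem_span_pair_iff'] at h1
        obtain ⟨a, ha, b, hb⟩ := h1
        have h2 := congrArg (homogeneousComponent (N + (k + 1) * δ)) hb
        rw [homogeneousComponent_eq_self hf, map_add, homogeneousComponent_mul_homog _ _ _ _ hF,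
          if_pos (by nlinarith)] at h2
        have e : N + (k + 1) * δ - δ = N + k * δ := by
          rw [add_mul, one_mul]; omega
        rw [e] at h2
        obtain ⟨b', hb', hb'I⟩ := ih _ (homogeneousComponent_isHomogeneous (N + k * δ) b)
        refine ⟨b', hb', ?_⟩
        have h3 : f - b' * F ^ (k + 1) = homogeneousComponent (N + (k + 1) * δ) a
            + (homogeneousComponent (N + k * δ) b - b' * F ^ k) * F := by
          rw [h2]; ring
        rw [h3]
        exact I.add_mem (hI a ha _) (I.mul_mem_right _ hb'I)
    let mk : MvPolynomial σ K →ₗ[K] MvPolynomial σ K ⧸ I := (Ideal.Quotient.mkₐ K I).toLinearMap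
    let H := homogeneousSubmodule σ K N
    haveI : Module.Finite K H := by
      rw [Module.Finite.iff_fg]; exact homogeneousSubmodule_fg σ K N
    let k := Module.finrank K H
    let J := N + k * δ
    let T : Submodule K (MvPolynomial σ K ⧸ I) :=
      H.map (mk.comp (LinearMap.mulRight K (F ^ k)))
    have hT : Module.finrank K T ≤ k := Submodule.finrank_map_le _ _
    let mon : Fin (J + 1) → MvPolynomial (Fin (s + 1 + 1)) K := fun i => X 0 ^ (i : ℕ) * X 1 ^ (J - i)
    have hmon : ∀ i, (mon i).IsHomogeneous J := by
      intro i
      have := ((isHomogeneous_X K (0 : Fin (s + 1 + 1))).pow (i : ℕ)).mul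
        ((isHomogeneous_X K (1 : Fin (s + 1 + 1))).pow (J - i))
      convert this using 1
      have := i.2
      omega
    have hmT : ∀ i, mk (aeval y (mon i)) ∈ T := by
      intro i
      have h1 : (aeval y (mon i)).IsHomogeneous J := by
        have := (hmon i).aeval y hy
        rwa [one_mul] at this
      obtain ⟨b, hb, hbI⟩ := red k _ h1
      refine ⟨b, hb, ?_⟩
      have := (Ideal.Quotient.eq).2 hbI
      simp only [mk, LinearMap.comp_apply, LinearMap.mulRight_apply, AlgHom.toLinearMap_apply, Ideal.Quotient.mkₐ_eq_mk]
      exact this.symm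
    have hJ : 0 < J + 1 := Nat.succ_pos _
    have hli0 : LinearIndependent K mon := by
      have : mon = (fun m => monomial m (1 : K)) ∘ (fun i : Fin (J + 1) => Finsupp.single (0 : Fin (s+1+1)) (i : ℕ) + Finsupp.single 1 (J - i)) := by
        funext i
        simp [mon, X_pow_eq_monomial, monomial_mul]
      rw [this]
      refine LinearIndependent.comp ?_ _ ?_
      · exact (basisMonomials _ K).linearIndependent
      · intro a b hab
        have := DFunLike.congr_fun hab 0
        simp at this
        exact Fin.ext this
    have hli : LinearIndependent K (fun i => (⟨mk (aeval y (mon i)), hmT i⟩ : T)) := by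
      rw [Fintype.linearIndependent_iff] at hli0 ⊢
      intro g hg
      apply hli0
      have h1 : mk (aeval y (∑ i, g i • mon i)) = 0 := by
        have := congrArg (Submodule.subtype T) hg
        simpa using this
      have h2 : aeval y (∑ i, g i • mon i) ∈ I := (Ideal.Quotient.eq_zero_iff_mem).1 h1
      by_cases hJ0 : 0 < J
      · refine hind J hJ0 _ ?_ h2
        refine IsHomogeneous.sum _ _ _ fun i _ => ?_
        rw [smul_eq_C_mul]
        simpa using (isHomogeneous_C _ (g i)).mul (hmon i)
      · -- `J = 0` forces `k = 0`, impossible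
        exfalso
        have hN0 : N = 0 := by omega
        have hk : k = 0 := by
          have : k * δ = 0 := by omega
          rcases Nat.mul_eq_zero.1 this with h | h
          · exact h
          · omega
        have : (1 : MvPolynomial σ K) ∈ H := by
          change (1 : MvPolynomial σ K).IsHomogeneous N
          rw [hN0]; exact isHomogeneous_one _ _
        have h0 : Module.finrank K H = 0 := hk
        rw [Submodule.finrank_eq_zero] at h0
        rw [h0] at this
        exact one_ne_zero ((Submodule.mem_bot K).1 this)
    have := hli.fintype_card_le_finrank
    rw [Fintype.card_fin] at this
    have h5 : k ≤ J := by
      have : k * 1 ≤ k * δ := Nat.mul_le_mul_left _ hδ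
      omega
    omega

theorem cm_aux (n : ℕ) {K : Type*} [Field K] [Infinite K] : ∀ (σ : Type) [Fintype σ] [DecidableEq σ]
    (hn : Fintype.card σ = n) (F : ℕ → MvPolynomial σ K)
    (hF : ∀ i < n, ∃ d, 0 < d ∧ (F i).IsHomogeneous d)
    (hrad : ∀ i, X i ∈ (Ik F n).radical),
    ∀ k < n, ∀ a, a * F k ∈ Ik F k → a ∈ Ik F k := by
  induction n with
  | zero => intro σ _ _ _ F _ _ k hk; omega
  | succ m ih =>
    intro σ _ _ hn F hF hrad
    haveI : Nonempty σ := Fintype.card_pos_iff.1 (by omega)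
    have hom : ∀ k ≤ m + 1, HomI (Ik F k) := by
      intro k hk
      apply homI_span
      rintro _ ⟨i, hi, rfl⟩
      obtain ⟨d, -, hd⟩ := hF i (lt_of_lt_of_le hi hk)
      exact ⟨d, hd⟩
    obtain ⟨δ, hδ, hFm⟩ := hF m (Nat.lt_succ_self m)
    obtain ⟨ℓ, hℓ, hℓ0, hℓr⟩ := exists_linear (Ik F m) (hom m (by omega)) (F m) δ hδ hFm
      (by rw [← Ik_succ]; exact hrad)
    obtain ⟨j, π, hπX, hπh, hπℓ, hπk, hπs⟩ := exists_subst ℓ hℓ hℓ0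
    have ih' := ih {i // i ≠ j} (by rw [Fintype.card_subtype_compl]; simp [hn]) (fun i => π (F i))
      (fun i hi => by
        obtain ⟨d, hd, h⟩ := hF i (by omega)
        exact ⟨d, hd, hπh _ _ h⟩)
      (fun i => by
        obtain ⟨t, ht⟩ := hℓr i.1
        rw [mem_span_pair_iff'] at ht
        obtain ⟨b, hb, c, hbc⟩ := ht
        refine ⟨t, ?_⟩
        rw [← hπX i, ← map_pow, hbc, map_add, map_mul, hπℓ, mul_zero, add_zero]
        have := Ideal.mem_map_of_mem π.toRingHom hb
        rw [Ik_map] at this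
        exact this)
    have lift : ∀ k, ∀ c, π c ∈ Ik (fun i => π (F i)) k → ∃ c' ∈ Ik F k, ∃ c'', c = c' + c'' * ℓ := by
      intro k c hc
      have h1 : π c ∈ (Ik F k).map π.toRingHom := by rw [Ik_map]; exact hc
      obtain ⟨c', hc', h2⟩ := (Ideal.mem_map_iff_of_surjective _ hπs).1 h1
      obtain ⟨c'', h3⟩ := hπk (c - c') (by rw [map_sub]; exact sub_eq_zero.2 h2.symm)
      exact ⟨c', hc', c'', by rw [← h3]; ring⟩
    have mapmem : ∀ k b, b ∈ Ik F k → π b ∈ Ik (fun i => π (F i)) k := by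
      intro k b hb
      have := Ideal.mem_map_of_mem π.toRingHom hb
      rw [Ik_map] at this
      exact this
    have s1 : ∀ k ≤ m, ∀ a, ℓ * a ∈ Ik F k → a ∈ Ik F k := by
      intro k
      induction k with
      | zero =>
        intro _ a ha
        rw [Ik_zero, Ideal.mem_bot] at ha ⊢
        exact (mul_eq_zero.1 ha).resolve_left hℓ0
      | succ k ihk =>
        intro hk a ha
        rw [Ik_succ, mem_span_pair_iff'] at ha
        obtain ⟨b, hb, c, hbc⟩ := ha
        have h1 : π c * π (F k) ∈ Ik (fun i => π (F i)) k := by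
          have h2 := congrArg π hbc
          rw [map_mul, hπℓ, zero_mul, map_add, map_mul] at h2
          have : π c * π (F k) = - π b := by linear_combination -h2
          rw [this]
          exact Ideal.neg_mem_iff _ |>.2 (mapmem k b hb)
        obtain ⟨c', hc', c'', hcc⟩ := lift k c (ih' k (by omega) _ h1)
        have h3 : a - c'' * F k ∈ Ik F k := by
          apply ihk (by omega)
          have : ℓ * (a - c'' * F k) = b + c' * F k := by
            rw [hcc] at hbc; linear_combination hbc
          rw [this]
          exact Ideal.add_mem _ hb (Ideal.mul_mem_right _ _ hc')
        rw [Ik_succ, mem_span_pair_iff']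
        exact ⟨_, h3, c'', by ring⟩
    have s1t : ∀ k ≤ m, ∀ t a, ℓ ^ t * a ∈ Ik F k → a ∈ Ik F k := by
      intro k hk t
      induction t with
      | zero => intro a ha; simpa using ha
      | succ t iht =>
        intro a ha
        apply iht
        apply s1 k hk
        rwa [← mul_assoc, ← pow_succ']
    intro k hk a ha
    rcases Nat.lt_succ_iff_lt_or_eq.1 hk with hkm | rfl
    · have claim : ∀ t, ∃ b ∈ Ik F k, ∃ c, a = b + c * ℓ ^ t := by
        intro t
        induction t with
        | zero => exact ⟨0, Ideal.zero_mem _, a, by simp⟩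
        | succ t iht =>
          obtain ⟨b, hb, c, hbc⟩ := iht
          have h1 : c * F k ∈ Ik F k := by
            apply s1t k (by omega) t
            have : ℓ ^ t * (c * F k) = a * F k - b * F k := by rw [hbc]; ring
            rw [this]
            exact Ideal.sub_mem _ ha (Ideal.mul_mem_right _ _ hb)
          have h2 := mapmem k _ h1
          rw [map_mul] at h2
          obtain ⟨c', hc', c'', hcc⟩ := lift k c (ih' k hkm _ h2)
          exact ⟨b + c' * ℓ ^ t, Ideal.add_mem _ hb (Ideal.mul_mem_right _ _ hc'), c'', by
            rw [hbc, hcc]; ring⟩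
      apply mem_of_components
      intro d hd
      obtain ⟨b, hb, c, hbc⟩ := claim (d + 1)
      rw [hbc, map_add, homogeneousComponent_mul_homog _ _ (d + 1) d
        (by simpa using hℓ.pow (d + 1)), if_neg (by omega), add_zero]
      exact hom k (by omega) b hb d
    · have hℓrad : ℓ ∈ (Ik F (k + 1)).radical := by
        have h1 : ℓ ∈ homogeneousSubmodule σ K 1 := hℓ
        rw [homogeneousSubmodule_one_eq_span_X, Submodule.mem_span_range_iff_exists_fun] at h1
        obtain ⟨c, hc⟩ := h1
        rw [← hc]
        refine Ideal.sum_mem _ fun i _ => ?_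
        rw [smul_eq_C_mul]
        exact Ideal.mul_mem_left _ _ (hrad i)
      obtain ⟨t, ht⟩ := hℓrad
      rw [Ik_succ, mem_span_pair_iff'] at ht
      obtain ⟨b, hb, c, hbc⟩ := ht
      apply s1t k le_rfl t
      have : ℓ ^ t * a = a * b + c * (a * F k) := by rw [hbc]; ring
      rw [this]
      exact Ideal.add_mem _ (Ideal.mul_mem_left _ _ hb) (Ideal.mul_mem_left _ _ ha)
end P1b
end NilpPf

namespace NilpPf
section P1c0

open scoped IntermediateField.algebraAdjoinAdjoin in
theorem formallySmooth_adjoin {K L ι : Type*} [Field K] [CharZero K] [Field L] [Algebra K L]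
    [Algebra.EssFiniteType K L] (y : ι → L) :
    Algebra.FormallySmooth (Algebra.adjoin K (Set.range y)) L := by
  have h1 : Algebra.FormallySmooth (Algebra.adjoin K (Set.range y))
      (IntermediateField.adjoin K (Set.range y)) :=
    .of_isLocalization (nonZeroDivisors _)
  haveI : CharZero L := charZero_of_injective_algebraMap (algebraMap K L).injective
  haveI : Algebra.EssFiniteType (IntermediateField.adjoin K (Set.range y)) L :=
    Algebra.EssFiniteType.of_comp K _ L
  have h2 : Algebra.FormallySmooth (IntermediateField.adjoin K (Set.range y)) L := inferInstance
  haveI : IsScalarTower (Algebra.adjoin K (Set.range y)) (IntermediateField.adjoin K (Set.range y)) L :=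
    IsScalarTower.of_algebraMap_eq fun x => rfl
  exact .comp _ (IntermediateField.adjoin K (Set.range y)) _

theorem exists_section {P L B : Type*} [CommRing P] [CommRing L] [CommRing B] [Algebra P L]
    [Algebra.FormallySmooth P L] (i : P →+* B) (g : B →+* L) (hg : Function.Surjective g)
    (hi : ∀ p, g (i p) = algebraMap P L p) (hn : IsNilpotent (RingHom.ker g)) :
    ∃ f : L →+* B, (∀ x, g (f x) = x) ∧ ∀ p, f (algebraMap P L p) = i p := by
  letI := i.toAlgebra
  let g' : B →ₐ[P] L := { g with commutes' := hi }
  let f := Algebra.FormallySmooth.liftOfSurjective (AlgHom.id P L) g' hg hn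
  refine ⟨f, fun x => ?_, fun p => f.commutes p⟩
  exact Algebra.FormallySmooth.liftOfSurjective_apply (AlgHom.id P L) g' hg hn x

theorem ker_nilp {B L : Type*} [CommRing B] [CommRing L] (g : B →+* L)
    (h : ∀ r s, g r = 0 → g s = 0 → r * s = 0) : IsNilpotent (RingHom.ker g) := by
  refine ⟨2, ?_⟩
  rw [pow_two, Ideal.zero_eq_bot, eq_bot_iff, Ideal.mul_le]
  intro r hr s hs
  rw [Ideal.mem_bot]
  exact h r s hr hs

theorem exists_derivation {K L ι : Type*} [Field K] [CharZero K] [Field L] [Algebra K L]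
    [Algebra.EssFiniteType K L] (y : ι → L) (hy : AlgebraicIndependent K y) (v : ι → L) :
    ∃ δ : Derivation K L L, ∀ j, δ (y j) = v j := by
  haveI := formallySmooth_adjoin (K := K) y
  let a : MvPolynomial ι K →ₐ[K] DualNumber L :=
    aeval (fun j => TrivSqZeroExt.inl (y j) + TrivSqZeroExt.inr (v j))
  let i : Algebra.adjoin K (Set.range y) →ₐ[K] DualNumber L := a.comp hy.aevalEquiv.symm.toAlgHom
  let g : DualNumber L →ₐ[K] L := TrivSqZeroExt.fstHom K L L
  have hi : ∀ p, g (i p) = algebraMap (Algebra.adjoin K (Set.range y)) L p := by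
    intro p
    obtain ⟨q, rfl⟩ := hy.aevalEquiv.surjective p
    have : (g.comp a) = aeval y := by
      apply algHom_ext; intro j
      simp [g, a]
    have h2 := DFunLike.congr_fun this q
    simpa [i] using h2
  have hn : IsNilpotent (RingHom.ker g.toRingHom) := by
    refine ker_nilp _ fun r s hr hs => ?_
    have hr' : r.fst = 0 := hr
    have hs' : s.fst = 0 := hs
    ext <;> simp [hr', hs']
  obtain ⟨f, hf, hfi⟩ := exists_section i.toRingHom g.toRingHom
    (fun x => ⟨TrivSqZeroExt.inl x, by simp [g]⟩) hi hn
  have hfst : ∀ x, (f x).fst = x := hf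
  have hK : ∀ k : K, (f (algebraMap K L k)).snd = 0 := by
    intro k
    have := hfi (algebraMap K _ k)
    have e : algebraMap (Algebra.adjoin K (Set.range y)) L (algebraMap K _ k) = algebraMap K L k := rfl
    rw [e] at this
    rw [this]
    have e2 : i.toRingHom (algebraMap K _ k) = algebraMap K _ k := i.commutes k
    rw [e2]
    simp [TrivSqZeroExt.algebraMap_eq_inl']
  let δ : Derivation K L L := Derivation.mk'
    { toFun := fun x => (f x).snd
      map_add' := fun x y => by simp
      map_smul' := fun k x => by
        rw [Algebra.smul_def, map_mul]
        simp [hK, hfst, Algebra.smul_def] }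
    (fun a b => by
      change (f (a * b)).snd = a • (f b).snd + b • (f a).snd
      rw [map_mul]
      simp [hfst, mul_comm])
  refine ⟨δ, fun j => ?_⟩
  change (f (y j)).snd = v j
  have h1 := hfi ⟨y j, Algebra.subset_adjoin ⟨j, rfl⟩⟩
  have h2 : i.toRingHom ⟨y j, Algebra.subset_adjoin ⟨j, rfl⟩⟩ = a (X j) := by
    change a (hy.aevalEquiv.symm _) = _
    congr 1
    rw [AlgEquiv.symm_apply_eq]
    ext
    simp
  rw [h2] at h1
  have h3 : f (y j) = a (X j) := h1
  rw [h3]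
  simp [a]
end P1c0
end NilpPf

namespace NilpPf
section P1c1
open Matrix

theorem exists_common_kernel {ι L : Type*} [Fintype ι] [DecidableEq ι] [Nonempty ι] [Field L]
    (P Q : Matrix ι ι L) (hc : P * Q = Q * P) (hP : IsNilpotent P) (hQ : IsNilpotent Q) :
    ∃ v : ι → L, v ≠ 0 ∧ P *ᵥ v = 0 ∧ Q *ᵥ v = 0 := by
  classical
  have h1 : ∃ a, P ^ (a + 1) = 0 := by
    obtain ⟨a, ha⟩ := hP
    exact ⟨a, by rw [pow_succ, ha, zero_mul]⟩
  obtain ⟨a, ha, ha'⟩ : ∃ a, P ^ (a + 1) = 0 ∧ P ^ a ≠ 0 := by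
    refine ⟨Nat.find h1, Nat.find_spec h1, ?_⟩
    rcases h : Nat.find h1 with _ | k
    · simp
    · exact Nat.find_min h1 (by omega)
  have h2 : ∃ b, Q ^ (b + 1) * P ^ a = 0 := by
    obtain ⟨b, hb⟩ := hQ
    exact ⟨b, by rw [pow_succ, hb, zero_mul, zero_mul]⟩
  obtain ⟨b, hb, hb'⟩ : ∃ b, Q ^ (b + 1) * P ^ a = 0 ∧ Q ^ b * P ^ a ≠ 0 := by
    refine ⟨Nat.find h2, Nat.find_spec h2, ?_⟩
    rcases h : Nat.find h2 with _ | k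
    · simpa using ha'
    · exact Nat.find_min h2 (by omega)
  obtain ⟨i, j, hij⟩ : ∃ i j, (Q ^ b * P ^ a) i j ≠ 0 := by
    by_contra h
    push Not at h
    exact hb' (by ext i j; simpa using h i j)
  refine ⟨fun k => (Q ^ b * P ^ a) k j, fun h => hij (congrFun h i), ?_, ?_⟩
  · have : P * (Q ^ b * P ^ a) = 0 := by
      have hcc : Commute P (Q ^ b) := (show Commute P Q from hc).pow_right b
      rw [← mul_assoc, hcc.eq, mul_assoc, ← pow_succ', ha, mul_zero]
    ext k
    exact congrFun (congrFun this k) j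
  · have : Q * (Q ^ b * P ^ a) = 0 := by
      rw [← mul_assoc, ← pow_succ', hb]
    ext k
    exact congrFun (congrFun this k) j

theorem map_deriv_mul {K L ι : Type*} [CommRing K] [CommRing L] [Algebra K L] {ι κ μ : Type*} [Fintype κ]
    (δ : Derivation K L L)
    (P : Matrix ι κ L) (Q : Matrix κ μ L) : (P * Q).map δ = P.map δ * Q + P * Q.map δ := by
  ext i j
  simp only [map_apply, mul_apply, Matrix.add_apply, map_sum, Derivation.leibniz, smul_eq_mul]
  rw [← Finset.sum_add_distrib]
  refine Finset.sum_congr rfl fun k _ => by ring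

theorem sub_mul_of_col {ι L : Type*} [Fintype ι] [DecidableEq ι] [CommRing L] (k : ι)
    (P Q : Matrix ι ι L) (h : ∀ i, P i k = 0) :
    (P * Q).submatrix (Subtype.val : {i // i ≠ k} → ι) (Subtype.val : {i // i ≠ k} → ι) =
    P.submatrix (Subtype.val : {i // i ≠ k} → ι) (Subtype.val : {i // i ≠ k} → ι) *
    Q.submatrix (Subtype.val : {i // i ≠ k} → ι) (Subtype.val : {i // i ≠ k} → ι) := by
  ext i j
  simp only [submatrix_apply, mul_apply]
  rw [← Finset.add_sum_erase _ _ (Finset.mem_univ k), h, zero_mul, zero_add]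
  rw [← Finset.sum_subtype (Finset.univ.erase k) (by simp) (fun x => P i x * Q x j)]

theorem trace_deriv_aux (N : ℕ) {K L : Type*} [CommRing K] [Field L] [Algebra K L]
    (δ : Derivation K L L) : ∀ (ι : Type) [Fintype ι] [DecidableEq ι] (hN : Fintype.card ι = N)
    (P Q : Matrix ι ι L) (hc : P * Q = Q * P) (hP : IsNilpotent P) (hQ : IsNilpotent Q),
    (P.map δ * Q).trace = 0 := by
  induction N with
  | zero =>
    intro ι _ _ hN P Q _ _ _
    haveI : IsEmpty ι := Fintype.card_eq_zero_iff.1 hN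
    simp [trace]
  | succ N ih =>
    intro ι _ _ hN P Q hc hP hQ
    haveI : Nonempty ι := Fintype.card_pos_iff.1 (by omega)
    obtain ⟨v, hv0, hPv, hQv⟩ := exists_common_kernel P Q hc hP hQ
    obtain ⟨k, hk⟩ : ∃ k, v k ≠ 0 := by
      by_contra h; push Not at h; exact hv0 (_root_.funext h)
    let g : Matrix ι ι L := (1 : Matrix ι ι L).updateCol k v
    have hdet : g.det = v k := by
      have : cramer (1 : Matrix ι ι L) v k = g.det := rfl
      rw [← this, cramer_one]; rfl
    have hgu : IsUnit g.det := by rw [hdet]; exact isUnit_iff_ne_zero.2 hk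
    let gi := g⁻¹
    have hgg : g * gi = 1 := mul_nonsing_inv _ hgu
    have hgg' : gi * g = 1 := nonsing_inv_mul _ hgu
    have hcol : ∀ R : Matrix ι ι L, R *ᵥ v = 0 → ∀ i, (gi * R * g) i k = 0 := by
      intro R hR i
      have h1 : ∀ i, (R * g) i k = 0 := by
        intro i
        rw [mul_apply]
        have := congrFun hR i
        simpa [g, mulVec, dotProduct] using this
      rw [mul_assoc, mul_apply]
      simp [h1]
    let P' := gi * P * g
    let Q' := gi * Q * g
    have hc' : P' * Q' = Q' * P' := by
      calc gi * P * g * (gi * Q * g) = gi * P * (g * gi) * Q * g := by noncomm_ring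
        _ = gi * (P * Q) * g := by rw [hgg]; noncomm_ring
        _ = gi * (Q * P) * g := by rw [hc]
        _ = gi * Q * (g * gi) * P * g := by rw [hgg]; noncomm_ring
        _ = gi * Q * g * (gi * P * g) := by noncomm_ring
    have hpow : ∀ (R : Matrix ι ι L) m, (gi * R * g) ^ m = gi * R ^ m * g := by
      intro R m
      induction m with
      | zero => simp [hgg']
      | succ m ihm =>
        rw [pow_succ, ihm, pow_succ]
        calc gi * R ^ m * g * (gi * R * g) = gi * R ^ m * (g * gi) * R * g := by noncomm_ring
          _ = _ := by rw [hgg]; noncomm_ring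
    -- conjugation invariance
    have hconj : (P.map δ * Q).trace = (P'.map δ * Q').trace := by
      have hP1 : P = g * P' * gi := by
        calc P = 1 * P * 1 := by simp
          _ = (g * gi) * P * (g * gi) := by rw [hgg]
          _ = _ := by simp only [P']; noncomm_ring
      have hQ1 : Q = g * Q' * gi := by
        calc Q = 1 * Q * 1 := by simp
          _ = (g * gi) * Q * (g * gi) := by rw [hgg]
          _ = _ := by simp only [Q']; noncomm_ring
      have hd0 : gi.map δ = - (gi * g.map δ * gi) := by
        have h1 : g.map δ * gi + g * gi.map δ = 0 := by
          rw [← map_deriv_mul (ι := ι), hgg]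
          ext i j; by_cases h : i = j
          · subst h; simp
          · simp [h]
        calc gi.map δ = gi * g * gi.map δ := by rw [hgg']; simp
          _ = gi * (g * gi.map δ) := by noncomm_ring
          _ = gi * (-(g.map δ * gi)) := by rw [eq_neg_of_add_eq_zero_right h1]
          _ = _ := by noncomm_ring
      have hPd : P.map δ = g * P'.map δ * gi + (g.map δ * P' * gi - g * P' * gi * g.map δ * gi) := by
        conv_lhs => rw [hP1]
        rw [map_deriv_mul (ι := ι), map_deriv_mul (ι := ι), hd0]
        noncomm_ring
      have e1 : g * P'.map δ * gi * (g * Q' * gi) = g * (P'.map δ * Q') * gi := by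
        calc _ = g * P'.map δ * (gi * g) * Q' * gi := by noncomm_ring
          _ = _ := by rw [hgg']; noncomm_ring
      have e2 : g.map δ * P' * gi * (g * Q' * gi) = g.map δ * (P' * Q' * gi) := by
        calc _ = g.map δ * P' * (gi * g) * Q' * gi := by noncomm_ring
          _ = _ := by rw [hgg']; noncomm_ring
      have e3 : g * P' * gi * g.map δ * gi * (g * Q' * gi) = (g * P') * (gi * g.map δ * Q' * gi) := by
        calc _ = g * P' * gi * g.map δ * (gi * g) * Q' * gi := by noncomm_ring
          _ = _ := by rw [hgg']; noncomm_ring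
      have e4 : (g * P' * (gi * g.map δ * Q' * gi)).trace = (g.map δ * (P' * Q' * gi)).trace := by
        rw [Matrix.trace_mul_comm]
        calc (gi * g.map δ * Q' * gi * (g * P')).trace = (gi * g.map δ * Q' * (gi * g) * P').trace := by
              congr 1; noncomm_ring
          _ = (gi * (g.map δ * (Q' * P'))).trace := by rw [hgg']; congr 1; noncomm_ring
          _ = ((g.map δ * (Q' * P')) * gi).trace := Matrix.trace_mul_comm _ _
          _ = _ := by rw [← hc']; congr 1; noncomm_ring
      have e5 : (g * (P'.map δ * Q') * gi).trace = (P'.map δ * Q').trace := by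
        rw [Matrix.trace_mul_comm, ← mul_assoc, hgg', one_mul]
      rw [hPd, hQ1, add_mul, sub_mul, e1, e2, e3, trace_add, trace_sub, e4, e5]
      simp
    rw [hconj]
    have hPk : ∀ i, P' i k = 0 := hcol P hPv
    have hQk : ∀ i, Q' i k = 0 := hcol Q hQv
    let s := fun R : Matrix ι ι L => R.submatrix (Subtype.val : {i // i ≠ k} → ι) (Subtype.val : {i // i ≠ k} → ι)
    have hspow : ∀ R : Matrix ι ι L, (∀ i, R i k = 0) → ∀ m, s (R ^ m) = (s R) ^ m := by
      intro R hR m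
      induction m with
      | zero => ext i j; simp [s, Matrix.one_apply, Subtype.ext_iff]
      | succ m ihm => rw [pow_succ', pow_succ', ← ihm]; exact sub_mul_of_col k R _ hR
    have hsn : ∀ R : Matrix ι ι L, R *ᵥ v = 0 → IsNilpotent R → IsNilpotent (s (gi * R * g)) := by
      rintro R hR ⟨m, hm⟩
      refine ⟨m, ?_⟩
      rw [← hspow _ (hcol R hR), hpow, hm]
      simp [s]
    have h1 := ih {i // i ≠ k} (by rw [Fintype.card_subtype_compl]; simp [hN]) (s P') (s Q')
      (by
        rw [← sub_mul_of_col k P' Q' hPk, ← sub_mul_of_col k Q' P' hQk, hc'])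
      (hsn P hPv hP) (hsn Q hQv hQ)
    rw [← h1]
    have h2 : ∀ i, (P'.map δ) i k = 0 := fun i => by rw [map_apply, hPk, map_zero]
    have h3 := sub_mul_of_col k (P'.map δ) Q' h2
    have h4 : (s P').map δ * s Q' = s (P'.map δ * Q') := h3.symm
    rw [h4, trace, trace, ← Finset.add_sum_erase _ _ (Finset.mem_univ k)]
    have h5 : (P'.map δ * Q').diag k = 0 := by
      rw [diag_apply, mul_apply]
      refine Finset.sum_eq_zero fun j _ => ?_
      rw [hQk, mul_zero]
    rw [h5, zero_add]
    exact Finset.sum_subtype (Finset.univ.erase k) (by simp) (fun x => (P'.map δ * Q').diag x)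
end P1c1
end NilpPf

namespace NilpPf
section P1c2
open Matrix Module

theorem exists_det_ne_zero {m ν R : Type*} [Fintype m] [DecidableEq m] [Fintype ν] [DecidableEq ν]
    [CommRing R] [Nontrivial R] (A : Matrix m ν R) (C : Matrix ν m R) (h : A * C = 1) :
    ∃ ω : m → ν, (A.submatrix id ω).det ≠ 0 := by
  by_contra hcon
  push Not at hcon
  have h1 : ((A * C)ᵀ).det = 0 := by
    have : (A * C)ᵀ = fun p => ∑ x : ν, C x p • (fun q => A q x) := by
      ext p q
      simp [mul_apply, mul_comm]
    change detRowAlternating ((A * C)ᵀ) = 0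
    rw [this]
    change (detRowAlternating : (m → R) [⋀^m]→ₗ[R] R).toMultilinearMap _ = 0
    rw [MultilinearMap.map_sum]
    refine Finset.sum_eq_zero fun ω _ => ?_
    rw [MultilinearMap.map_smul_univ]
    have h2 : (detRowAlternating : (m → R) [⋀^m]→ₗ[R] R).toMultilinearMap
        (fun i => fun q => A q (ω i)) = 0 := by
      have := hcon ω
      rw [← det_transpose] at this
      exact this
    rw [h2, smul_zero]
  rw [det_transpose, h, det_one] at h1
  exact one_ne_zero h1

theorem filt_bound {L V U : Type*} [Field L] [AddCommGroup V] [Module L V] [FiniteDimensional L V]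
    [AddCommGroup U] [Module L U] [FiniteDimensional L U] (F : ℕ → Submodule L V)
    (hF0 : F 0 = ⊥) (hmono : Monotone F) (T : U →ₗ[L] V →ₗ[L] V) (e : ℕ)
    (hT : ∀ u, ∀ i < e, ∀ v ∈ F (i + 1), T u v ∈ F i) :
    ∃ N : Submodule L U, (∀ u ∈ N, ∀ v ∈ F e, T u v = 0) ∧
    finrank L U ≤ finrank L N +
      ∑ i ∈ Finset.range e, (finrank L (F (i + 1)) - finrank L (F i)) * finrank L (F i) := by
  induction e with
  | zero =>
    refine ⟨⊤, ?_, by simp⟩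
    intro u _ v hv
    rw [hF0, Submodule.mem_bot] at hv
    simp [hv]
  | succ e ih =>
    obtain ⟨N, hN, hle⟩ := ih (fun u i hi => hT u i (by omega))
    obtain ⟨C, hC⟩ := Submodule.exists_isCompl ((F e).comap (F (e + 1)).subtype)
    have hCf : finrank L C = finrank L (F (e + 1)) - finrank L (F e) := by
      have h1 := Submodule.finrank_add_eq_of_isCompl hC
      have h2 : finrank L ((F e).comap (F (e + 1)).subtype) = finrank L (F e) :=
        LinearEquiv.finrank_eq (Submodule.comapSubtypeEquivOfLe (hmono (Nat.le_succ e)))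
      omega
    let Θ : N →ₗ[L] (C →ₗ[L] F e) :=
      { toFun := fun u => LinearMap.codRestrict (F e) ((T u.1) ∘ₗ (F (e + 1)).subtype ∘ₗ C.subtype)
          (fun c => hT u.1 e (by omega) _ c.1.2)
        map_add' := by intros; ext; simp
        map_smul' := by intros; ext; simp }
    refine ⟨(LinearMap.ker Θ).map N.subtype, ?_, ?_⟩
    · rintro u hu v hv
      obtain ⟨u', hu', rfl⟩ := Submodule.mem_map.1 hu
      have : (⟨v, hv⟩ : F (e + 1)) ∈ ((F e).comap (F (e + 1)).subtype) ⊔ C := by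
        rw [hC.sup_eq_top]; trivial
      obtain ⟨x, hx, c, hc, hxc⟩ := Submodule.mem_sup.1 this
      have hv' : v = x.1 + c.1 := (congrArg Subtype.val hxc).symm
      rw [hv', map_add]
      have h1 : T (N.subtype u') x.1 = 0 := hN _ u'.2 _ hx
      have h2 : T (N.subtype u') c.1 = 0 := by
        have := LinearMap.congr_fun (LinearMap.mem_ker.1 hu') ⟨c, hc⟩
        exact congrArg Subtype.val this
      rw [h1, h2, add_zero]
    · have h1 := LinearMap.finrank_range_add_finrank_ker Θ
      have h2 : finrank L (LinearMap.range Θ) ≤ finrank L (C →ₗ[L] F e) := Submodule.finrank_le _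
      rw [finrank_linearMap, hCf] at h2
      have h3 : finrank L ((LinearMap.ker Θ).map N.subtype) = finrank L (LinearMap.ker Θ) :=
        (LinearEquiv.finrank_eq (Submodule.equivMapOfInjective _ N.injective_subtype _)).symm
      rw [Finset.sum_range_succ, h3]
      omega

theorem tangent_bound {L P : Type*} [Field L] [Fintype P] [DecidableEq P]
    (T : Submodule L ((P → L) × (P → L))) (C0 CA : Submodule L (P → L))
    (h0 : ∀ t ∈ T, ∀ c ∈ C0, ∑ p, t.1 p * c p = 0)
    (hA : ∀ t ∈ T, t.1 = 0 → t.2 ∈ CA) :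
    finrank L T + finrank L C0 ≤ Fintype.card P + finrank L CA := by
  let π : T →ₗ[L] (P → L) := LinearMap.fst L _ _ ∘ₗ T.subtype
  have h1 := LinearMap.finrank_range_add_finrank_ker π
  have h2 : finrank L (LinearMap.ker π) ≤ finrank L CA := by
    let f : LinearMap.ker π →ₗ[L] CA :=
      LinearMap.codRestrict CA (LinearMap.snd L _ _ ∘ₗ T.subtype ∘ₗ (LinearMap.ker π).subtype)
        (fun t => hA _ t.1.2 (LinearMap.mem_ker.1 t.2))
    refine LinearMap.finrank_le_finrank_of_injective (f := f) ?_
    rw [injective_iff_map_eq_zero]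
    intro t ht
    have e1 : t.1.1.1 = 0 := LinearMap.mem_ker.1 t.2
    have e2 : t.1.1.2 = 0 := congrArg Subtype.val ht
    exact Subtype.ext (Subtype.ext (Prod.ext e1 e2))
  have h3 : finrank L (LinearMap.range π) + finrank L C0 ≤ Fintype.card P := by
    have h4 := Subspace.finrank_add_finrank_dualAnnihilator_eq C0
    rw [finrank_fintype_fun_eq_card] at h4
    rw [← h4, add_comm]
    apply Nat.add_le_add_left
    let D : (P → L) ≃ₗ[L] Dual L (P → L) := (Pi.basisFun L P).toDualEquiv
    have hD : ∀ t c : P → L, D t c = ∑ p, t p * c p := by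
      intro t c
      have : D t c = (Pi.basisFun L P).toDual t c := rfl
      rw [this]
      conv_lhs => rw [← (Pi.basisFun L P).sum_repr c]
      rw [map_sum]
      refine Finset.sum_congr rfl fun p _ => ?_
      rw [map_smul, Basis.toDual_apply_left]
      simp [mul_comm]
    have h5 : (LinearMap.range π).map D.toLinearMap ≤ C0.dualAnnihilator := by
      rintro _ ⟨_, ⟨t, rfl⟩, rfl⟩
      rw [Submodule.mem_dualAnnihilator]
      intro c hc
      exact (hD _ _).trans (h0 _ t.2 c hc)
    rw [LinearEquiv.finrank_eq (Submodule.equivMapOfInjective D.toLinearMap D.injective (LinearMap.range π))]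
    exact Submodule.finrank_mono h5
  omega

theorem num_bound (e : ℕ) (k r : ℕ → ℤ) (h0 : r 0 = k 0) (hle : ∀ i, r i ≤ k i)
    (hke : k e = 0) (hre : r e = 0) (hconv : ∀ i, k (i + 1) - k (i + 2) ≤ k i - k (i + 1)) :
    ∑ i ∈ Finset.range e, (r i - r (i + 1)) * (k 0 - r i) ≤
      ∑ i ∈ Finset.range e, k (i + 1) * (k i - k (i + 1)) ∧
    (∑ i ∈ Finset.range e, (r i - r (i + 1)) * (k 0 - r i) =
      ∑ i ∈ Finset.range e, k (i + 1) * (k i - k (i + 1)) → ∀ i ≤ e, r i = k i) := by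
  set x : ℕ → ℤ := fun i => k i - r i with hx
  have hrx : ∀ i, r i = k i - x i := fun i => by simp [hx]
  have key : ∀ m, 2 * (∑ i ∈ Finset.range m, k (i + 1) * (k i - k (i + 1))) -
      2 * ∑ i ∈ Finset.range m, r (i + 1) * (r i - r (i + 1)) =
      ∑ i ∈ Finset.range m, (x i - x (i + 1)) ^ 2 +
      2 * ∑ i ∈ Finset.range m, x (i + 1) * (k i - 2 * k (i + 1) + k (i + 2)) +
      (x m ^ 2 - 2 * k (m + 1) * x m) - (x 0 ^ 2 - 2 * k 1 * x 0) := by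
    intro m
    induction m with
    | zero => simp
    | succ m ih =>
      simp only [Finset.sum_range_succ]
      have e1 := hrx m
      have e2 := hrx (m + 1)
      rw [e1, e2]
      linear_combination ih
  have tele : ∀ m, ∑ i ∈ Finset.range m, (r i - r (i + 1)) * (k 0 - r i) =
      ∑ i ∈ Finset.range m, r (i + 1) * (r i - r (i + 1)) + k 0 * (r 0 - r m) - r 0 ^ 2 + r m ^ 2 := by
    intro m
    induction m with
    | zero => simp
    | succ m ih =>
      simp only [Finset.sum_range_succ, ih]
      ring
  have hx0 : x 0 = 0 := by simp [hx, h0]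
  have hxe : x e = 0 := by simp [hx, hke, hre]
  have ke := key e
  have te := tele e
  rw [hx0, hxe] at ke
  rw [h0, hre] at te
  have s1 : 0 ≤ ∑ i ∈ Finset.range e, (x i - x (i + 1)) ^ 2 :=
    Finset.sum_nonneg fun i _ => sq_nonneg _
  have s2 : 0 ≤ ∑ i ∈ Finset.range e, x (i + 1) * (k i - 2 * k (i + 1) + k (i + 2)) := by
    refine Finset.sum_nonneg fun i _ => mul_nonneg ?_ ?_
    · have := hle (i + 1); simp [hx]; linarith
    · linarith [hconv i]
  have te' : ∑ i ∈ Finset.range e, (r i - r (i + 1)) * (k 0 - r i) =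
      ∑ i ∈ Finset.range e, r (i + 1) * (r i - r (i + 1)) := by rw [te]; ring
  refine ⟨by rw [te']; linarith, fun heq => ?_⟩
  have s3 : ∑ i ∈ Finset.range e, (x i - x (i + 1)) ^ 2 = 0 := by
    rw [te'] at heq; linarith
  rw [Finset.sum_eq_zero_iff_of_nonneg (fun i _ => sq_nonneg _)] at s3
  have hz : ∀ i ≤ e, x i = 0 := by
    intro i
    induction i with
    | zero => intro _; exact hx0
    | succ i ih =>
      intro hi
      have h1 := s3 i (Finset.mem_range.2 (by omega))
      have h2 := pow_eq_zero_iff (two_ne_zero) |>.1 h1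
      linarith [ih (by omega)]
  intro i hi
  have := hz i hi
  rw [hrx i, this, sub_zero]
end P1c2
end NilpPf

namespace NilpPf
section P1c3
open Matrix Module

abbrev Pr {ν : Type} (lev : ν → ℕ) : Type := {pq : ν × ν // lev pq.1 = lev pq.2 + 1}

def toA {ν : Type} (lev : ν → ℕ) {R : Type*} [Zero R] (a : Pr lev → R) : Matrix ν ν R :=
  fun p q => if h : lev p = lev q + 1 then a ⟨(p, q), h⟩ else 0

def toB {ν : Type} (lev : ν → ℕ) {R : Type*} [Zero R] (b : Pr lev → R) : Matrix ν ν R :=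
  (toA lev b)ᵀ

/-- index set of equations -/
abbrev Eqn {ν : Type} (lev : ν → ℕ) : Type := {pq : ν × ν // lev pq.1 = lev pq.2 ∧ 1 ≤ lev pq.1}

def HasDeg {ν : Type} (lev : ν → ℕ) {R : Type*} [Zero R] (M : Matrix ν ν R) (d : ℤ) : Prop :=
  ∀ p q, (lev p : ℤ) ≠ lev q + d → M p q = 0

variable {ν : Type} {lev : ν → ℕ} {R : Type*} [CommRing R]

theorem hasDeg_toA (a : Pr lev → R) : HasDeg lev (toA lev a) 1 := by
  intro p q h
  simp only [toA]
  rw [dif_neg (by omega)]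

theorem hasDeg_toB (a : Pr lev → R) : HasDeg lev (toB lev a) (-1) := by
  intro p q h
  simp only [toB, transpose_apply]
  exact hasDeg_toA a q p (by omega)

theorem HasDeg.mul [Fintype ν] {M N : Matrix ν ν R} {d d' : ℤ} (hM : HasDeg lev M d)
    (hN : HasDeg lev N d') : HasDeg lev (M * N) (d + d') := by
  intro p q h
  rw [mul_apply]
  refine Finset.sum_eq_zero fun x _ => ?_
  by_cases h1 : (lev p : ℤ) = lev x + d
  · rw [hN x q (by omega), mul_zero]
  · rw [hM p x h1, zero_mul]

theorem hasDeg_one [DecidableEq ν] : HasDeg lev (1 : Matrix ν ν R) 0 := by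
  intro p q h
  rw [one_apply_ne]
  rintro rfl; simp at h

theorem HasDeg.pow [Fintype ν] [DecidableEq ν] {M : Matrix ν ν R} {d : ℤ} (hM : HasDeg lev M d)
    (m : ℕ) : HasDeg lev (M ^ m) (m * d) := by
  induction m with
  | zero => simpa using hasDeg_one
  | succ m ih =>
    rw [pow_succ]
    have := ih.mul hM
    convert this using 1
    push_cast; ring

theorem HasDeg.pow_eq_zero [Fintype ν] [DecidableEq ν] {M : Matrix ν ν R} {d : ℤ}
    (hd : d = 1 ∨ d = -1) (hM : HasDeg lev M d) (e : ℕ) (he : ∀ p, lev p < e) : M ^ e = 0 := by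
  ext p q
  refine hM.pow e p q ?_
  have := he p; have := he q
  rcases hd with rfl | rfl <;> push_cast <;> omega

theorem toA_apply (a : Pr lev → R) (p : Pr lev) : toA lev a p.1.1 p.1.2 = a p := by
  simp only [toA]
  rw [dif_pos p.2]

theorem toB_apply (a : Pr lev → R) (p : Pr lev) : toB lev a p.1.2 p.1.1 = a p := toA_apply a p

theorem trace_toA_toB [Fintype ν] [DecidableEq ν] (a b : Pr lev → R) :
    (toA lev a * toB lev b).trace = ∑ p, a p * b p := by
  simp only [trace, diag_apply, mul_apply, toB, transpose_apply]
  rw [← Fintype.sum_prod_type' (fun p q => toA lev a p q * toA lev b p q)]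
  rw [← Finset.sum_filter_of_ne (p := fun pq : ν × ν => lev pq.1 = lev pq.2 + 1)]
  · rw [Finset.sum_subtype (p := fun pq : ν × ν => lev pq.1 = lev pq.2 + 1) _ (by simp)]
    refine Finset.sum_congr rfl fun x _ => ?_
    rw [toA_apply, toA_apply]
  · intro x _ hx
    by_contra h
    apply hx
    simp only [toA]
    rw [dif_neg h, zero_mul]

theorem toA_add (a b : Pr lev → R) : toA lev (a + b) = toA lev a + toA lev b := by
  ext p q; simp only [toA, Matrix.add_apply]; split_ifs <;> simp

theorem toA_smul (c : R) (a : Pr lev → R) : toA lev (c • a) = c • toA lev a := by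
  ext p q; simp only [toA, Matrix.smul_apply]; split_ifs <;> simp

theorem toB_add (a b : Pr lev → R) : toB lev (a + b) = toB lev a + toB lev b := by
  simp [toB, toA_add]

theorem toB_smul (c : R) (a : Pr lev → R) : toB lev (c • a) = c • toB lev a := by
  simp [toB, toA_smul]

theorem toA_map {R' : Type*} [CommRing R'] (f : R → R') (hf : f 0 = 0) (a : Pr lev → R) :
    (toA lev a).map f = toA lev (f ∘ a) := by
  ext p q; simp only [toA, map_apply]; split_ifs <;> simp [hf]

theorem toB_map {R' : Type*} [CommRing R'] (f : R → R') (hf : f 0 = 0) (a : Pr lev → R) :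
    (toB lev a).map f = toB lev (f ∘ a) := by
  simp [toB, ← toA_map f hf, transpose_map]

/-- partial centralizer -/
def CA [Fintype ν] (A : Matrix ν ν R) (lev : ν → ℕ) : Submodule R (Pr lev → R) where
  carrier := {c | ∀ p p', lev p = lev p' → 1 ≤ lev p → (A * toB lev c) p p' = (toB lev c * A) p p'}
  add_mem' := by
    intro a b ha hb p p' h h'
    rw [toB_add, mul_add, add_mul, Matrix.add_apply, Matrix.add_apply, ha p p' h h', hb p p' h h']
  zero_mem' := by
    intro p p' h h'
    have : toB lev (0 : Pr lev → R) = 0 := by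
      have := toB_smul (lev := lev) (0 : R) (0 : Pr lev → R)
      simpa using this
    rw [this]; simp
  smul_mem' := by
    intro c a ha p p' h h'
    rw [toB_smul, mul_smul_comm, smul_mul_assoc, Matrix.smul_apply, Matrix.smul_apply, ha p p' h h']

def C0 [Fintype ν] (A : Matrix ν ν R) (lev : ν → ℕ) : Submodule R (Pr lev → R) where
  carrier := {c | A * toB lev c = toB lev c * A}
  add_mem' := by
    intro a b (ha : _ = _) (hb : _ = _)
    change _ = _
    rw [toB_add, mul_add, add_mul, ha, hb]
  zero_mem' := by
    have : toB lev (0 : Pr lev → R) = 0 := by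
      have := toB_smul (lev := lev) (0 : R) (0 : Pr lev → R)
      simpa using this
    change _ = _
    rw [this]; simp
  smul_mem' := by
    intro c a (ha : _ = _)
    change _ = _
    rw [toB_smul, mul_smul_comm, smul_mul_assoc, ha]

def Vl (R : Type*) [CommRing R] (lev : ν → ℕ) (i : ℕ) : Submodule R (ν → R) where
  carrier := {v | ∀ p, lev p ≠ i → v p = 0}
  add_mem' := by
    intro a b ha hb p hp
    simp [ha p hp, hb p hp]
  zero_mem' := by intro p _; rfl
  smul_mem' := by
    intro c a ha p hp
    simp [ha p hp]

theorem mulVec_mem_Vl [Fintype ν] {M : Matrix ν ν R} {d : ℤ} (hM : HasDeg lev M d) {i j : ℕ}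
    (hij : (j : ℤ) = i + d) {v : ν → R} (hv : v ∈ Vl R lev i) : M *ᵥ v ∈ Vl R lev j := by
  intro p hp
  simp only [mulVec, dotProduct]
  refine Finset.sum_eq_zero fun q _ => ?_
  by_cases h : lev q = i
  · rw [hM p q (by omega), zero_mul]
  · rw [hv q h, mul_zero]

theorem finrank_Vl {L : Type*} [Field L] [Fintype ν] [DecidableEq ν] (i : ℕ) :
    finrank L (Vl L lev i) = Fintype.card {p // lev p = i} := by
  let f : Vl L lev i ≃ₗ[L] ({p // lev p = i} → L) :=
    { toFun := fun v p => v.1 p.1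
      map_add' := by intros; rfl
      map_smul' := by intros; rfl
      invFun := fun w => ⟨fun p => if h : lev p = i then w ⟨p, h⟩ else 0, by
        intro p hp; simp [hp]⟩
      left_inv := by
        intro v
        ext p
        simp only
        split_ifs with h
        · rfl
        · exact (v.2 p h).symm
      right_inv := by
        intro w
        ext p
        simp [p.2] }
  rw [f.finrank_eq, finrank_fintype_fun_eq_card]

theorem card_fiber_sum [Fintype ν] [DecidableEq ν] (e : ℕ) (P : ν × ν → Prop) [DecidablePred P]
    (g : ℕ → ℕ → Prop) [∀ i j, Decidable (g i j)] (hP : ∀ pq, P pq ↔ g (lev pq.1) (lev pq.2))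
    (hlev : ∀ p, lev p < e) :
    Fintype.card {pq : ν × ν // P pq} = ∑ i ∈ Finset.range e, ∑ j ∈ Finset.range e,
      if g i j then Fintype.card {p // lev p = i} * Fintype.card {p // lev p = j} else 0 := by
  rw [Fintype.card_subtype]
  rw [← Finset.sum_product']
  rw [Finset.card_eq_sum_card_fiberwise (f := fun pq => (lev pq.1, lev pq.2))
    (t := Finset.range e ×ˢ Finset.range e)]
  · refine Finset.sum_congr rfl fun ij _ => ?_
    rw [Finset.filter_filter]
    split_ifs with h
    · rw [Fintype.card_subtype, Fintype.card_subtype, ← Finset.card_product]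
      congr 1
      ext pq
      simp only [Finset.mem_filter, Finset.mem_univ, true_and, Finset.mem_product, hP]
      constructor
      · rintro ⟨_, h2⟩; simp [← h2]
      · rintro ⟨h1, h2⟩; simp [h1, h2, h]
    · rw [Finset.card_eq_zero, Finset.filter_eq_empty_iff]
      rintro pq _ ⟨h1, h2⟩
      rw [hP] at h1
      simp [← h2] at h
      exact h h1
  · intro pq _
    simp [hlev]

theorem card_Pr [Fintype ν] [DecidableEq ν] (e : ℕ) (hlev : ∀ p, lev p < e) :
    Fintype.card (Pr lev) = ∑ i ∈ Finset.range e,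
      Fintype.card {p // lev p = i + 1} * Fintype.card {p // lev p = i} := by
  rw [card_fiber_sum e _ (fun i j => i = j + 1) (fun _ => Iff.rfl) hlev, Finset.sum_comm]
  refine Finset.sum_congr rfl fun j hj => ?_
  rw [Finset.sum_ite_eq']
  split_ifs with h
  · rfl
  · have : IsEmpty {p // lev p = j + 1} := ⟨fun p => by
      have := hlev p.1; have := p.2; simp at h; omega⟩
    simp

theorem card_Eqn [Fintype ν] [DecidableEq ν] (e : ℕ) (hlev : ∀ p, lev p < e) :
    Fintype.card (Eqn lev) = ∑ i ∈ Finset.range e,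
      Fintype.card {p // lev p = i + 1} * Fintype.card {p // lev p = i + 1} := by
  rw [card_fiber_sum e _ (fun i j => i = j ∧ 1 ≤ i) (fun _ => Iff.rfl) hlev]
  have h1 : ∀ i ∈ Finset.range e, (∑ j ∈ Finset.range e,
      if i = j ∧ 1 ≤ i then Fintype.card {p // lev p = i} * Fintype.card {p // lev p = j} else 0) =
      if 1 ≤ i then Fintype.card {p // lev p = i} * Fintype.card {p // lev p = i} else 0 := by
    intro i hi
    rw [Finset.sum_eq_single i]
    · simp
    · intro j _ hj; rw [if_neg]; rintro ⟨rfl, _⟩; exact hj rfl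
    · intro h; exact absurd hi h
  rw [Finset.sum_congr rfl h1]
  have h2 := Finset.sum_range_succ' (fun i => if 1 ≤ i then
    Fintype.card {p // lev p = i} * Fintype.card {p // lev p = i} else 0) e
  rw [Finset.sum_range_succ] at h2
  have h3 : IsEmpty {p // lev p = e} := ⟨fun p => by have := hlev p.1; have := p.2; omega⟩
  simp at h2
  rw [← h2]
end P1c3
end NilpPf

namespace NilpPf
section P1c4
open Matrix Module

theorem commute_CA {ν : Type} {lev : ν → ℕ} [Fintype ν] {L : Type*} [Field L]
    (a c : Pr lev → L) (hc : c ∈ CA (toA lev a) lev) (v : ν → L) (hv : ∀ p, lev p = 0 → v p = 0) :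
    toA lev a *ᵥ (toB lev c *ᵥ v) = toB lev c *ᵥ (toA lev a *ᵥ v) := by
  rw [mulVec_mulVec, mulVec_mulVec]
  ext p
  simp only [mulVec, dotProduct]
  refine Finset.sum_congr rfl fun q _ => ?_
  by_cases h : lev q = 0
  · rw [hv q h]; simp
  · congr 1
    by_cases h1 : lev p = lev q
    · exact hc p q h1 (by omega)
    · rw [((hasDeg_toA a).mul (hasDeg_toB c)) p q (by simp; exact_mod_cast h1),
        ((hasDeg_toB c).mul (hasDeg_toA a)) p q (by simp; exact_mod_cast h1)]

theorem lin_bound {ν : Type} {lev : ν → ℕ} [Fintype ν] [DecidableEq ν] (e : ℕ)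
    (hlev : ∀ p, lev p < e)
    (hconv : ∀ i, (Fintype.card {p // lev p = i + 1} : ℤ) - Fintype.card {p // lev p = i + 2} ≤
      Fintype.card {p // lev p = i} - Fintype.card {p // lev p = i + 1})
    {L : Type*} [Field L] (a : Pr lev → L) :
    finrank L (CA (toA lev a) lev) + Fintype.card (Eqn lev) ≤
      finrank L (C0 (toA lev a) lev) + Fintype.card (Pr lev) ∧
    (finrank L (CA (toA lev a) lev) + Fintype.card (Eqn lev) =
      finrank L (C0 (toA lev a) lev) + Fintype.card (Pr lev) →
      ∃ ω : {p // 1 ≤ lev p} → ν, ((toA lev a).submatrix Subtype.val ω).det ≠ 0) := by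
  set A := toA lev a with hA
  set k : ℕ → ℕ := fun i => Fintype.card {p // lev p = i} with hk
  have hAe : A ^ e = 0 := HasDeg.pow_eq_zero (Or.inl rfl) (hasDeg_toA a) e hlev
  let F : ℕ → Submodule L (ν → L) := fun i => Vl L lev 0 ⊓ LinearMap.ker (A ^ i).mulVecLin
  have hFmem : ∀ i v, v ∈ F i ↔ v ∈ Vl L lev 0 ∧ (A ^ i) *ᵥ v = 0 := by
    intro i v
    simp [F]
  have hF0 : F 0 = ⊥ := by
    rw [eq_bot_iff]
    intro v hv
    have := ((hFmem 0 v).1 hv).2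
    simpa using this
  have hmono : Monotone F := by
    refine monotone_nat_of_le_succ fun i v hv => ?_
    rw [hFmem] at hv ⊢
    refine ⟨hv.1, ?_⟩
    rw [pow_succ', ← mulVec_mulVec, hv.2, mulVec_zero]
  have hFe : F e = Vl L lev 0 := by
    ext v
    rw [hFmem, hAe]
    simp
  let T : (CA A lev) →ₗ[L] (ν → L) →ₗ[L] (ν → L) :=
    { toFun := fun c => (toB lev c.1 * A).mulVecLin
      map_add' := by
        intro x y
        ext1 v
        simp [toB_add, add_mul]
      map_smul' := by
        intro x y
        ext1 v
        simp [toB_smul] }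
  have hT : ∀ u, ∀ i < e, ∀ v ∈ F (i + 1), T u v ∈ F i := by
    intro u i hi v hv
    rw [hFmem] at hv ⊢
    have e1 : T u v = toB lev u.1 *ᵥ (A *ᵥ v) := by simp [T]
    rw [e1]
    have hAv : A *ᵥ v ∈ Vl L lev 1 := mulVec_mem_Vl (hasDeg_toA a) (by simp) hv.1
    refine ⟨mulVec_mem_Vl (hasDeg_toB _) (by simp) hAv, ?_⟩
    have key : ∀ j, (A ^ j) *ᵥ (toB lev u.1 *ᵥ (A *ᵥ v)) = toB lev u.1 *ᵥ ((A ^ (j + 1)) *ᵥ v) := by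
      intro j
      induction j with
      | zero => simp
      | succ j ih =>
        rw [pow_succ', ← mulVec_mulVec, ih]
        rw [commute_CA a u.1 u.2]
        · congr 1
          rw [mulVec_mulVec, ← pow_succ']
        · intro p hp
          have : (A ^ (j + 1)) *ᵥ v ∈ Vl L lev (j + 1) :=
            mulVec_mem_Vl ((hasDeg_toA a).pow (j + 1)) (by push_cast; ring) hv.1
          exact this p (by omega)
    rw [key, hv.2, mulVec_zero]
  obtain ⟨N, hN, hle⟩ := filt_bound F hF0 hmono T e hT
  have hNC : finrank L N ≤ finrank L (C0 A lev) := by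
    have : N.map (CA A lev).subtype ≤ C0 A lev := by
      rintro _ ⟨u, hu, rfl⟩
      change A * toB lev u.1 = toB lev u.1 * A
      ext p q
      by_cases h1 : lev p = lev q
      · by_cases h2 : 1 ≤ lev p
        · exact u.2 p q h1 h2
        · have e1 : (A * toB lev u.1) p q = 0 := by
            rw [mul_apply]
            refine Finset.sum_eq_zero fun x _ => ?_
            rw [hasDeg_toB u.1 x q (by omega), mul_zero]
          have hs : Pi.single q (1 : L) ∈ F e := by
            rw [hFe]
            intro x hx
            rw [Pi.single_eq_of_ne]
            rintro rfl
            omega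
          have e2 := congrFun (hN u hu _ hs) p
          rw [e1]
          have e3 : (T u) (Pi.single q 1) p = (toB lev u.1 * A) p q := by
            change ((toB lev u.1 * A) *ᵥ Pi.single q 1) p = _
            rw [mulVec_single_one]; rfl
          rw [← e3]; exact e2.symm
      · rw [((hasDeg_toA a).mul (hasDeg_toB u.1)) p q (by simp; exact_mod_cast h1),
        ((hasDeg_toB u.1).mul (hasDeg_toA a)) p q (by simp; exact_mod_cast h1)]
    have h2 := Submodule.finrank_mono this
    rwa [← LinearEquiv.finrank_eq (Submodule.equivMapOfInjective _ (Submodule.injective_subtype _) N)] at h2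
  -- dimensions
  let W : ℕ → Submodule L (ν → L) := fun i => (Vl L lev 0).map (A ^ i).mulVecLin
  have hW : ∀ i, W i ≤ Vl L lev i := by
    rintro i _ ⟨v, hv, rfl⟩
    exact mulVec_mem_Vl ((hasDeg_toA a).pow i) (by push_cast; ring) hv
  have hdim : ∀ i, finrank L (W i) + finrank L (F i) = k 0 := by
    intro i
    have h1 := LinearMap.finrank_range_add_finrank_ker ((A ^ i).mulVecLin.domRestrict (Vl L lev 0))
    rw [finrank_Vl] at h1
    refine Eq.trans ?_ h1
    congr 1
    · rw [LinearMap.range_domRestrict]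
    · have : F i = (LinearMap.ker ((A ^ i).mulVecLin.domRestrict (Vl L lev 0))).map
          (Vl L lev 0).subtype := by
        ext v
        rw [hFmem]
        constructor
        · rintro ⟨h1, h2⟩
          exact ⟨⟨v, h1⟩, by simpa using h2, rfl⟩
        · rintro ⟨w, h1, rfl⟩
          exact ⟨w.2, by simpa using h1⟩
      rw [this]
      exact (LinearEquiv.finrank_eq (Submodule.equivMapOfInjective _ (Submodule.injective_subtype _) _)).symm
  have hWk : ∀ i, finrank L (W i) ≤ k i := by
    intro i
    exact (Submodule.finrank_mono (hW i)).trans_eq (finrank_Vl i)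
  have hke : k e = 0 := by
    have h3 : IsEmpty {p // lev p = e} := ⟨fun p => by have := hlev p.1; have := p.2; omega⟩
    simp [hk]
  have hnum := num_bound e (fun i => (k i : ℤ)) (fun i => (finrank L (W i) : ℤ))
    (by
      have h1 := hdim 0
      rw [hF0] at h1
      simp at h1
      simp [h1])
    (fun i => by exact_mod_cast hWk i) (by simp [hke])
    (by have := hWk e; rw [hke] at this; simpa using this) hconv
  have hsum : ((∑ i ∈ Finset.range e, (finrank L (F (i + 1)) - finrank L (F i)) * finrank L (F i) : ℕ) : ℤ)
      = ∑ i ∈ Finset.range e, ((finrank L (W i) : ℤ) - finrank L (W (i + 1))) * (k 0 - finrank L (W i)) := by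
    rw [Nat.cast_sum]
    refine Finset.sum_congr rfl fun i _ => ?_
    have h1 := hdim i
    have h2 := hdim (i + 1)
    have h3 : finrank L (F i) ≤ finrank L (F (i + 1)) := Submodule.finrank_mono (hmono (Nat.le_succ i))
    rw [Nat.cast_mul, Nat.cast_sub h3]
    congr 1 <;> omega
  have hφ : ∑ i ∈ Finset.range e, (k (i + 1) : ℤ) * (k i - k (i + 1)) =
      (Fintype.card (Pr lev) : ℤ) - Fintype.card (Eqn lev) := by
    rw [card_Pr e hlev, card_Eqn e hlev]
    push_cast
    rw [← Finset.sum_sub_distrib]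
    refine Finset.sum_congr rfl fun i _ => ?_
    simp only [hk]; ring
  rw [hφ, ← hsum] at hnum
  refine ⟨by have := hnum.1; omega, fun heq => ?_⟩
  have hWeq := hnum.2 (by have := hnum.1; omega)
  have hWtop : ∀ i ≤ e, W i = Vl L lev i := by
    intro i hi
    refine Submodule.eq_of_le_of_finrank_eq (hW i) ?_
    rw [finrank_Vl]
    exact_mod_cast hWeq i hi
  have hex : ∀ p : {p // 1 ≤ lev p}, ∃ v : ν → L, A *ᵥ v = Pi.single p.1 1 := by
    intro p
    have h1 : (Pi.single p.1 1 : ν → L) ∈ W (lev p.1) := by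
      rw [hWtop _ (hlev p.1).le]
      intro x hx
      rw [Pi.single_eq_of_ne]
      rintro rfl; exact hx rfl
    obtain ⟨v, _, hv⟩ := h1
    obtain ⟨m, hm⟩ := Nat.exists_eq_add_of_le p.2
    refine ⟨(A ^ m) *ᵥ v, ?_⟩
    rw [mulVec_mulVec, ← pow_succ', ← hv, hm, add_comm]
    rfl
  choose w hw using hex
  obtain ⟨ω, hω⟩ := exists_det_ne_zero (A.submatrix (Subtype.val : {p // 1 ≤ lev p} → ν) id)
    (Matrix.of fun x p => w p x) (by
      ext p q
      have := congrFun (hw q) p.1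
      rw [mul_apply]
      simp only [mulVec, dotProduct] at this
      simp only [submatrix_apply, id, of_apply]
      rw [this, one_apply]
      by_cases h : p = q
      · subst h; simp
      · rw [if_neg h, Pi.single_eq_of_ne]
        exact fun h' => h (Subtype.ext h'))
  exact ⟨ω, hω⟩
end P1c4
end NilpPf

namespace NilpPf
section P1c5
open Matrix Module

theorem field_bound {ν : Type} {lev : ν → ℕ} [Fintype ν] [DecidableEq ν] (e : ℕ)
    (hlev : ∀ p, lev p < e) {K L : Type*} [Field K] [CharZero K] [Field L] [Algebra K L]
    [Algebra.EssFiniteType K L] (a b : Pr lev → L)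
    (hab : ∀ p p', lev p = lev p' → 1 ≤ lev p →
      (toA lev a * toB lev b) p p' = (toB lev b * toA lev a) p p')
    {s : ℕ} (c : Fin s → (Pr lev ⊕ Pr lev) → K)
    (hy : AlgebraicIndependent K (fun j => ∑ q, c j q • Sum.elim a b q)) :
    s + finrank L (C0 (toA lev a) lev) ≤ Fintype.card (Pr lev) + finrank L (CA (toA lev a) lev) := by
  have h1 : ∀ i : Fin s, ∃ δ : Derivation K L L,
      ∀ j, δ (∑ q, c j q • Sum.elim a b q) = if i = j then 1 else 0 := by
    intro i
    exact exists_derivation _ hy _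
  choose δ hδ using h1
  let w : Fin s → (Pr lev → L) × (Pr lev → L) := fun i => (δ i ∘ a, δ i ∘ b)
  have hw : LinearIndependent L w := by
    rw [Fintype.linearIndependent_iff]
    intro g hg j
    have e1 : ∀ p, ∑ i, g i * δ i (a p) = 0 := by
      intro p
      have := congrFun (congrArg Prod.fst hg) p
      simpa [w, Prod.fst_sum] using this
    have e2 : ∀ p, ∑ i, g i * δ i (b p) = 0 := by
      intro p
      have := congrFun (congrArg Prod.snd hg) p
      simpa [w, Prod.snd_sum] using this
    have e3 : ∀ q, ∑ i, g i * δ i (Sum.elim a b q) = 0 := by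
      rintro (p | p)
      · exact e1 p
      · exact e2 p
    have e4 : ∑ i, g i * δ i (∑ q, c j q • Sum.elim a b q) = 0 := by
      have : ∀ i, g i * δ i (∑ q, c j q • Sum.elim a b q) =
          ∑ q, c j q • (g i * δ i (Sum.elim a b q)) := by
        intro i
        rw [map_sum, Finset.mul_sum]
        refine Finset.sum_congr rfl fun q _ => ?_
        rw [Derivation.map_smul, mul_smul_comm]
      simp only [this]
      rw [Finset.sum_comm]
      refine Finset.sum_eq_zero fun q _ => ?_
      rw [← Finset.smul_sum, e3, smul_zero]
    simp only [hδ] at e4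
    simpa using e4
  have hf := finrank_span_eq_card hw
  rw [Fintype.card_fin] at hf
  rw [← hf]
  have hδA : ∀ i, (toA lev a).map (δ i) = toA lev (δ i ∘ a) := fun i => toA_map _ (map_zero _) a
  have hδB : ∀ i, (toB lev b).map (δ i) = toB lev (δ i ∘ b) := fun i => toB_map _ (map_zero _) b
  apply tangent_bound
  · intro t ht cc hcc
    induction ht using Submodule.span_induction with
    | mem x hx =>
      obtain ⟨i, rfl⟩ := hx
      change ∑ p, (δ i ∘ a) p * cc p = 0
      rw [← trace_toA_toB, ← hδA]
      refine trace_deriv_aux _ (δ i) ν rfl _ _ hcc ⟨e, ?_⟩ ⟨e, ?_⟩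
      · exact HasDeg.pow_eq_zero (Or.inl rfl) (hasDeg_toA a) e hlev
      · exact HasDeg.pow_eq_zero (Or.inr rfl) (hasDeg_toB cc) e hlev
    | zero => simp
    | add x y _ _ hx hy =>
      simp only [Prod.fst_add, Pi.add_apply, add_mul, Finset.sum_add_distrib, hx, hy, add_zero]
    | smul r x _ hx =>
      simp only [Prod.smul_fst, Pi.smul_apply, smul_eq_mul, mul_assoc, ← Finset.mul_sum, hx, mul_zero]
  · intro t ht ht1
    have key : ∀ p p', lev p = lev p' → 1 ≤ lev p →
        (toA lev t.1 * toB lev b + toA lev a * toB lev t.2) p p' =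
        (toB lev t.2 * toA lev a + toB lev b * toA lev t.1) p p' := by
      intro p p' h h'
      clear ht1
      induction ht using Submodule.span_induction with
      | mem x hx =>
        obtain ⟨i, rfl⟩ := hx
        have := congrArg (δ i) (hab p p' h h')
        rw [← map_apply (f := δ i), ← map_apply (f := δ i), map_deriv_mul (ι := ν), map_deriv_mul (ι := ν),
          hδA, hδB] at this
        exact this
      | zero =>
        have e1 : toB lev (0 : Pr lev → L) = 0 := by
          simpa using toB_smul (lev := lev) (0 : L) (0 : Pr lev → L)
        have e2 : toA lev (0 : Pr lev → L) = 0 := by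
          simpa using toA_smul (lev := lev) (0 : L) (0 : Pr lev → L)
        simp [e1, e2]
      | add x y _ _ hx hy =>
        simp only [Prod.fst_add, Prod.snd_add, toA_add, toB_add, add_mul, mul_add,
          Matrix.add_apply] at hx hy ⊢
        linear_combination hx + hy
      | smul r x _ hx =>
        simp only [Prod.smul_fst, Prod.smul_snd, toA_smul, toB_smul, smul_mul_assoc, mul_smul_comm,
          Matrix.add_apply, Matrix.smul_apply, smul_eq_mul] at hx ⊢
        linear_combination r * hx
    intro p p' h h'
    have := key p p' h h'
    have e2 : toA lev (0 : Pr lev → L) = 0 := by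
      simpa using toA_smul (lev := lev) (0 : L) (0 : Pr lev → L)
    rw [ht1, e2] at this
    simpa using this

/-- generic matrices -/
noncomputable def gA {ν : Type} (lev : ν → ℕ) (K : Type*) [CommRing K] :
    Matrix ν ν (MvPolynomial (Pr lev ⊕ Pr lev) K) := toA lev (fun p => X (Sum.inl p))

noncomputable def gB {ν : Type} (lev : ν → ℕ) (K : Type*) [CommRing K] :
    Matrix ν ν (MvPolynomial (Pr lev ⊕ Pr lev) K) := toB lev (fun p => X (Sum.inr p))

noncomputable def gE {ν : Type} [Fintype ν] (lev : ν → ℕ) (K : Type*) [CommRing K] (q : Eqn lev) :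
    MvPolynomial (Pr lev ⊕ Pr lev) K :=
  (gA lev K * gB lev K) q.1.1 q.1.2 - (gB lev K * gA lev K) q.1.1 q.1.2

noncomputable def idE {ν : Type} [Fintype ν] (lev : ν → ℕ) (K : Type*) [CommRing K] :
    Ideal (MvPolynomial (Pr lev ⊕ Pr lev) K) := Ideal.span (Set.range (gE lev K))

noncomputable def gH {ν : Type} (lev : ν → ℕ) (K : Type*) [CommRing K] [Fintype ν]
    [DecidableEq ν] (ω : {p // 1 ≤ lev p} → ν) : MvPolynomial (Pr lev ⊕ Pr lev) K :=
  ((gA lev K).submatrix Subtype.val ω).det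

theorem linear_form_sum {σ K : Type*} [Fintype σ] [Field K] (ℓ : MvPolynomial σ K)
    (hℓ : ℓ.IsHomogeneous 1) : ∃ c : σ → K, ℓ = ∑ i, c i • X i := by
  have : ℓ ∈ homogeneousSubmodule σ K 1 := hℓ
  rw [homogeneousSubmodule_one_eq_span_X] at this
  obtain ⟨c, hc⟩ := (Submodule.mem_span_range_iff_exists_fun K).1 this
  exact ⟨c, hc.symm⟩

theorem alg_bound {ν : Type} {lev : ν → ℕ} [Fintype ν] [DecidableEq ν] (e : ℕ)
    (hlev : ∀ p, lev p < e)
    (hconv : ∀ i, (Fintype.card {p // lev p = i + 1} : ℤ) - Fintype.card {p // lev p = i + 2} ≤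
      Fintype.card {p // lev p = i} - Fintype.card {p // lev p = i + 1})
    {K : Type*} [Field K] [CharZero K] (I : Ideal (MvPolynomial (Pr lev ⊕ Pr lev) K))
    (hI : idE lev K ≤ I) {s : ℕ} (y : Fin s → MvPolynomial (Pr lev ⊕ Pr lev) K)
    (hy : ∀ i, (y i).IsHomogeneous 1) (hind : ∀ Q : MvPolynomial (Fin s) K, Q ≠ 0 → aeval y Q ∉ I) :
    s + Fintype.card (Eqn lev) ≤ 2 * Fintype.card (Pr lev) ∧
    ((∀ ω, ∃ t, gH lev K ω ^ t ∈ I) → s + Fintype.card (Eqn lev) < 2 * Fintype.card (Pr lev)) := by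
  let S := MvPolynomial (Pr lev ⊕ Pr lev) K
  let W : Submonoid S := (nonZeroDivisors (MvPolynomial (Fin s) K)).map (aeval y : _ →ₐ[K] S)
  have hdisj : Disjoint (I : Set S) W := by
    rw [Set.disjoint_left]
    rintro _ hx ⟨Q, hQ, rfl⟩
    exact hind Q (nonZeroDivisors.ne_zero hQ) hx
  obtain ⟨P, hP, hIP, hPW⟩ := Ideal.exists_le_prime_disjoint I W hdisj
  let L := FractionRing (S ⧸ P)
  let φ : S →ₐ[K] L := (IsScalarTower.toAlgHom K (S ⧸ P) L).comp (Ideal.Quotient.mkₐ K P)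
  have hφ : ∀ f, φ f = 0 ↔ f ∈ P := by
    intro f
    have : φ f = algebraMap (S ⧸ P) L (Ideal.Quotient.mk P f) := rfl
    rw [this, FaithfulSMul.algebraMap_eq_zero_iff, Ideal.Quotient.eq_zero_iff_mem]
  choose c hc using fun i => linear_form_sum (y i) (hy i)
  let a : Pr lev → L := fun p => φ (X (Sum.inl p))
  let b : Pr lev → L := fun p => φ (X (Sum.inr p))
  have hAm : (gA lev K).map φ = toA lev a := toA_map _ (map_zero _) _
  have hBm : (gB lev K).map φ = toB lev b := toB_map _ (map_zero _) _
  have hab : ∀ p p', lev p = lev p' → 1 ≤ lev p →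
      (toA lev a * toB lev b) p p' = (toB lev b * toA lev a) p p' := by
    intro p p' h h'
    have h1 : gE lev K ⟨(p, p'), h, h'⟩ ∈ P := hIP (hI (Ideal.subset_span ⟨_, rfl⟩))
    rw [← hφ, gE, map_sub, sub_eq_zero] at h1
    rw [← hAm, ← hBm]
    have e1 := congrFun (congrFun (Matrix.map_mul (f := φ) (L := gA lev K) (M := gB lev K)) p) p'
    have e2 := congrFun (congrFun (Matrix.map_mul (f := φ) (L := gB lev K) (M := gA lev K)) p) p'
    rw [← e1, ← e2]
    exact h1
  have hyL : AlgebraicIndependent K (fun j => ∑ q, c j q • Sum.elim a b q) := by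
    have : (fun j => ∑ q, c j q • Sum.elim a b q) = fun j => φ (y j) := by
      ext j
      rw [hc j, map_sum]
      refine Finset.sum_congr rfl fun q _ => ?_
      rw [map_smul]
      rcases q with q | q <;> rfl
    rw [this, algebraicIndependent_iff]
    intro Q hQ
    by_contra hQ0
    have e1 : aeval (fun j => φ (y j)) Q = φ (aeval y Q) := by
      rw [← AlgHom.comp_apply, comp_aeval]
    rw [e1, hφ] at hQ
    exact Set.disjoint_left.1 hPW hQ ⟨Q, mem_nonZeroDivisors_of_ne_zero hQ0, rfl⟩
  have h1 := field_bound e hlev a b hab c hyL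
  have h2 := lin_bound e hlev hconv a
  refine ⟨by have := h2.1; omega, fun hω => ?_⟩
  by_contra hcon
  obtain ⟨ω, h3⟩ := h2.2 (by have := h2.1; omega)
  apply h3
  obtain ⟨t, ht⟩ := hω ω
  have h4 := (hφ _).2 (hP.mem_of_pow_mem t (hIP ht))
  rw [← h4, gH]
  have := AlgHom.map_det φ ((gA lev K).submatrix Subtype.val ω)
  rw [this, ← hAm]
  rfl

theorem exists_homog_rel {σ K : Type*} [Field K] (I : Ideal (MvPolynomial σ K)) (hI : HomI I) {s : ℕ}
    (y : Fin s → MvPolynomial σ K) (hy : ∀ i, (y i).IsHomogeneous 1) (Q : MvPolynomial (Fin s) K)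
    (hQ : Q ≠ 0) (hQI : aeval y Q ∈ I) :
    ∃ d, ∃ Q' : MvPolynomial (Fin s) K, Q'.IsHomogeneous d ∧ Q' ≠ 0 ∧ aeval y Q' ∈ I := by
  obtain ⟨d, hd⟩ : ∃ d, homogeneousComponent d Q ≠ 0 := by
    by_contra h
    push Not at h
    apply hQ
    rw [← sum_homogeneousComponent Q]
    exact Finset.sum_eq_zero fun i _ => h i
  refine ⟨d, _, homogeneousComponent_isHomogeneous d Q, hd, ?_⟩
  have h1 := hI _ hQI d
  have h2 : homogeneousComponent d (aeval y Q) = aeval y (homogeneousComponent d Q) := by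
    conv_lhs => rw [← sum_homogeneousComponent Q]
    rw [map_sum, map_sum]
    have h3 : ∀ i, homogeneousComponent d (aeval y (homogeneousComponent i Q)) =
        if i = d then aeval y (homogeneousComponent i Q) else 0 := by
      intro i
      have h4 : (aeval y (homogeneousComponent i Q)).IsHomogeneous i := by
        have := (homogeneousComponent_isHomogeneous i Q).aeval y hy
        rwa [one_mul] at this
      rw [homogeneousComponent_of_mem h4]
      simp [eq_comm]
    simp only [h3]
    rw [Finset.sum_ite_eq']
    split_ifs with h
    · rfl
    · rw [homogeneousComponent_eq_zero d Q (by simpa using h), map_zero]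
  rwa [h2] at h1
end P1c5
end NilpPf

namespace NilpPf
section P1d
open Matrix Module

theorem exists_right_inv {ν : Type} {lev : ν → ℕ} [Fintype ν] [DecidableEq ν] {R : Type*} [CommRing R]
    (a : Pr lev → R) (ω : {p // 1 ≤ lev p} → ν)
    (hu : IsUnit ((toA lev a).submatrix (Subtype.val : {p // 1 ≤ lev p} → ν) ω).det) :
    ∃ C : Matrix ν ν R, HasDeg lev C (-1) ∧ ∀ p q, 1 ≤ lev p → (toA lev a * C) p q = (1 : Matrix ν ν R) p q := by
  set A := toA lev a
  let D := A.submatrix (Subtype.val : {p // 1 ≤ lev p} → ν) ω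
  let W : Matrix ν {p // 1 ≤ lev p} R := fun x p => if ω p = x then 1 else 0
  have h1 : A.submatrix (Subtype.val : {p // 1 ≤ lev p} → ν) id * W = D := by
    ext p q
    rw [mul_apply]
    simp [W, D]
  let C' := W * D⁻¹
  have h2 : A.submatrix (Subtype.val : {p // 1 ≤ lev p} → ν) id * C' = 1 := by
    change A.submatrix (Subtype.val : {p // 1 ≤ lev p} → ν) id * (W * D⁻¹) = 1
    rw [← Matrix.mul_assoc, h1, mul_nonsing_inv _ hu]
  let C : Matrix ν ν R := fun p q => if h : lev q = lev p + 1 then C' p ⟨q, by omega⟩ else 0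
  have hC : HasDeg lev C (-1) := by
    intro p q h
    simp only [C]
    rw [dif_neg (by omega)]
  refine ⟨C, hC, fun p q hp => ?_⟩
  by_cases hpq : lev p = lev q
  · have h3 := congrFun (congrFun h2 ⟨p, hp⟩) ⟨q, by omega⟩
    rw [mul_apply] at h3 ⊢
    have h4 : (1 : Matrix ν ν R) p q = (1 : Matrix {p // 1 ≤ lev p} {p // 1 ≤ lev p} R) ⟨p, hp⟩ ⟨q, by omega⟩ := by
      simp [one_apply, Subtype.ext_iff]
    rw [h4, ← h3]
    refine Finset.sum_congr rfl fun x _ => ?_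
    simp only [submatrix_apply, id]
    by_cases hx : lev p = lev x + 1
    · congr 1
      simp only [C]
      rw [dif_pos (by omega)]
    · have : A p x = 0 := hasDeg_toA a p x (by omega)
      rw [this, zero_mul, zero_mul]
  · rw [(hasDeg_toA a).mul hC p q (by simp; exact_mod_cast hpq), one_apply_ne]
    rintro rfl; exact hpq rfl

theorem exists_section_B {ν : Type} {lev : ν → ℕ} [Fintype ν] [DecidableEq ν] {R : Type*} [CommRing R]
    (e : ℕ) (hlev : ∀ p, lev p < e)
    (a b : Pr lev → R) (ω : {p // 1 ≤ lev p} → ν)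
    (hu : IsUnit ((toA lev a).submatrix (Subtype.val : {p // 1 ≤ lev p} → ν) ω).det)
    (I : Ideal R) (hI : ∀ p p', lev p = lev p' → 1 ≤ lev p →
      (toA lev a * toB lev b) p p' - (toB lev b * toA lev a) p p' ∈ I) :
    ∃ b' : Pr lev → R, (∀ p, b' p - b p ∈ I) ∧ ∀ p p', lev p = lev p' → 1 ≤ lev p →
      (toA lev a * toB lev b') p p' = (toB lev b' * toA lev a) p p' := by
  obtain ⟨C, hC, hAC⟩ := exists_right_inv a ω hu
  set A := toA lev a with hA
  set B := toB lev b with hB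
  have hAd : HasDeg lev A 1 := hasDeg_toA a
  have hBd : HasDeg lev B (-1) := hasDeg_toB b
  let G : Matrix ν ν R → Matrix ν ν R := fun N => B - C * (A * B - N * A)
  let N : ℕ → Matrix ν ν R := fun j => G^[j] B
  have hN0 : N 0 = B := rfl
  have hNs : ∀ j, N (j + 1) = B - C * (A * B - N j * A) := by
    intro j
    simp only [N, Function.iterate_succ_apply']
    rfl
  have hdiff : ∀ j, N (j + 1) - N j = C ^ j * (N 1 - N 0) * A ^ j := by
    intro j
    induction j with
    | zero => simp
    | succ j ih =>
      have : N (j + 2) - N (j + 1) = C * (N (j + 1) - N j) * A := by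
        rw [hNs (j + 1), hNs j]; noncomm_ring
      rw [this, ih, pow_succ' C, pow_succ A]
      simp only [mul_assoc]
  have hfix : N (e + 1) = N e := by
    have := hdiff e
    rw [HasDeg.pow_eq_zero (Or.inl rfl) hAd e hlev, mul_zero] at this
    exact sub_eq_zero.1 this
  have hNd : ∀ j, HasDeg lev (N j) (-1) := by
    intro j
    induction j with
    | zero => exact hBd
    | succ j ih =>
      rw [hNs]
      have h1 := hC.mul ((hAd.mul hBd))
      have h2 := hC.mul (ih.mul hAd)
      intro p q h
      rw [mul_sub, Matrix.sub_apply, Matrix.sub_apply, hBd p q h, h1 p q (by simpa using h),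
        h2 p q (by simpa using h)]
      simp
  have hNI : ∀ j p q, N j p q - B p q ∈ I := by
    intro j
    induction j with
    | zero => intro p q; simp [hN0]
    | succ j ih =>
      intro p q
      have e1 : N (j + 1) - B = - (C * (A * B - B * A)) + C * ((N j - B) * A) := by
        rw [hNs]; noncomm_ring
      have e2 := congrFun (congrFun e1 p) q
      rw [Matrix.sub_apply] at e2
      rw [e2, Matrix.add_apply, Matrix.neg_apply]
      refine I.add_mem (I.neg_mem ?_) ?_
      · rw [mul_apply]
        refine I.sum_mem fun x _ => ?_
        by_cases hx : (lev p : ℤ) = lev x + (-1)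
        · refine I.mul_mem_left _ ?_
          rw [Matrix.sub_apply]
          by_cases hxq : lev x = lev q
          · exact hI x q hxq (by omega)
          · rw [hAd.mul hBd x q (by simp; exact_mod_cast hxq), hBd.mul hAd x q (by simp; exact_mod_cast hxq)]
            simp
        · rw [hC p x hx, zero_mul]; exact I.zero_mem
      · rw [mul_apply]
        refine I.sum_mem fun x _ => I.mul_mem_left _ ?_
        rw [mul_apply]
        refine I.sum_mem fun z _ => I.mul_mem_right _ ?_
        rw [Matrix.sub_apply]
        exact ih x z
  refine ⟨fun p => N e p.1.2 p.1.1, fun p => ?_, ?_⟩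
  · have := hNI e p.1.2 p.1.1
    rwa [hB, toB_apply] at this
  · have hb' : toB lev (fun p : Pr lev => N e p.1.2 p.1.1) = N e := by
      ext p q
      simp only [toB, transpose_apply, toA]
      split_ifs with h
      · rfl
      · rw [hNd e p q (by omega)]
    rw [hb']
    intro p p' h h'
    have e1 : A * N e = A * B - (A * C) * (A * B - N e * A) := by
      conv_lhs => rw [← hfix, hNs]
      noncomm_ring
    have e2 : ((A * C) * (A * B - N e * A)) p p' = (A * B - N e * A) p p' := by
      rw [mul_apply]
      have : ∀ x, (A * C) p x = (1 : Matrix ν ν R) p x := fun x => hAC p x h'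
      simp only [this]
      rw [← mul_apply, one_mul]
    rw [e1, Matrix.sub_apply, e2, Matrix.sub_apply]
    ring

theorem rad_localize {ν : Type} {lev : ν → ℕ} [Fintype ν] [DecidableEq ν] (e : ℕ)
    (hlev : ∀ p, lev p < e) {K : Type*} [Field K] (u : MvPolynomial (Pr lev ⊕ Pr lev) K)
    (hu : u ∈ (idE lev K).radical) (ω : {p // 1 ≤ lev p} → ν) :
    ∃ t, 0 < t ∧ gH lev K ω ^ t * u ∈ idE lev K := by
  set h := gH lev K ω with hh
  by_cases h0 : h = 0
  · exact ⟨1, one_pos, by simp [h0]⟩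
  let S := MvPolynomial (Pr lev ⊕ Pr lev) K
  let R := Localization.Away h
  haveI : IsDomain R := IsLocalization.isDomain_localization (powers_le_nonZeroDivisors_of_noZeroDivisors h0)
  let φ : S →ₐ[K] R := IsScalarTower.toAlgHom K S R
  let a : Pr lev → R := fun p => φ (X (Sum.inl p))
  let b : Pr lev → R := fun p => φ (X (Sum.inr p))
  have hAm : (gA lev K).map φ = toA lev a := toA_map _ (map_zero _) _
  have hBm : (gB lev K).map φ = toB lev b := toB_map _ (map_zero _) _
  let I : Ideal R := (idE lev K).map φ
  have hmul : ∀ (ψ : S →ₐ[K] R) (M N : Matrix ν ν S) p q, ψ ((M * N) p q) = (M.map ψ * N.map ψ) p q := by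
    intro ψ M N p q
    exact congrFun (congrFun (Matrix.map_mul (f := ψ) (L := M) (M := N)) p) q
  have hI : ∀ p p', lev p = lev p' → 1 ≤ lev p →
      (toA lev a * toB lev b) p p' - (toB lev b * toA lev a) p p' ∈ I := by
    intro p p' h1 h2
    have : φ (gE lev K ⟨(p, p'), h1, h2⟩) ∈ I := Ideal.mem_map_of_mem φ (Ideal.subset_span ⟨_, rfl⟩)
    rwa [gE, map_sub, hmul, hmul, hAm, hBm] at this
  have hunit : IsUnit ((toA lev a).submatrix (Subtype.val : {p // 1 ≤ lev p} → ν) ω).det := by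
    have h1 : IsUnit (φ h) := IsLocalization.Away.algebraMap_isUnit (S := R) h
    have h2 := AlgHom.map_det φ ((gA lev K).submatrix Subtype.val ω)
    have h3 : φ h = (φ.mapMatrix ((gA lev K).submatrix Subtype.val ω)).det := h2
    rw [h3] at h1
    rw [← hAm]
    exact h1
  obtain ⟨b', hb', hcomm⟩ := exists_section_B e hlev a b ω hunit I hI
  let τ : S →ₐ[K] R := aeval (Sum.elim a b')
  have hτl : ∀ p, τ (X (Sum.inl p)) = a p := fun p => aeval_X _ _
  have hτr : ∀ p, τ (X (Sum.inr p)) = b' p := fun p => aeval_X _ _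
  have hτA : (gA lev K).map τ = toA lev a := by
    rw [gA, toA_map _ (map_zero _)]
    congr 1
    ext p; exact hτl p
  have hτB : (gB lev K).map τ = toB lev b' := by
    rw [gB, toB_map _ (map_zero _)]
    congr 1
    ext p; exact hτr p
  have hτE : ∀ f ∈ idE lev K, τ f = 0 := by
    have : idE lev K ≤ RingHom.ker τ := by
      rw [idE, Ideal.span_le]
      rintro _ ⟨q, rfl⟩
      change τ (gE lev K q) = 0
      rw [gE, map_sub, hmul, hmul, hτA, hτB, hcomm _ _ q.2.1 q.2.2, sub_self]
    intro f hf
    exact this hf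
  have hτφ : ∀ f, φ f - τ f ∈ I := by
    have : (Ideal.Quotient.mkₐ K I).comp φ = (Ideal.Quotient.mkₐ K I).comp τ := by
      apply MvPolynomial.algHom_ext
      rintro (p | p)
      · simp only [AlgHom.comp_apply]
        rw [hτl]
      · simp only [AlgHom.comp_apply, Ideal.Quotient.mkₐ_eq_mk]
        rw [Ideal.Quotient.eq]
        have h1 := hb' p
        rw [← neg_mem_iff]
        rw [hτr, neg_sub]
        exact h1
    intro f
    rw [← Ideal.Quotient.eq]
    exact DFunLike.congr_fun this f
  have hτu : τ u = 0 := by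
    obtain ⟨m, hm⟩ := hu
    have := hτE _ hm
    rw [map_pow] at this
    exact eq_zero_of_pow_eq_zero this
  have h1 := hτφ u
  rw [hτu, sub_zero] at h1
  have h2 : algebraMap S R u ∈ (idE lev K).map (algebraMap S R) := h1
  rw [IsLocalization.algebraMap_mem_map_algebraMap_iff (Submonoid.powers h)] at h2
  obtain ⟨_, ⟨t, rfl⟩, ht⟩ := h2
  refine ⟨t + 1, by omega, ?_⟩
  rw [pow_succ', mul_assoc]
  exact Ideal.mul_mem_left _ _ ht
end P1d
end NilpPf

namespace NilpPf
section P1e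
open Matrix Module

theorem gA_homog {ν : Type} {lev : ν → ℕ} {K : Type*} [Field K] (p q : ν) :
    (gA lev K p q).IsHomogeneous 1 := by
  simp only [gA, toA]
  split_ifs
  · exact isHomogeneous_X _ _
  · exact isHomogeneous_zero _ _ _

theorem gB_homog {ν : Type} {lev : ν → ℕ} {K : Type*} [Field K] (p q : ν) :
    (gB lev K p q).IsHomogeneous 1 := by
  simp only [gB, toB, transpose_apply, toA]
  split_ifs
  · exact isHomogeneous_X _ _
  · exact isHomogeneous_zero _ _ _

theorem gE_homog {ν : Type} {lev : ν → ℕ} [Fintype ν] {K : Type*} [Field K] (q : Eqn lev) :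
    (gE lev K q).IsHomogeneous 2 := by
  rw [gE, mul_apply, mul_apply]
  refine IsHomogeneous.sub ?_ ?_
  · exact IsHomogeneous.sum _ _ _ fun x _ => (gA_homog _ _).mul (gB_homog _ _)
  · exact IsHomogeneous.sum _ _ _ fun x _ => (gB_homog _ _).mul (gA_homog _ _)

theorem gH_homog {ν : Type} {lev : ν → ℕ} [Fintype ν] [DecidableEq ν] {K : Type*} [Field K]
    (ω : {p // 1 ≤ lev p} → ν) : (gH lev K ω).IsHomogeneous (Fintype.card {p // 1 ≤ lev p}) := by
  rw [gH, det_apply]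
  refine IsHomogeneous.sum _ _ _ fun σ _ => ?_
  have h1 : (∏ i, ((gA lev K).submatrix (Subtype.val : {p // 1 ≤ lev p} → ν) ω) (σ i) i).IsHomogeneous
      (Fintype.card {p // 1 ≤ lev p}) := by
    have := IsHomogeneous.prod (Finset.univ : Finset {p // 1 ≤ lev p})
      (fun i => ((gA lev K).submatrix (Subtype.val : {p // 1 ≤ lev p} → ν) ω) (σ i) i) (fun _ => 1)
      (fun i _ => gA_homog _ _)
    simpa using this
  rw [Units.smul_def]
  exact (mem_homogeneousSubmodule _ _).1 (zsmul_mem ((mem_homogeneousSubmodule _ _).2 h1) _)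

theorem homog_zero_eq_C {σ K : Type*} [Field K] (Q : MvPolynomial σ K) (hQ : Q.IsHomogeneous 0)
    (h0 : Q ≠ 0) : ∃ c : K, c ≠ 0 ∧ Q = C c := by
  have h1 : Q = C (coeff 0 Q) := totalDegree_eq_zero_iff_eq_C.1 (by
    exact Nat.le_zero.1 hQ.totalDegree_le)
  refine ⟨coeff 0 Q, ?_, h1⟩
  intro h
  rw [h, C_0] at h1
  exact h0 h1

theorem idE_radical {ν : Type} {lev : ν → ℕ} [Fintype ν] [DecidableEq ν] (e : ℕ)
    (hlev : ∀ p, lev p < e)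
    (hconv : ∀ i, (Fintype.card {p // lev p = i + 1} : ℤ) - Fintype.card {p // lev p = i + 2} ≤
      Fintype.card {p // lev p = i} - Fintype.card {p // lev p = i + 1})
    {K : Type*} [Field K] [CharZero K] (u : MvPolynomial (Pr lev ⊕ Pr lev) K)
    (hu : u ∈ (idE lev K).radical) : u ∈ idE lev K := by
  haveI : Infinite K := CharZero.infinite K
  set E := idE lev K with hE
  have hEh : HomI E := homI_span _ (by rintro _ ⟨q, rfl⟩; exact ⟨2, gE_homog q⟩)
  obtain ⟨s, y, hy, hyr, hind⟩ := exists_nn E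
  have hE0 : ∀ c : K, C c ∈ E → c = 0 := by
    intro c hc
    have h1 : E ≤ RingHom.ker (constantCoeff (R := K) (σ := Pr lev ⊕ Pr lev)) := by
      rw [hE, idE, Ideal.span_le]
      rintro _ ⟨q, rfl⟩
      change constantCoeff _ = 0
      rw [constantCoeff_eq]
      exact (gE_homog q).coeff_eq_zero (by simp)
    have h2 : constantCoeff (C c : MvPolynomial (Pr lev ⊕ Pr lev) K) = 0 := h1 hc
    simpa using h2
  have hs := (alg_bound e hlev hconv E le_rfl y hy (by
    intro Q hQ hQE
    obtain ⟨d, Q', h1, h2, h3⟩ := exists_homog_rel E hEh y hy Q hQ hQE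
    rcases Nat.eq_zero_or_pos d with rfl | hd
    · obtain ⟨c, hc, rfl⟩ := homog_zero_eq_C Q' h1 h2
      rw [algHom_C] at h3
      exact hc (hE0 c h3)
    · exact h2 (hind d hd Q' h1 h3))).1
  set r := Fintype.card (Eqn lev) with hr
  obtain ⟨D, hD⟩ : ∃ D, D + r = 2 * Fintype.card (Pr lev) := ⟨2 * Fintype.card (Pr lev) - r, by omega⟩
  have hsD : s ≤ D := by omega
  let y' : Fin D → MvPolynomial (Pr lev ⊕ Pr lev) K := fun i => if h : i.1 < s then y ⟨i, h⟩ else 0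
  have hy' : ∀ i, (y' i).IsHomogeneous 1 := by
    intro i
    simp only [y']
    split_ifs
    · exact hy _
    · exact isHomogeneous_zero _ _ _
  have hyr' : ∀ i, X i ∈ (E ⊔ Ideal.span (Set.range y')).radical := by
    intro i
    refine Ideal.radical_mono (sup_le_sup_left (Ideal.span_mono ?_) _) (hyr i)
    rintro _ ⟨j, rfl⟩
    exact ⟨⟨j.1, by omega⟩, by simp [y']⟩
  choose t ht htE using fun ω => rad_localize e hlev u hu ω
  let I2 := E ⊔ Ideal.span (Set.range fun ω => gH lev K ω ^ t ω)
  have hI2u : ∀ x ∈ I2, x * u ∈ E := by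
    have : I2 ≤ Submodule.comap (LinearMap.mulRight (MvPolynomial (Pr lev ⊕ Pr lev) K) u) E := by
      refine sup_le ?_ ?_
      · intro x hx
        exact E.mul_mem_right _ hx
      · rw [Ideal.span_le]
        rintro _ ⟨ω, rfl⟩
        exact htE ω
    intro x hx
    exact this hx
  have hI2h : HomI I2 := by
    have : I2 = Ideal.span (Set.range (gE lev K) ∪ Set.range fun ω => gH lev K ω ^ t ω) := by
      rw [Ideal.span_union]; rfl
    rw [this]
    refine homI_span _ ?_
    rintro _ (⟨q, rfl⟩ | ⟨ω, rfl⟩)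
    · exact ⟨2, gE_homog q⟩
    · exact ⟨_, (gH_homog ω).pow _⟩
  obtain ⟨Q, hQ0, hQI⟩ : ∃ Q : MvPolynomial (Fin D) K, Q ≠ 0 ∧ aeval y' Q ∈ I2 := by
    by_contra hcon
    push Not at hcon
    have := (alg_bound e hlev hconv I2 le_sup_left y' hy' hcon).2 (fun ω =>
      ⟨t ω, Ideal.mem_sup_right (Ideal.subset_span ⟨ω, rfl⟩)⟩)
    omega
  obtain ⟨d, Q', h1, h2, h3⟩ := exists_homog_rel I2 hI2h y' hy' Q hQ0 hQI
  rcases Nat.eq_zero_or_pos d with rfl | hd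
  · obtain ⟨c, hc, rfl⟩ := homog_zero_eq_C Q' h1 h2
    rw [algHom_C] at h3
    have h4 := E.mul_mem_left (C c⁻¹) (hI2u _ h3)
    rw [algebraMap_eq, ← mul_assoc, ← C_mul, inv_mul_cancel₀ hc, C_1, one_mul] at h4
    exact h4
  have h4 := hI2u _ h3
  obtain ⟨T, rfl⟩ : ∃ T, D = T + 1 := by
    rcases D with _ | T
    · exfalso
      apply h2
      have := h1.coeff_eq_zero (d := 0) (by simpa using hd.ne)
      ext m
      rw [Subsingleton.elim m 0, this, coeff_zero]
    · exact ⟨T, rfl⟩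
  obtain ⟨z, hz, hyz⟩ := rel_step y' hy' Q' d hd h1 h2
  let F : ℕ → MvPolynomial (Pr lev ⊕ Pr lev) K := fun i =>
    if h : i < r then gE lev K ((Fintype.equivFin (Eqn lev)).symm ⟨i, h⟩)
    else if i = r then aeval y' Q' else if h : i - (r + 1) < T then z ⟨i - (r + 1), h⟩ else 0
  have hFr : F r = aeval y' Q' := by simp [F]
  have hcard : Fintype.card (Pr lev ⊕ Pr lev) = r + 1 + T := by
    rw [Fintype.card_sum]; omega
  have hIkr : Ik F r = E := by
    rw [Ik, hE, idE]
    congr 1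
    ext x
    constructor
    · rintro ⟨i, hi, rfl⟩
      have hi' : i < r := hi
      simp only [F]
      rw [dif_pos hi']
      exact ⟨_, rfl⟩
    · rintro ⟨q, rfl⟩
      refine ⟨Fintype.equivFin (Eqn lev) q, (Fintype.equivFin (Eqn lev) q).2, ?_⟩
      simp only [F]
      rw [dif_pos (Fintype.equivFin (Eqn lev) q).2]
      simp
  have hle1 : E ≤ Ik F (r + 1 + T) := by
    rw [← hIkr]
    exact Ideal.span_mono (Set.image_mono (Set.Iio_subset_Iio (by omega)))
  have hle2 : Ideal.span {aeval y' Q'} ⊔ Ideal.span (Set.range z) ≤ Ik F (r + 1 + T) := by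
    refine sup_le ?_ ?_
    · rw [Ideal.span_singleton_le_iff_mem, ← hFr]
      exact Ideal.subset_span ⟨r, by simp; omega, rfl⟩
    · rw [Ideal.span_le]
      rintro _ ⟨j, rfl⟩
      refine Ideal.subset_span ⟨r + 1 + j, by simp, ?_⟩
      simp only [F]
      rw [dif_neg (by omega), if_neg (by omega), dif_pos (by omega)]
      congr 1
      ext; simp
  have hcm := cm_aux (r + 1 + T) (Pr lev ⊕ Pr lev) hcard F (by
    intro i hi
    simp only [F]
    split_ifs with h1' h2' h3'
    · exact ⟨2, by norm_num, gE_homog _⟩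
    · refine ⟨d, hd, ?_⟩
      have := h1.aeval y' hy'
      rwa [one_mul] at this
    · exact ⟨1, one_pos, hz _⟩
    · exact ⟨1, one_pos, isHomogeneous_zero _ _ _⟩) (by
    intro i
    have h5 : E ⊔ Ideal.span (Set.range y') ≤ (Ik F (r + 1 + T)).radical := by
      refine sup_le (hle1.trans Ideal.le_radical) ?_
      rw [Ideal.span_le]
      rintro _ ⟨j, rfl⟩
      exact Ideal.radical_mono hle2 (hyz j)
    have h6 := Ideal.radical_mono h5 (hyr' i)
    rwa [Ideal.radical_idem] at h6) r (by omega) u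
  rw [hIkr, hFr, mul_comm] at hcm
  exact hcm h4
end P1e
end NilpPf

namespace NilpPf
section P3a
open Module

variable {σ : Type} [Fintype σ]

/-- product of factorials of the exponents -/
def fac (d : σ →₀ ℕ) : ℚ := ∏ i, ((d i).factorial : ℚ)

lemma fac_pos (d : σ →₀ ℕ) : 0 < fac d :=
  Finset.prod_pos fun i _ => by exact_mod_cast Nat.factorial_pos _

lemma fac_add_single (d : σ →₀ ℕ) (i : σ) :
    fac (d + Finsupp.single i 1) = fac d * (d i + 1) := by
  classical
  unfold fac
  rw [← Finset.mul_prod_erase _ _ (Finset.mem_univ i), ← Finset.mul_prod_erase (Finset.univ) (fun j => ((d j).factorial : ℚ)) (Finset.mem_univ i)]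
  have : ∏ x ∈ Finset.univ.erase i, (((d + Finsupp.single i 1 : σ →₀ ℕ) x).factorial : ℚ)
      = ∏ x ∈ Finset.univ.erase i, ((d x).factorial : ℚ) := by
    apply Finset.prod_congr rfl
    intro x hx
    have : x ≠ i := Finset.ne_of_mem_erase hx
    simp [this, Finsupp.single_apply, this.symm]
  rw [this]
  simp [Nat.factorial_succ]
  ring

/-- The Fischer (apolar) bilinear form. -/
noncomputable def fis : MvPolynomial σ ℚ →ₗ[ℚ] MvPolynomial σ ℚ →ₗ[ℚ] ℚ :=
  (basisMonomials σ ℚ).constr ℚ (fun d => fac d • lcoeff ℚ d)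

lemma fis_monomial (d : σ →₀ ℕ) (a : ℚ) (g : MvPolynomial σ ℚ) :
    fis (monomial d a) g = a * (fac d * coeff d g) := by
  have h : (monomial d a : MvPolynomial σ ℚ) = a • basisMonomials σ ℚ d := by
    simp [smul_monomial]
  rw [h, map_smul, fis, Basis.constr_basis]
  simp

lemma fis_apply (f g : MvPolynomial σ ℚ) :
    fis f g = ∑ d ∈ f.support, coeff d f * (fac d * coeff d g) := by
  conv_lhs => rw [← support_sum_monomial_coeff f]
  rw [map_sum, LinearMap.sum_apply]
  exact Finset.sum_congr rfl fun d _ => fis_monomial _ _ _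

lemma fis_symm (f g : MvPolynomial σ ℚ) : fis f g = fis g f := by
  classical
  induction f using MvPolynomial.induction_on' with
  | add p q hp hq => rw [map_add, map_add, LinearMap.add_apply, hp, hq]
  | monomial d a =>
    induction g using MvPolynomial.induction_on' with
    | add p q hp hq => rw [map_add, map_add, LinearMap.add_apply, hp, hq]
    | monomial d' b =>
      rw [fis_monomial, fis_monomial, coeff_monomial, coeff_monomial]
      by_cases h : d = d'
      · subst h; simp; ring
      · simp [h, Ne.symm h]

lemma fis_self_nonneg (f : MvPolynomial σ ℚ) : 0 ≤ fis f f := by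
  rw [fis_apply]
  apply Finset.sum_nonneg
  intro d _
  have := (fac_pos d).le
  nlinarith [mul_nonneg this (mul_self_nonneg (coeff d f))]

lemma fis_self_eq_zero (f : MvPolynomial σ ℚ) (h : fis f f = 0) : f = 0 := by
  by_contra hf
  rw [fis_apply, Finset.sum_eq_zero_iff_of_nonneg] at h
  · obtain ⟨d, hd⟩ := MvPolynomial.support_nonempty.2 hf
    have := h d hd
    rw [MvPolynomial.mem_support_iff] at hd
    have := (fac_pos d).ne'
    simp_all
  intro d _
  have := (fac_pos d).le
  nlinarith [mul_nonneg this (mul_self_nonneg (coeff d f))]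

lemma fis_X_mul (i : σ) (f g : MvPolynomial σ ℚ) :
    fis (X i * f) g = fis f (pderiv i g) := by
  induction f using MvPolynomial.induction_on' with
  | add p q hp hq => rw [mul_add, map_add, map_add, LinearMap.add_apply, LinearMap.add_apply, hp, hq]
  | monomial d a =>
    rw [X, monomial_mul, fis_monomial, fis_monomial, coeff_pderiv, add_comm (Finsupp.single i 1) d, fac_add_single]
    ring

lemma fis_X_mul_r (i : σ) (f g : MvPolynomial σ ℚ) :
    fis f (X i * g) = fis (pderiv i f) g := by
  rw [fis_symm, fis_X_mul, fis_symm]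

lemma fis_pderiv (i : σ) (f g : MvPolynomial σ ℚ) :
    fis (pderiv i f) g = fis f (X i * g) := (fis_X_mul_r i f g).symm

lemma fis_homog_ne {m n : ℕ} (hmn : m ≠ n) {f g : MvPolynomial σ ℚ}
    (hf : f.IsHomogeneous m) (hg : g.IsHomogeneous n) : fis f g = 0 := by
  rw [fis_apply]
  apply Finset.sum_eq_zero
  intro d hd
  rw [MvPolynomial.mem_support_iff] at hd
  have h1 := hf hd
  have h2 : coeff d g = 0 := by
    by_contra h
    exact hmn (h1.symm.trans (hg h))
  simp [h2]

/-- linear form attached to a point -/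
noncomputable def ell (z : σ → ℚ) : MvPolynomial σ ℚ := ∑ i, C (z i) * X i

lemma fis_ell_pow (z : σ → ℚ) (n : ℕ) : ∀ (p : MvPolynomial σ ℚ), p.IsHomogeneous n →
    fis (ell z ^ n) p = n.factorial * eval z p := by
  induction n with
  | zero =>
    intro p hp
    rw [← totalDegree_zero_iff_isHomogeneous, totalDegree_eq_zero_iff_eq_C] at hp
    rw [hp, pow_zero, show (1 : MvPolynomial σ ℚ) = monomial 0 1 from rfl, fis_monomial]
    simp [fac]
  | succ n ih =>
    intro p hp
    have e := hp.sum_X_mul_pderiv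
    have e2 := congrArg (eval z) e
    simp only [map_sum, map_mul, eval_X, map_nsmul] at e2
    rw [pow_succ', ell, Finset.sum_mul, map_sum, LinearMap.sum_apply]
    have : ∀ i, fis (C (z i) * X i * (∑ i, C (z i) * X i) ^ n) p
        = z i * (n.factorial * eval z (pderiv i p)) := by
      intro i
      rw [mul_assoc, C_mul', map_smul, LinearMap.smul_apply, fis_X_mul, smul_eq_mul]
      rw [← ell, ih _ (by simpa using hp.pderiv (i := i))]
    rw [Finset.sum_congr rfl fun i _ => this i, Nat.factorial_succ]
    push_cast
    have e3 : ∑ i, z i * (n.factorial * eval z (pderiv i p)) = n.factorial * ∑ i, z i * eval z (pderiv i p) := by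
      rw [Finset.mul_sum]; exact Finset.sum_congr rfl fun i _ => by ring
    rw [e3, e2, nsmul_eq_mul]
    push_cast; ring

lemma fis_proj (U : Submodule ℚ (MvPolynomial σ ℚ)) [FiniteDimensional ℚ U] (g : MvPolynomial σ ℚ) :
    ∃ u ∈ U, ∀ w ∈ U, fis (g - u) w = 0 := by
  let φ : U →ₗ[ℚ] Module.Dual ℚ U := (LinearMap.lcomp ℚ ℚ U.subtype).comp ((fis (σ := σ)).comp U.subtype)
  have hinj : Function.Injective φ := by
    rw [injective_iff_map_eq_zero]
    intro x hx
    exact Subtype.ext (fis_self_eq_zero _ (LinearMap.congr_fun hx x))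
  have hsurj : Function.Surjective φ :=
    (LinearMap.injective_iff_surjective_of_finrank_eq_finrank
      (Subspace.dual_finrank_eq (K := ℚ) (V := U)).symm).1 hinj
  obtain ⟨u, hu⟩ := hsurj ((fis g).comp U.subtype)
  refine ⟨u, u.2, fun w hw => ?_⟩
  have := LinearMap.congr_fun hu ⟨w, hw⟩
  rw [map_sub, LinearMap.sub_apply, sub_eq_zero]
  exact this.symm

end P3a
end NilpPf

namespace NilpPf
section P3b
open Matrix

lemma polyvan (c : ℕ → ℚ) (N : ℕ) (h : ∀ t : ℚ, ∑ i ∈ Finset.range N, t ^ i * c i = 0) :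
    ∀ i < N, c i = 0 := by
  have h0 : (∑ i ∈ Finset.range N, Polynomial.C (c i) * Polynomial.X ^ i : Polynomial ℚ) = 0 := by
    apply Polynomial.funext
    intro t
    rw [Polynomial.eval_finsetSum, Polynomial.eval_zero, ← h t]
    exact Finset.sum_congr rfl fun i _ => by
      rw [Polynomial.eval_mul, Polynomial.eval_C, Polynomial.eval_pow, Polynomial.eval_X, mul_comm]
  intro i hi
  have := congrArg (fun p => Polynomial.coeff p i) h0
  simpa [Polynomial.finset_sum_coeff, Polynomial.coeff_C_mul, Polynomial.coeff_X_pow, hi] using this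

lemma coefvan {σ : Type} (φ : MvPolynomial σ ℚ →ₗ[ℚ] ℚ) (p : Polynomial (MvPolynomial σ ℚ))
    (h : ∀ t : ℚ, φ (p.eval (C t)) = 0) (i : ℕ) : φ (p.coeff i) = 0 := by
  by_cases hi : i < p.natDegree + 1
  · refine polyvan (fun i => φ (p.coeff i)) (p.natDegree + 1) ?_ i hi
    intro t
    rw [← h t, Polynomial.eval_eq_sum_range, map_sum]
    refine Finset.sum_congr rfl fun j _ => ?_
    rw [mul_comm (p.coeff j), ← map_pow, C_mul', map_smul, smul_eq_mul]
  · rw [Polynomial.coeff_eq_zero_of_natDegree_lt (by omega), map_zero]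

lemma powvan {σ : Type} (φ : MvPolynomial σ ℚ →ₗ[ℚ] ℚ) (α β : MvPolynomial σ ℚ) (N : ℕ)
    (h : ∀ t : ℚ, φ ((α + C t * β) ^ N) = 0) (j : ℕ) (hj : j ≤ N) :
    φ (β ^ j * α ^ (N - j)) = 0 := by
  have := polyvan (fun j => (N.choose j : ℚ) * φ (β ^ j * α ^ (N - j))) (N + 1) (fun t => by
    rw [← h t, add_comm α, add_pow, map_sum]
    refine Finset.sum_congr rfl fun j _ => ?_
    rw [show (C t * β) ^ j * α ^ (N - j) * (N.choose j : MvPolynomial σ ℚ)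
        = C (t ^ j * N.choose j) * (β ^ j * α ^ (N - j)) by simp only [map_mul, map_pow, map_natCast]; ring,
      C_mul', map_smul, smul_eq_mul]
    ring) j (by omega)
  have h2 : (N.choose j : ℚ) ≠ 0 := by exact_mod_cast (Nat.choose_pos hj).ne'
  simpa [h2] using this

lemma bordered {R : Type*} [CommRing R] [IsDomain R] {m : Type*} [Fintype m] [DecidableEq m]
    (S : Matrix m m R) (hS : S.det ≠ 0) (c : Matrix m Unit R) (r : Matrix Unit m R) (d : R) :
    (fromBlocks S c r (Matrix.of fun _ _ => d)).det = d * S.det - (r * S.adjugate * c) () () := by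
  have h1 : fromBlocks S c r (Matrix.of fun _ _ => d) *
      fromBlocks S.adjugate (-(S.adjugate * c)) 0 (Matrix.of fun _ _ => S.det)
      = fromBlocks (S.det • (1 : Matrix m m R)) 0 (r * S.adjugate) (Matrix.of fun _ _ => d * S.det - (r * S.adjugate * c) () ()) := by
    rw [fromBlocks_multiply]
    congr 1
    · rw [Matrix.mul_zero, add_zero, mul_adjugate]
    · rw [Matrix.mul_neg, ← Matrix.mul_assoc, mul_adjugate, Matrix.smul_mul, Matrix.one_mul]
      ext i j
      simp [Matrix.mul_apply, mul_comm]
    · simp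
    · ext i j
      rw [Matrix.mul_neg, ← Matrix.mul_assoc]
      simp only [Matrix.add_apply, Matrix.neg_apply, Matrix.of_apply]
      rw [show ((Matrix.of fun (_ : Unit) (_ : Unit) => d) * (Matrix.of fun (_ : Unit) (_ : Unit) => S.det)) i j = d * S.det by simp [Matrix.mul_apply]]
      ring
  have h2 := congrArg Matrix.det h1
  rw [det_mul, det_fromBlocks_zero₂₁, det_fromBlocks_zero₁₂, det_unique (n := Unit), det_unique (n := Unit), det_smul, det_one] at h2
  have h3 : S.adjugate.det * S.det = S.det ^ Fintype.card m := by
    rw [← det_mul, adjugate_mul, det_smul, det_one, mul_one]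
  have h4 : (S.det ^ Fintype.card m) ≠ 0 := pow_ne_zero _ hS
  simp only [Matrix.of_apply] at h2
  rw [h3] at h2
  apply mul_right_cancel₀ h4
  rw [h2]; ring

variable {κ : Type} [Fintype κ] [DecidableEq κ]

/-- generic square matrix with rational coefficients -/
noncomputable def gX (κ : Type) : Matrix κ κ (MvPolynomial (κ × κ) ℚ) := Matrix.of fun i j => X (i, j)

/-- ideal of minors -/
noncomputable def Imin (κ : Type) (m : ℕ) : Ideal (MvPolynomial (κ × κ) ℚ) :=
  Ideal.span {q | ∃ f g : Fin m → κ, q = ((gX κ).submatrix f g).det}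

/-- rank one linear form -/
noncomputable def uf (b a : κ → ℚ) : MvPolynomial (κ × κ) ℚ := ell (fun p => b p.1 * a p.2)

lemma ell_homog {σ : Type} [Fintype σ] (z : σ → ℚ) : (ell z).IsHomogeneous 1 :=
  IsHomogeneous.sum _ _ _ fun i _ => by
    simpa using (isHomogeneous_C σ (z i)).mul (isHomogeneous_X ℚ i)

lemma kill_mul_homog {σ : Type} (φ : MvPolynomial σ ℚ →ₗ[ℚ] ℚ) (n0 : ℕ)
    (h : ∀ p n, n0 ≤ n → IsHomogeneous p n → φ p = 0) (q : MvPolynomial σ ℚ) (d : ℕ)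
    (hq : q.IsHomogeneous d) (hd : n0 ≤ d) (f : MvPolynomial σ ℚ) : φ (q * f) = 0 := by
  rw [← sum_homogeneousComponent f, Finset.mul_sum, map_sum]
  exact Finset.sum_eq_zero fun i _ => h _ (d + i) (by omega) (hq.mul (homogeneousComponent_isHomogeneous _ _))

lemma dual_base (φ : MvPolynomial (κ × κ) ℚ →ₗ[ℚ] ℚ) (h1 : φ 1 = 0)
    (hX : ∀ i j f, φ (X (i, j) * f) = 0) : φ = 0 := by
  apply LinearMap.ext
  intro q
  show φ q = 0
  induction q using MvPolynomial.induction_on with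
  | C a => rw [C_eq_smul_one, map_smul, h1, smul_zero]
  | add p q hp hq => rw [map_add, hp, hq, add_zero]
  | mul_X p n hp => rw [mul_comm]; exact hX _ _ _

/-- annihilator ideal of a functional -/
def annF {σ : Type} (φ : MvPolynomial σ ℚ →ₗ[ℚ] ℚ) : Ideal (MvPolynomial σ ℚ) where
  carrier := {q | ∀ f, φ (q * f) = 0}
  zero_mem' := fun f => by simp
  add_mem' := fun {a b} ha hb f => by rw [add_mul, map_add, ha f, hb f, add_zero]
  smul_mem' := fun c x hx f => by
    rw [smul_eq_mul, mul_comm c, mul_assoc]; exact hx _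

lemma uf_polar (φ : MvPolynomial (κ × κ) ℚ →ₗ[ℚ] ℚ) (k : ℕ)
    (h : ∀ b a : κ → ℚ, uf b a ^ (k + 1) ∈ annF φ) (b a : κ → ℚ) (i j : κ) :
    uf b a ^ k * X (i, j) + (k : MvPolynomial (κ × κ) ℚ) * uf b a ^ (k - 1)
      * uf (Pi.single i 1) a * uf b (Pi.single j 1) ∈ annF φ := by
  have hlin : ∀ s t : ℚ, uf (b + t • Pi.single i 1) (a + s • Pi.single j 1)
      = (uf b a + C s * uf b (Pi.single j 1)) + C t * (uf (Pi.single i 1) a + C s * X (i, j)) := by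
    intro s t
    have hz : (X (i, j) : MvPolynomial (κ × κ) ℚ) = uf (Pi.single i 1) (Pi.single j 1) := by
      unfold uf ell
      rw [Finset.sum_eq_single (i, j)]
      · simp
      · rintro ⟨i', j'⟩ _ hne
        by_cases h1 : i' = i
        · by_cases h2 : j' = j
          · simp [h1, h2] at hne
          · simp [h2]
        · simp [h1]
      · simp
    rw [hz]
    unfold uf ell
    simp only [Finset.mul_sum, ← Finset.sum_add_distrib]
    refine Finset.sum_congr rfl fun p _ => ?_
    simp only [Pi.add_apply, Pi.smul_apply, smul_eq_mul, map_mul, map_add]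
    ring
  intro f
  have h1 : ∀ s : ℚ, φ ((uf (Pi.single i 1) a + C s * X (i, j)) *
      (uf b a + C s * uf b (Pi.single j 1)) ^ k * f) = 0 := by
    intro s
    have := powvan (φ.comp (LinearMap.mulRight ℚ f)) (uf b a + C s * uf b (Pi.single j 1))
      (uf (Pi.single i 1) a + C s * X (i, j)) (k + 1) (fun t => by
        rw [← hlin]; exact h _ _ f) 1 (by omega)
    simpa using this
  have h2 := coefvan (φ.comp (LinearMap.mulRight ℚ f))
    ((Polynomial.C (uf (Pi.single i 1) a) + Polynomial.X * Polynomial.C (X (i, j))) *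
      (Polynomial.C (uf b a) + Polynomial.X * Polynomial.C (uf b (Pi.single j 1))) ^ k) (fun s => by
        rw [LinearMap.comp_apply, LinearMap.mulRight_apply]
        simp only [Polynomial.eval_mul, Polynomial.eval_add, Polynomial.eval_C, Polynomial.eval_X, Polynomial.eval_pow]
        exact h1 s) 1
  have h3 : ∀ p : Polynomial (MvPolynomial (κ × κ) ℚ), p.coeff 1 = p.derivative.eval 0 := by
    intro p
    rw [← Polynomial.coeff_zero_eq_eval_zero, Polynomial.coeff_derivative]; simp
  rw [h3] at h2
  simp only [LinearMap.comp_apply, LinearMap.mulRight_apply] at h2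
  rw [← h2]
  congr 2
  simp [Polynomial.derivative_pow]
  ring

end P3b
end NilpPf

namespace NilpPf
section P3b2
open Matrix

variable {κ : Type} [Fintype κ] [DecidableEq κ]

lemma minor_mem_Imin {τ : Type} [Fintype τ] [DecidableEq τ] (m : ℕ) (hm : Fintype.card τ = m) (f g : τ → κ) :
    ((gX κ).submatrix f g).det ∈ Imin κ m := by
  have e : Fin m ≃ τ := (Fintype.equivFinOfCardEq hm).symm
  apply Ideal.subset_span
  refine ⟨f ∘ e, g ∘ e, ?_⟩
  rw [← det_submatrix_equiv_self e, submatrix_submatrix]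

lemma uf_eq (b a : κ → ℚ) : uf b a = ∑ i, ∑ j, C (b i) * C (a j) * X (i, j) := by
  unfold uf ell
  rw [Fintype.sum_prod_type]
  simp

lemma uf_single_r (b : κ → ℚ) (j : κ) : uf b (Pi.single j 1) = ∑ i, C (b i) * X (i, j) := by
  rw [uf_eq]
  refine Finset.sum_congr rfl fun i _ => ?_
  rw [Finset.sum_eq_single j]
  · simp
  · intro j' _ h; simp [h]
  · simp

lemma uf_single_l (a : κ → ℚ) (i : κ) : uf (Pi.single i 1) a = ∑ j, C (a j) * X (i, j) := by
  rw [uf_eq, Finset.sum_eq_single i]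
  · simp
  · intro j' _ h; simp [h]
  · simp

lemma bordered_sum (m : ℕ) (b a : κ → ℚ) (I J : Fin m → κ) (h0 : ((gX κ).submatrix I J).det ≠ 0) :
    uf b a * ((gX κ).submatrix I J).det - ∑ q, ∑ p, uf b (Pi.single (J q) 1) *
      ((gX κ).submatrix I J).adjugate q p * uf (Pi.single (I p) 1) a ∈ Imin κ (m + 1) := by
  set S := (gX κ).submatrix I J with hS
  have h1 : ∀ i j, X (i, j) * S.det - ∑ q, ∑ p, X (i, J q) * S.adjugate q p * X (I p, j) ∈ Imin κ (m + 1) := by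
    intro i j
    have h2 := minor_mem_Imin (κ := κ) (τ := Fin m ⊕ Unit) (m + 1) (by simp)
      (Sum.elim I (fun _ => i)) (Sum.elim J (fun _ => j))
    have h3 : (gX κ).submatrix (Sum.elim I (fun _ : Unit => i)) (Sum.elim J (fun _ : Unit => j))
        = fromBlocks S (Matrix.of fun p _ => X (I p, j)) (Matrix.of fun _ q => X (i, J q)) (Matrix.of fun _ _ => X (i, j)) := by
      ext x y
      rcases x with x | x <;> rcases y with y | y <;> rfl
    rw [h3, bordered S h0] at h2
    convert h2 using 2
    simp only [Matrix.mul_apply, Matrix.of_apply, Finset.sum_mul]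
    rw [Finset.sum_comm]
  have h4 : ∑ i, ∑ j, C (b i) * C (a j) * (X (i, j) * S.det - ∑ q, ∑ p, X (i, J q) * S.adjugate q p * X (I p, j)) ∈ Imin κ (m + 1) :=
    Ideal.sum_mem _ fun i _ => Ideal.sum_mem _ fun j _ => Ideal.mul_mem_left _ _ (h1 i j)
  convert h4 using 1
  simp only [mul_sub, Finset.sum_sub_distrib]
  congr 1
  · rw [uf_eq, Finset.sum_mul]
    refine Finset.sum_congr rfl fun i _ => ?_
    rw [Finset.sum_mul]
    exact Finset.sum_congr rfl fun j _ => by ring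
  · simp only [uf_single_l, uf_single_r, Finset.sum_mul, Finset.mul_sum]
    have e1 : ∀ F : κ → κ → Fin m → Fin m → MvPolynomial (κ × κ) ℚ,
        ∑ q, ∑ p, ∑ j, ∑ i, F i j q p = ∑ i, ∑ j, ∑ q, ∑ p, F i j q p := by
      intro F
      calc _ = ∑ q, ∑ p, ∑ i, ∑ j, F i j q p :=
            Finset.sum_congr rfl fun q _ => Finset.sum_congr rfl fun p _ => Finset.sum_comm
        _ = ∑ q, ∑ i, ∑ p, ∑ j, F i j q p := Finset.sum_congr rfl fun q _ => Finset.sum_comm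
        _ = ∑ i, ∑ q, ∑ p, ∑ j, F i j q p := Finset.sum_comm
        _ = _ := Finset.sum_congr rfl fun i _ => by
            calc _ = ∑ q, ∑ j, ∑ p, F i j q p := Finset.sum_congr rfl fun q _ => Finset.sum_comm
              _ = _ := Finset.sum_comm
    rw [← e1]
    refine Finset.sum_congr rfl fun q _ => Finset.sum_congr rfl fun p _ => ?_
    first
    | refine Finset.sum_congr rfl fun i _ => Finset.sum_congr rfl fun j _ => ?_
      ring
    | rw [Finset.sum_comm]
      refine Finset.sum_congr rfl fun i _ => Finset.sum_congr rfl fun j _ => ?_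
      ring

lemma minor_mem_annF (φ : MvPolynomial (κ × κ) ℚ →ₗ[ℚ] ℚ) (k : ℕ) (hk : 1 ≤ k)
    (h : ∀ b a : κ → ℚ, uf b a ^ (k + 1) ∈ annF φ) (m : ℕ) (hI : Imin κ (m + 1) ≤ annF φ)
    (b a : κ → ℚ) (I J : Fin m → κ) :
    uf b a ^ k * ((gX κ).submatrix I J).det ∈ annF φ := by
  by_cases h0 : ((gX κ).submatrix I J).det = 0
  · rw [h0, mul_zero]; exact zero_mem _
  have h1 := hI (bordered_sum m b a I J h0)
  set S := (gX κ).submatrix I J with hS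
  have h2 : ∑ q, ∑ p, S.adjugate q p * (uf b a ^ k * X (I p, J q) + (k : MvPolynomial (κ × κ) ℚ) * uf b a ^ (k - 1)
      * uf (Pi.single (I p) 1) a * uf b (Pi.single (J q) 1)) ∈ annF φ :=
    Ideal.sum_mem _ fun i _ => Ideal.sum_mem _ fun j _ => Ideal.mul_mem_left _ _ (uf_polar φ k h b a _ _)
  have h3 := add_mem (Ideal.mul_mem_left _ ((k : MvPolynomial (κ × κ) ℚ) * uf b a ^ (k - 1)) h1) h2
  have ht : ∑ q, ∑ p, S.adjugate q p * X (I p, J q) = (m : MvPolynomial (κ × κ) ℚ) * S.det := by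
    have := congrArg Matrix.trace (adjugate_mul S)
    rw [trace_smul, trace_one, Fintype.card_fin, smul_eq_mul] at this
    rw [mul_comm, ← this, Matrix.trace]
    refine Finset.sum_congr rfl fun q _ => ?_
    rw [Matrix.diag_apply, Matrix.mul_apply]
    rfl
  have h4 : (k : MvPolynomial (κ × κ) ℚ) * uf b a ^ (k - 1) * (uf b a * S.det - ∑ q, ∑ p, uf b (Pi.single (J q) 1) *
      S.adjugate q p * uf (Pi.single (I p) 1) a) + ∑ q, ∑ p, S.adjugate q p * (uf b a ^ k * X (I p, J q) + (k : MvPolynomial (κ × κ) ℚ) * uf b a ^ (k - 1)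
      * uf (Pi.single (I p) 1) a * uf b (Pi.single (J q) 1)) = C ((k : ℚ) + m) * (uf b a ^ k * S.det) := by
    have e1 : ∑ q, ∑ p, S.adjugate q p * (uf b a ^ k * X (I p, J q) + (k : MvPolynomial (κ × κ) ℚ) * uf b a ^ (k - 1)
      * uf (Pi.single (I p) 1) a * uf b (Pi.single (J q) 1)) = uf b a ^ k * (∑ q, ∑ p, S.adjugate q p * X (I p, J q))
        + (k : MvPolynomial (κ × κ) ℚ) * uf b a ^ (k - 1) * ∑ q, ∑ p, uf b (Pi.single (J q) 1) *
      S.adjugate q p * uf (Pi.single (I p) 1) a := by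
      simp only [Finset.mul_sum, ← Finset.sum_add_distrib]
      exact Finset.sum_congr rfl fun q _ => Finset.sum_congr rfl fun p _ => by ring
    rw [e1, ht, map_add, map_natCast, map_natCast]
    obtain ⟨k', rfl⟩ : ∃ k', k = k' + 1 := ⟨k - 1, by omega⟩
    simp only [Nat.add_sub_cancel]
    ring
  rw [h4] at h3
  have hkm : (k : ℚ) + m ≠ 0 := by positivity
  have h5 := Ideal.mul_mem_left _ (C ((k : ℚ) + m)⁻¹) h3
  rwa [← mul_assoc, ← map_mul, inv_mul_cancel₀ hkm, map_one, one_mul] at h5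

theorem dual_zero (m : ℕ) : ∀ (φ : MvPolynomial (κ × κ) ℚ →ₗ[ℚ] ℚ) (n0 : ℕ)
    (hn0 : ∀ p n, n0 ≤ n → IsHomogeneous p n → φ p = 0)
    (hI : ∀ q ∈ Imin κ (m + 1), φ q = 0)
    (hZ : ∀ (B : Matrix κ (Fin m) ℚ) (A : Matrix (Fin m) κ ℚ) (n : ℕ),
      φ (ell (fun p : κ × κ => (B * A) p.1 p.2) ^ n) = 0), φ = 0 := by
  induction m with
  | zero =>
    intro φ n0 hn0 hI hZ
    apply dual_base
    · simpa using hZ 0 0 0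
    · intro i j f
      apply hI
      apply Ideal.mul_mem_right
      have := minor_mem_Imin (κ := κ) (τ := Unit) 1 (by simp) (fun _ => i) (fun _ => j)
      rwa [det_unique] at this
  | succ m ih =>
    intro φ n0 hn0 hI hZ
    by_contra hφ
    have hIa : Imin κ (m + 1 + 1) ≤ annF φ := fun q hq f => hI _ (Ideal.mul_mem_right _ _ hq)
    let P : ℕ → Prop := fun k => ∀ b a : κ → ℚ, uf b a ^ k ∈ annF φ
    have hPn : P n0 := by
      intro b a f
      refine kill_mul_homog φ n0 hn0 _ n0 ?_ le_rfl f
      simpa [uf] using (ell_homog (fun p : κ × κ => b p.1 * a p.2)).pow n0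
    classical
    have hex : ∃ k, P k := ⟨n0, hPn⟩
    have hP0 : ¬ P 0 := by
      intro h
      apply hφ
      apply LinearMap.ext
      intro f
      simpa using h 0 0 f
    obtain ⟨k, hk⟩ : ∃ k, Nat.find hex = k + 1 := by
      refine ⟨Nat.find hex - 1, ?_⟩
      have : Nat.find hex ≠ 0 := fun h => hP0 (h ▸ Nat.find_spec hex)
      omega
    have hk1 : P (k + 1) := hk ▸ Nat.find_spec hex
    have hk2 : ¬ P k := Nat.find_min hex (by omega)
    apply hk2
    intro b a
    by_cases hk0 : k = 0
    · exfalso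
      apply hφ
      apply dual_base
      · simpa using hZ 0 0 0
      · intro i j f
        have := uf_polar φ k hk1 b a i j f
        simpa [hk0] using this
    have hz := ih (φ.comp (LinearMap.mulLeft ℚ (uf b a ^ k))) n0 (by
        intro p n hn hp
        rw [LinearMap.comp_apply, LinearMap.mulLeft_apply]
        refine hn0 _ (1 * k + n) (by omega) (IsHomogeneous.mul ?_ hp)
        exact (ell_homog (fun p : κ × κ => b p.1 * a p.2)).pow k) (by
        intro q hq
        rw [LinearMap.comp_apply, LinearMap.mulLeft_apply]
        have : Imin κ (m + 1) ≤ Submodule.comap (LinearMap.mulLeft (MvPolynomial (κ × κ) ℚ) (uf b a ^ k)) (annF φ) := by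
          apply Ideal.span_le.2
          rintro _ ⟨I, J, rfl⟩
          exact minor_mem_annF φ k (by omega) hk1 (m + 1) hIa b a I J
        have h2 := this hq 1
        simpa using h2) (by
        intro B A n
        rw [LinearMap.comp_apply, LinearMap.mulLeft_apply]
        have := powvan φ (ell (fun p : κ × κ => (B * A) p.1 p.2)) (uf b a) (k + n) (fun t => by
          have h := hZ (Matrix.of fun i => Fin.cons (t * b i) (B i)) (Matrix.of (Fin.cons (α := fun _ => κ → ℚ) a (fun x => A x))) (k + n)
          convert h using 3
          unfold uf ell
          rw [Finset.mul_sum, ← Finset.sum_add_distrib]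
          refine Finset.sum_congr rfl fun p _ => ?_
          simp only [Matrix.mul_apply, Fin.sum_univ_succ, Matrix.of_apply, Fin.cons_zero, Fin.cons_succ, map_add, map_mul]
          ring) k (by omega)
        simpa using this)
    intro f
    exact LinearMap.congr_fun hz f

end P3b2
end NilpPf

namespace NilpPf
section P3b3
open Matrix

variable {κ : Type} [Fintype κ] [DecidableEq κ]

lemma Imin_homI (m : ℕ) : HomI (Imin κ m) := by
  apply homI_span
  rintro _ ⟨f, g, rfl⟩
  refine ⟨m, ?_⟩
  rw [det_apply]
  refine IsHomogeneous.sum _ _ _ fun s _ => ?_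
  have h : (∏ i, ((gX κ).submatrix f g) (s i) i).IsHomogeneous (∑ i : Fin m, 1) :=
    IsHomogeneous.prod _ _ _ fun i _ => isHomogeneous_X _ _
  simp only [Finset.sum_const, Finset.card_univ, Fintype.card_fin, smul_eq_mul, mul_one] at h
  rcases Int.units_eq_one_or (Equiv.Perm.sign s) with h1 | h1
  · rw [h1, one_smul]; exact h
  · rw [h1, Units.neg_smul, one_smul]; exact h.neg

lemma eval_Imin (m : ℕ) (B : Matrix κ (Fin m) ℚ) (A : Matrix (Fin m) κ ℚ) (q) (hq : q ∈ Imin κ (m + 1)) :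
    eval (fun x : κ × κ => (B * A) x.1 x.2) q = 0 := by
  have : Imin κ (m + 1) ≤ RingHom.ker (eval (fun x : κ × κ => (B * A) x.1 x.2)) := by
    apply Ideal.span_le.2
    rintro _ ⟨f, g, rfl⟩
    show eval _ _ = 0
    rw [RingHom.map_det]
    have h1 : (eval (fun x : κ × κ => (B * A) x.1 x.2)).mapMatrix ((gX κ).submatrix f g) = B.submatrix f id * A.submatrix id g := by
      ext i j
      simp [gX, Matrix.mul_apply]
    rw [h1]
    by_contra h
    have h2 := rank_of_det_ne_zero h
    have h3 := (rank_mul_le_left (B.submatrix f id) (A.submatrix id g)).trans (rank_le_card_width _)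
    simp at h2 h3
    omega
  exact this hq

lemma sft_homog (m n : ℕ) (p : MvPolynomial (κ × κ) ℚ) (hn : p.IsHomogeneous n)
    (hp : ∀ (B : Matrix κ (Fin m) ℚ) (A : Matrix (Fin m) κ ℚ), eval (fun x : κ × κ => (B * A) x.1 x.2) p = 0) :
    p ∈ Imin κ (m + 1) := by
  let U : Submodule ℚ (MvPolynomial (κ × κ) ℚ) :=
    (Imin κ (m + 1)).restrictScalars ℚ ⊓ homogeneousSubmodule (κ × κ) ℚ n
  haveI : FiniteDimensional ℚ (homogeneousSubmodule (κ × κ) ℚ n) :=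
    Module.Finite.iff_fg.2 (homogeneousSubmodule_fg _ _ n)
  haveI : FiniteDimensional ℚ U := Submodule.finiteDimensional_of_le inf_le_right
  obtain ⟨u, hu, hw⟩ := fis_proj U p
  have hwn : (p - u).IsHomogeneous n := hn.sub hu.2
  have hz := dual_zero m (fis (p - u)) (n + 1) (fun q d hd hq => fis_homog_ne (by omega) hwn hq) (by
    intro q hq
    rw [← sum_homogeneousComponent q, map_sum]
    apply Finset.sum_eq_zero
    intro d _
    by_cases hd : d = n
    · subst hd
      exact hw _ ⟨Imin_homI _ q hq d, homogeneousComponent_isHomogeneous _ _⟩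
    · exact fis_homog_ne (Ne.symm hd) hwn (homogeneousComponent_isHomogeneous _ _)) (by
    intro B A d
    by_cases hd : d = n
    · subst hd
      rw [fis_symm, fis_ell_pow _ _ _ hwn, map_sub, hp, eval_Imin _ _ _ _ hu.1]
      simp
    · have h := (ell_homog (fun p : κ × κ => (B * A) p.1 p.2)).pow d
      exact fis_homog_ne (by omega) hwn h)
  have : p - u = 0 := fis_self_eq_zero _ (by rw [hz]; rfl)
  rw [sub_eq_zero] at this
  rw [this]; exact hu.1

lemma eval_smul_homog {σ : Type} (t : ℚ) (z : σ → ℚ) (n : ℕ) (p : MvPolynomial σ ℚ) (hp : p.IsHomogeneous n) :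
    eval (t • z) p = t ^ n * eval z p := by
  rw [eval_eq, eval_eq, Finset.mul_sum]
  refine Finset.sum_congr rfl fun d hd => ?_
  have h1 : d.degree = n := by
    have := hp (MvPolynomial.mem_support_iff.1 hd)
    rwa [Finsupp.degree_eq_weight_one]
  have h2 : ∏ i ∈ d.support, (t • z) i ^ d i = t ^ n * ∏ i ∈ d.support, z i ^ d i := by
    rw [← h1, Finsupp.degree, ]
    simp only [Pi.smul_apply, smul_eq_mul, mul_pow, Finset.prod_mul_distrib]
    rw [Finset.prod_pow_eq_pow_sum]
    rfl
  rw [h2]; ring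

theorem sft_fin (m : ℕ) (p : MvPolynomial (κ × κ) ℚ)
    (hp : ∀ (B : Matrix κ (Fin m) ℚ) (A : Matrix (Fin m) κ ℚ), eval (fun x : κ × κ => (B * A) x.1 x.2) p = 0) :
    p ∈ Imin κ (m + 1) := by
  rw [← sum_homogeneousComponent p]
  refine Ideal.sum_mem _ fun n hn => sft_homog m n _ (homogeneousComponent_isHomogeneous _ _) fun B A => ?_
  refine polyvan (fun n => eval (fun x : κ × κ => (B * A) x.1 x.2) (homogeneousComponent n p)) (p.totalDegree + 1) ?_ n (Finset.mem_range.1 hn)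
  intro t
  rw [← hp (t • B) A]
  conv_rhs => rw [← sum_homogeneousComponent p]
  rw [map_sum]
  refine Finset.sum_congr rfl fun n _ => ?_
  rw [← eval_smul_homog _ _ _ _ (homogeneousComponent_isHomogeneous _ _)]
  congr 2
  ext x
  simp

theorem sft {ι : Type} [Fintype ι] (p : MvPolynomial (κ × κ) ℚ)
    (hp : ∀ (B : Matrix κ ι ℚ) (A : Matrix ι κ ℚ), eval (fun x : κ × κ => (B * A) x.1 x.2) p = 0) :
    p ∈ Imin κ (Fintype.card ι + 1) := by
  apply sft_fin
  intro B A
  have := hp (B.submatrix id (Fintype.equivFin ι)) (A.submatrix (Fintype.equivFin ι) id)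
  rw [submatrix_mul_equiv, submatrix_id_id] at this
  exact this

end P3b3
end NilpPf

namespace NilpPf
section P3c
open Matrix

/-- variables: entries of A (left) and of B (right) -/
abbrev Sg (ι κ : Type) := (ι × κ) ⊕ (κ × ι)

variable {ι κ : Type} [Fintype ι] [DecidableEq ι] [Fintype κ] [DecidableEq κ]

noncomputable def mA (ι κ : Type) : Matrix ι κ (MvPolynomial (Sg ι κ) ℚ) := Matrix.of fun i c => X (Sum.inl (i, c))
noncomputable def mB (ι κ : Type) : Matrix κ ι (MvPolynomial (Sg ι κ) ℚ) := Matrix.of fun c i => X (Sum.inr (c, i))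

noncomputable def dL (i j : ι) : Derivation ℚ (MvPolynomial (Sg ι κ) ℚ) (MvPolynomial (Sg ι κ) ℚ) :=
  ∑ c : κ, mA ι κ i c • pderiv (Sum.inl (j, c))
noncomputable def dL' (i j : ι) : Derivation ℚ (MvPolynomial (Sg ι κ) ℚ) (MvPolynomial (Sg ι κ) ℚ) :=
  ∑ c : κ, mB ι κ c j • pderiv (Sum.inr (c, i))
noncomputable def dD (i j : ι) : Derivation ℚ (MvPolynomial (Sg ι κ) ℚ) (MvPolynomial (Sg ι κ) ℚ) :=
  dL i j - dL' i j

lemma der_sum_apply {σ τ : Type} [Fintype τ] (D : τ → Derivation ℚ (MvPolynomial σ ℚ) (MvPolynomial σ ℚ)) (f : MvPolynomial σ ℚ) :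
    (∑ c, D c) f = ∑ c, D c f := by
  have := map_sum (Derivation.coeFnAddMonoidHom (R := ℚ) (A := MvPolynomial σ ℚ) (M := MvPolynomial σ ℚ)) D Finset.univ
  have h := congrFun this f
  rw [Finset.sum_apply] at h
  exact h

lemma dL_apply (i j : ι) (f : MvPolynomial (Sg ι κ) ℚ) :
    dL i j f = ∑ c : κ, mA ι κ i c * pderiv (Sum.inl (j, c)) f := by
  rw [dL, der_sum_apply]; rfl
lemma dL'_apply (i j : ι) (f : MvPolynomial (Sg ι κ) ℚ) :
    dL' i j f = ∑ c : κ, mB ι κ c j * pderiv (Sum.inr (c, i)) f := by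
  rw [dL', der_sum_apply]; rfl
lemma dD_apply (i j : ι) (f : MvPolynomial (Sg ι κ) ℚ) : dD i j f = dL i j f - dL' i j f := rfl

lemma dL_mA (i j a : ι) (c : κ) : dL i j (mA ι κ a c) = if a = j then mA ι κ i c else 0 := by
  rw [dL_apply]
  simp only [mA, Matrix.of_apply, pderiv_X, Pi.single_apply]
  rw [Finset.sum_eq_single c]
  · simp
  · intro c' _ hc
    simp [Ne.symm hc]
  · simp
lemma dL_mB (i j a : ι) (c : κ) : dL i j (mB ι κ c a) = 0 := by
  rw [dL_apply]
  simp [mB, Matrix.of_apply, pderiv_X, Pi.single_apply]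
lemma dL'_mA (i j a : ι) (c : κ) : dL' i j (mA ι κ a c) = 0 := by
  rw [dL'_apply]
  simp [mA, Matrix.of_apply, pderiv_X, Pi.single_apply]
lemma dL'_mB (i j a : ι) (c : κ) : dL' i j (mB ι κ c a) = if a = i then mB ι κ c j else 0 := by
  rw [dL'_apply]
  simp only [mB, Matrix.of_apply, pderiv_X, Pi.single_apply]
  rw [Finset.sum_eq_single c]
  · simp
  · intro c' _ hc
    simp [Ne.symm hc]
  · simp
lemma dD_mA (i j a : ι) (c : κ) : dD i j (mA ι κ a c) = if a = j then mA ι κ i c else 0 := by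
  rw [dD_apply, dL_mA, dL'_mA, sub_zero]
lemma dD_mB (i j a : ι) (c : κ) : dD i j (mB ι κ c a) = if a = i then -mB ι κ c j else 0 := by
  rw [dD_apply, dL_mB, dL'_mB]; split_ifs <;> simp

lemma dD_BA (i j : ι) (c c' : κ) : dD i j ((mB ι κ * mA ι κ) c c') = 0 := by
  rw [Matrix.mul_apply, map_sum]
  simp only [Derivation.leibniz, dD_mA, dD_mB, smul_eq_mul]
  rw [Finset.sum_add_distrib]
  simp
  ring

lemma fis_dL (i j : ι) (f g : MvPolynomial (Sg ι κ) ℚ) : fis (dL i j f) g = fis f (dL j i g) := by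
  rw [dL_apply, dL_apply, map_sum, map_sum, LinearMap.sum_apply]
  refine Finset.sum_congr rfl fun c _ => ?_
  simp only [mA, Matrix.of_apply]
  rw [fis_X_mul, fis_pderiv]
lemma fis_dL' (i j : ι) (f g : MvPolynomial (Sg ι κ) ℚ) : fis (dL' i j f) g = fis f (dL' j i g) := by
  rw [dL'_apply, dL'_apply, map_sum, map_sum, LinearMap.sum_apply]
  refine Finset.sum_congr rfl fun c _ => ?_
  simp only [mB, Matrix.of_apply]
  rw [fis_X_mul, fis_pderiv]
lemma fis_dD (i j : ι) (f g : MvPolynomial (Sg ι κ) ℚ) : fis (dD i j f) g = fis f (dD j i g) := by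
  rw [dD_apply, dD_apply, map_sub, map_sub, LinearMap.sub_apply, fis_dL, fis_dL']

lemma X_pderiv_homog {σ : Type} (a b : σ) {n : ℕ} {f : MvPolynomial σ ℚ} (hf : f.IsHomogeneous n) :
    (X a * pderiv b f).IsHomogeneous n := by
  cases n with
  | zero =>
    rw [← totalDegree_zero_iff_isHomogeneous, totalDegree_eq_zero_iff_eq_C] at hf
    rw [hf, pderiv_C, mul_zero]
    exact isHomogeneous_zero _ _ _
  | succ n =>
    have := (isHomogeneous_X ℚ a).mul (hf.pderiv (i := b))
    convert this using 1
    omega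

lemma dL_homog (i j : ι) {n : ℕ} {f : MvPolynomial (Sg ι κ) ℚ} (hf : f.IsHomogeneous n) :
    (dL i j f).IsHomogeneous n := by
  rw [dL_apply]
  exact IsHomogeneous.sum _ _ _ fun c _ => X_pderiv_homog _ _ hf
lemma dL'_homog (i j : ι) {n : ℕ} {f : MvPolynomial (Sg ι κ) ℚ} (hf : f.IsHomogeneous n) :
    (dL' i j f).IsHomogeneous n := by
  rw [dL'_apply]
  exact IsHomogeneous.sum _ _ _ fun c _ => X_pderiv_homog _ _ hf

/-- substitution of the product BA -/
noncomputable def sub (ι κ : Type) [Fintype ι] : MvPolynomial (κ × κ) ℚ →ₐ[ℚ] MvPolynomial (Sg ι κ) ℚ :=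
  aeval (fun x : κ × κ => (mB ι κ * mA ι κ) x.1 x.2)

/-- sum of the images of the derivations -/
noncomputable def imD (ι κ : Type) [Fintype ι] [DecidableEq ι] [Fintype κ] [DecidableEq κ] :
    Submodule ℚ (MvPolynomial (Sg ι κ) ℚ) :=
  ⨆ p : ι × ι, LinearMap.range (dD (κ := κ) p.1 p.2).toLinearMap

lemma dD_mem (i j : ι) (f : MvPolynomial (Sg ι κ) ℚ) : dD i j f ∈ imD ι κ :=
  (le_iSup (fun p : ι × ι => LinearMap.range (dD (κ := κ) p.1 p.2).toLinearMap) (i, j)) ⟨f, rfl⟩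

lemma imD_induct {S : Submodule ℚ (MvPolynomial (Sg ι κ) ℚ)} (h : ∀ i j f, dD i j f ∈ S) : imD ι κ ≤ S := by
  apply iSup_le
  rintro ⟨i, j⟩ _ ⟨f, rfl⟩
  exact h i j f

lemma dD_sub (i j : ι) (q : MvPolynomial (κ × κ) ℚ) : dD i j (sub ι κ q) = 0 := by
  induction q using MvPolynomial.induction_on with
  | C a => rw [algHom_C]; exact Derivation.map_algebraMap _ _
  | add p q hp hq => rw [map_add, map_add, hp, hq, add_zero]
  | mul_X p n hp => rw [map_mul, Derivation.leibniz, hp, sub, aeval_X, dD_BA]; simp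

theorem orth (q : MvPolynomial (κ × κ) ℚ) (h : sub ι κ q ∈ imD ι κ) : sub ι κ q = 0 := by
  have : imD ι κ ≤ LinearMap.ker (fis (sub ι κ q)) := by
    apply imD_induct
    intro i j f
    rw [LinearMap.mem_ker, ← fis_dD, dD_sub, map_zero, LinearMap.zero_apply]
  exact fis_self_eq_zero _ (this h)

noncomputable def WW (ι κ : Type) [Fintype ι] [DecidableEq ι] [Fintype κ] [DecidableEq κ] :
    Submodule ℚ (MvPolynomial (Sg ι κ) ℚ) := LinearMap.range (sub ι κ).toLinearMap ⊔ imD ι κ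

lemma imD_mul (c c' : κ) (f : MvPolynomial (Sg ι κ) ℚ) (hf : f ∈ imD ι κ) :
    (mB ι κ * mA ι κ) c c' * f ∈ imD ι κ := by
  have : imD ι κ ≤ (imD ι κ).comap (LinearMap.mulLeft ℚ ((mB ι κ * mA ι κ) c c')) := by
    apply imD_induct
    intro i j f
    show (mB ι κ * mA ι κ) c c' * _ ∈ imD ι κ
    have h := dD_mem i j ((mB ι κ * mA ι κ) c c' * f)
    rwa [Derivation.leibniz, dD_BA, smul_zero, add_zero, smul_eq_mul] at h
  exact this hf

lemma WW_mul (c c' : κ) (f : MvPolynomial (Sg ι κ) ℚ) (hf : f ∈ WW ι κ) :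
    (mB ι κ * mA ι κ) c c' * f ∈ WW ι κ := by
  obtain ⟨_, ⟨q, rfl⟩, y, hy, rfl⟩ := Submodule.mem_sup.1 hf
  rw [mul_add]
  refine add_mem (Submodule.mem_sup_left ⟨X (c, c') * q, ?_⟩) (Submodule.mem_sup_right (imD_mul c c' y hy))
  show sub ι κ _ = _
  rw [map_mul]
  congr 1
  rw [sub, aeval_X]

lemma dLL (v : MvPolynomial (Sg ι κ) ℚ) :
    ∑ i, ∑ j, dL' i j (dL j i v) = ∑ c, ∑ c', (mB ι κ * mA ι κ) c c' *
      ∑ i, pderiv (Sum.inr (c, i)) (pderiv (Sum.inl (i, c')) v) := by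
  have h1 : ∀ i j, dL' i j (dL j i v) = ∑ c, ∑ c', (mB ι κ c j * mA ι κ j c') *
      pderiv (Sum.inr (c, i)) (pderiv (Sum.inl (i, c')) v) := by
    intro i j
    rw [dL'_apply]
    refine Finset.sum_congr rfl fun c _ => ?_
    rw [dL_apply, map_sum, Finset.mul_sum]
    refine Finset.sum_congr rfl fun c' _ => ?_
    rw [Derivation.leibniz]
    have : pderiv (R := ℚ) (Sum.inr (c, i)) (mA ι κ j c') = 0 := by
      simp [mA, pderiv_X, Pi.single_apply]
    rw [this, smul_zero, add_zero, smul_eq_mul]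
    ring
  simp only [h1]
  simp only [Matrix.mul_apply, Finset.sum_mul, Finset.mul_sum]
  rw [show (∑ i : ι, ∑ j : ι, ∑ c : κ, ∑ c' : κ, (mB ι κ c j * mA ι κ j c') *
      pderiv (Sum.inr (c, i)) (pderiv (Sum.inl (i, c')) v)) = ∑ i : ι, ∑ c : κ, ∑ j : ι, ∑ c' : κ, (mB ι κ c j * mA ι κ j c') *
      pderiv (Sum.inr (c, i)) (pderiv (Sum.inl (i, c')) v) from Finset.sum_congr rfl fun i _ => Finset.sum_comm]
  rw [Finset.sum_comm]
  refine Finset.sum_congr rfl fun c _ => ?_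
  calc _ = ∑ i : ι, ∑ c' : κ, ∑ j : ι, (mB ι κ c j * mA ι κ j c') *
      pderiv (Sum.inr (c, i)) (pderiv (Sum.inl (i, c')) v) := Finset.sum_congr rfl fun i _ => Finset.sum_comm
    _ = ∑ c' : κ, ∑ i : ι, ∑ j : ι, (mB ι κ c j * mA ι κ j c') *
      pderiv (Sum.inr (c, i)) (pderiv (Sum.inl (i, c')) v) := Finset.sum_comm
    _ = _ := Finset.sum_congr rfl fun c' _ => by
      first | rfl | exact Finset.sum_comm

theorem dec_homog (n : ℕ) : ∀ g : MvPolynomial (Sg ι κ) ℚ, g.IsHomogeneous n → g ∈ WW ι κ := by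
  induction n using Nat.strong_induction_on with
  | _ n ih =>
  intro g hg
  by_cases hn : n = 0
  · subst hn
    rw [← totalDegree_zero_iff_isHomogeneous, totalDegree_eq_zero_iff_eq_C] at hg
    apply Submodule.mem_sup_left
    refine ⟨C (coeff 0 g), ?_⟩
    conv_rhs => rw [hg]
    exact algHom_C (sub ι κ) _
  let U : Submodule ℚ (MvPolynomial (Sg ι κ) ℚ) := WW ι κ ⊓ homogeneousSubmodule (Sg ι κ) ℚ n
  haveI : FiniteDimensional ℚ (homogeneousSubmodule (Sg ι κ) ℚ n) :=
    Module.Finite.iff_fg.2 (homogeneousSubmodule_fg _ _ n)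
  haveI : FiniteDimensional ℚ U := Submodule.finiteDimensional_of_le inf_le_right
  obtain ⟨u, hu, hv⟩ := fis_proj U g
  have hvn : (g - u).IsHomogeneous n := hg.sub hu.2
  obtain ⟨v, hvdef⟩ : ∃ v, v = g - u := ⟨_, rfl⟩
  rw [← hvdef] at hvn hv
  have hO : ∑ i, ∑ j, dL i j (dL j i v) ∈ U := by
    refine ⟨?_, ?_⟩
    · have e : ∀ i j, dL i j (dL j i v) = dD i j (dL j i v) + dL' i j (dL j i v) := fun i j => by
        rw [dD_apply]; ring
      simp only [e, Finset.sum_add_distrib]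
      refine add_mem (Submodule.sum_mem _ fun i _ => Submodule.sum_mem _ fun j _ =>
        Submodule.mem_sup_right (dD_mem _ _ _)) ?_
      rw [dLL]
      refine Submodule.sum_mem _ fun c _ => Submodule.sum_mem _ fun c' _ => WW_mul _ _ _ ?_
      refine Submodule.sum_mem _ fun i _ => ih (n - 1 - 1) (by omega) _ (hvn.pderiv.pderiv)
    · exact IsHomogeneous.sum _ _ _ fun i _ => IsHomogeneous.sum _ _ _ fun j _ => dL_homog _ _ (dL_homog _ _ hvn)
  have h1 : ∑ i, ∑ j, fis (dL j i v) (dL j i v) = 0 := by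
    rw [← hv _ hO, map_sum]
    refine Finset.sum_congr rfl fun i _ => ?_
    rw [map_sum]
    exact Finset.sum_congr rfl fun j _ => fis_dL _ _ _ _
  have h2 : ∀ i j, dL j i v = 0 := by
    intro i j
    rw [Finset.sum_eq_zero_iff_of_nonneg] at h1
    · have h3 := h1 i (Finset.mem_univ i)
      rw [Finset.sum_eq_zero_iff_of_nonneg] at h3
      · exact fis_self_eq_zero (dL j i v) (h3 j (Finset.mem_univ j))
      · intro j _; exact fis_self_nonneg _
    · intro i _
      exact Finset.sum_nonneg fun j _ => fis_self_nonneg _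
  have h4 : ∀ i, fis v (dL' i i v) = 0 := by
    intro i
    apply hv
    refine ⟨?_, dL'_homog _ _ hvn⟩
    have := dD_mem (κ := κ) i i v
    rw [dD_apply, h2, zero_sub] at this
    exact Submodule.mem_sup_right (by simpa using neg_mem this)
  have h5 := hvn.sum_X_mul_pderiv
  have h6 : ∑ i : Sg ι κ, X i * pderiv i v = ∑ i, dL i i v + ∑ i, dL' i i v := by
    rw [Fintype.sum_sum_type, Fintype.sum_prod_type, Fintype.sum_prod_type]
    congr 1
    · exact Finset.sum_congr rfl fun i _ => by rw [dL_apply]; rfl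
    · rw [Finset.sum_comm]
      exact Finset.sum_congr rfl fun i _ => by rw [dL'_apply]; rfl
  rw [h6, Finset.sum_eq_zero (fun i _ => h2 i i), zero_add] at h5
  have h7 := congrArg (fis v) h5
  rw [map_sum, Finset.sum_eq_zero (fun i _ => h4 i), map_nsmul, nsmul_eq_mul] at h7
  have h8 : fis v v = 0 := by
    have : (n : ℚ) ≠ 0 := by exact_mod_cast hn
    rcases mul_eq_zero.1 h7.symm with h | h
    · exact absurd h this
    · exact h
  have h9 := fis_self_eq_zero _ h8
  rw [hvdef, sub_eq_zero] at h9
  rw [h9]; exact hu.1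

theorem dec (g : MvPolynomial (Sg ι κ) ℚ) : ∃ q : MvPolynomial (κ × κ) ℚ, ∃ y ∈ imD ι κ, g = sub ι κ q + y := by
  have : g ∈ WW ι κ := by
    rw [← sum_homogeneousComponent g]
    exact Submodule.sum_mem _ fun n _ => dec_homog n _ (homogeneousComponent_isHomogeneous _ _)
  obtain ⟨_, ⟨q, rfl⟩, y, hy, h⟩ := Submodule.mem_sup.1 this
  exact ⟨q, y, hy, h.symm⟩

end P3c
end NilpPf

namespace NilpPf
section P3d
open Matrix

variable {ι κ : Type} [Fintype ι] [DecidableEq ι] [Fintype κ] [DecidableEq κ]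

lemma Imin_kill {R : Type*} [CommRing R] [Algebra ℚ R] (M : Matrix κ κ R) (m : ℕ)
    (hmin : ∀ f g : Fin m → κ, (M.submatrix f g).det = 0) (q) (hq : q ∈ Imin κ m) :
    aeval (fun x : κ × κ => M x.1 x.2) q = 0 := by
  have : Imin κ m ≤ RingHom.ker (aeval (R := ℚ) (fun x : κ × κ => M x.1 x.2)) := by
    apply Ideal.span_le.2
    rintro _ ⟨f, g, rfl⟩
    show aeval _ _ = 0
    rw [AlgHom.map_det]
    rw [← hmin f g]
    congr 1
    ext i j
    simp [gX]
  exact this hq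

lemma eval_sub (B : Matrix κ ι ℚ) (A : Matrix ι κ ℚ) (q : MvPolynomial (κ × κ) ℚ) :
    eval (Sum.elim (fun x : ι × κ => A x.1 x.2) (fun x : κ × ι => B x.1 x.2)) (sub ι κ q)
      = eval (fun x : κ × κ => (B * A) x.1 x.2) q := by
  induction q using MvPolynomial.induction_on with
  | C a => rw [algHom_C]; simp
  | add p q hp hq => rw [map_add, map_add, map_add, hp, hq]
  | mul_X p n hp =>
    rw [map_mul, map_mul, map_mul, hp]
    congr 1
    rw [sub, aeval_X]
    simp [Matrix.mul_apply, mA, mB]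

theorem exists_rho {R : Type*} [CommRing R] [Algebra ℚ R] (M : Matrix κ κ R)
    (hmin : ∀ f g : Fin (Fintype.card ι + 1) → κ, (M.submatrix f g).det = 0) :
    ∃ ρ : MvPolynomial (Sg ι κ) ℚ →ₗ[ℚ] R, (∀ q, ρ (sub ι κ q) = aeval (fun x : κ × κ => M x.1 x.2) q) ∧
      ∀ y ∈ imD ι κ, ρ y = 0 := by
  let F : MvPolynomial (κ × κ) ℚ →ₗ[ℚ] (MvPolynomial (Sg ι κ) ℚ ⧸ imD ι κ) := (imD ι κ).mkQ.comp (sub ι κ).toLinearMap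
  have hF : Function.Surjective F := by
    intro x
    obtain ⟨g, rfl⟩ := (imD ι κ).mkQ_surjective x
    obtain ⟨q, y, hy, rfl⟩ := dec g
    refine ⟨q, ?_⟩
    rw [map_add]
    have : (imD ι κ).mkQ y = 0 := by simpa using hy
    rw [this, add_zero]; rfl
  have hker : ∀ q, F q = 0 → aeval (fun x : κ × κ => M x.1 x.2) q = 0 := by
    intro q hq
    have h1 : sub ι κ q ∈ imD ι κ := by
      rw [← Submodule.ker_mkQ (imD ι κ)]; exact hq
    have h2 := orth q h1
    apply Imin_kill M _ hmin
    apply sft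
    intro B A
    rw [← eval_sub, h2, map_zero]
  obtain ⟨s, hs⟩ := LinearMap.exists_rightInverse_of_surjective F (LinearMap.range_eq_top.2 hF)
  refine ⟨((aeval (R := ℚ) (fun x : κ × κ => M x.1 x.2)).toLinearMap.comp s).comp (imD ι κ).mkQ, ?_, ?_⟩
  · intro q
    have h1 : F (s (F q)) = F q := LinearMap.congr_fun hs (F q)
    have h2 := hker (s (F q) - q) (by rw [map_sub, h1, sub_self])
    rw [map_sub, sub_eq_zero] at h2
    exact h2
  · intro y hy
    have : (imD ι κ).mkQ y = 0 := by simpa using hy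
    rw [LinearMap.comp_apply, this, map_zero]

lemma rho_mul {R : Type*} [CommRing R] [Algebra ℚ R] (M : Matrix κ κ R)
    (ρ : MvPolynomial (Sg ι κ) ℚ →ₗ[ℚ] R) (h1 : ∀ q, ρ (sub ι κ q) = aeval (fun x : κ × κ => M x.1 x.2) q)
    (h2 : ∀ y ∈ imD ι κ, ρ y = 0) (c c' : κ) (g) :
    ρ ((mB ι κ * mA ι κ) c c' * g) = M c c' * ρ g := by
  obtain ⟨q, y, hy, rfl⟩ := dec g
  rw [mul_add, map_add, map_add, h2 _ hy, h2 _ (imD_mul c c' y hy), add_zero, add_zero, h1]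
  have : (mB ι κ * mA ι κ) c c' * sub ι κ q = sub ι κ (X (c, c') * q) := by
    rw [map_mul]; congr 1; rw [sub, aeval_X]
  rw [this, h1, map_mul, aeval_X]

/-- covariance of a square matrix under the derivations -/
def Cov (N : Matrix ι ι (MvPolynomial (Sg ι κ) ℚ)) : Prop :=
  ∀ i j a b, dD i j (N a b) = (if a = j then N i b else 0) - (if b = i then N a j else 0)

lemma cov_one : Cov (1 : Matrix ι ι (MvPolynomial (Sg ι κ) ℚ)) := by
  intro i j a b
  have : dD i j ((1 : Matrix ι ι (MvPolynomial (Sg ι κ) ℚ)) a b) = 0 := by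
    rw [Matrix.one_apply]; split_ifs
    · exact Derivation.map_one_eq_zero _
    · exact map_zero _
  rw [this]
  simp only [Matrix.one_apply]
  by_cases h1 : a = j <;> by_cases h2 : b = i <;> simp [h1, h2, eq_comm (a := i) (b := b)]

lemma cov_AB : Cov (mA ι κ * mB ι κ) := by
  intro i j a b
  simp only [Matrix.mul_apply, map_sum, Derivation.leibniz, dD_mA, dD_mB, smul_eq_mul, Finset.sum_add_distrib]
  split_ifs <;> simp [mul_comm] <;> ring

lemma cov_mul {N N' : Matrix ι ι (MvPolynomial (Sg ι κ) ℚ)} (h : Cov N) (h' : Cov N') : Cov (N * N') := by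
  intro i j a b
  simp only [Matrix.mul_apply, map_sum, Derivation.leibniz, h i j, h' i j, smul_eq_mul, mul_sub, Finset.sum_add_distrib, Finset.sum_sub_distrib]
  simp
  split_ifs <;> simp [mul_comm] <;> ring

lemma cov_pow (k : ℕ) : Cov ((mA ι κ * mB ι κ) ^ k) := by
  induction k with
  | zero => rw [pow_zero]; exact cov_one
  | succ k ih => rw [pow_succ]; exact cov_mul ih cov_AB

/-- setting the extra variables to zero -/
noncomputable def eps (ι κ : Type) : MvPolynomial (Sg ι (Option κ)) ℚ →ₐ[ℚ] MvPolynomial (Sg ι κ) ℚ :=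
  aeval (Sum.elim (fun x => x.2.elim 0 (fun c => mA ι κ x.1 c)) (fun x => x.1.elim 0 (fun c => mB ι κ c x.2)))

lemma eps_A (i : ι) (c : κ) : eps ι κ (mA ι (Option κ) i (some c)) = mA ι κ i c := by
  simp [eps, mA]
lemma eps_A0 (i : ι) : eps ι κ (mA ι (Option κ) i none) = 0 := by
  simp [eps, mA]
lemma eps_B (i : ι) (c : κ) : eps ι κ (mB ι (Option κ) (some c) i) = mB ι κ c i := by
  simp [eps, mB]
lemma eps_B0 (i : ι) : eps ι κ (mB ι (Option κ) none i) = 0 := by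
  simp [eps, mB]

lemma eps_dD (i j : ι) (x : MvPolynomial (Sg ι (Option κ)) ℚ) : eps ι κ (dD i j x) = dD i j (eps ι κ x) := by
  induction x using MvPolynomial.induction_on with
  | C a => 
    rw [algHom_C, show (C a : MvPolynomial (Sg ι (Option κ)) ℚ) = algebraMap _ _ a from rfl, Derivation.map_algebraMap, Derivation.map_algebraMap, map_zero]
  | add p q hp hq => simp only [map_add, hp, hq]
  | mul_X p n hp =>
    rw [Derivation.leibniz, map_mul, Derivation.leibniz, map_add, smul_eq_mul, smul_eq_mul, map_mul, map_mul, hp, smul_eq_mul, smul_eq_mul]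
    congr 2
    rcases n with ⟨a, c⟩ | ⟨c, a⟩
    · show eps ι κ (dD i j (mA ι (Option κ) a c)) = dD i j (eps ι κ (mA ι (Option κ) a c))
      rcases c with _ | c
      · rw [eps_A0, dD_mA, map_zero]; split_ifs
        · exact eps_A0 _
        · exact map_zero _
      · rw [eps_A, dD_mA, dD_mA]; split_ifs
        · exact eps_A _ _
        · exact map_zero _
    · show eps ι κ (dD i j (mB ι (Option κ) c a)) = dD i j (eps ι κ (mB ι (Option κ) c a))
      rcases c with _ | c
      · rw [eps_B0, dD_mB, map_zero]; split_ifs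
        · rw [map_neg, eps_B0, neg_zero]
        · exact map_zero _
      · rw [eps_B, dD_mB, dD_mB]; split_ifs
        · rw [map_neg, eps_B]
        · exact map_zero _

lemma pd_mA (s : Sg ι κ) (i : ι) (c : κ) : pderiv s (mA ι κ i c) = if s = Sum.inl (i, c) then 1 else 0 := by
  simp only [mA, Matrix.of_apply, pderiv_X, Pi.single_apply, eq_comm]
lemma pd_mB (s : Sg ι κ) (i : ι) (c : κ) : pderiv s (mB ι κ c i) = if s = Sum.inr (c, i) then 1 else 0 := by
  simp only [mB, Matrix.of_apply, pderiv_X, Pi.single_apply, eq_comm]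

lemma comm_xi (a i j : ι) (c0 : κ) (x : MvPolynomial (Sg ι κ) ℚ) :
    pderiv (Sum.inl (a, c0)) (dD i j x) = dD i j (pderiv (Sum.inl (a, c0)) x)
      + if a = i then pderiv (Sum.inl (j, c0)) x else 0 := by
  have : ⁅pderiv (R := ℚ) (Sum.inl (a, c0) : Sg ι κ), dD (κ := κ) i j⁆ = if a = i then pderiv (Sum.inl (j, c0)) else 0 := by
    apply MvPolynomial.derivation_ext
    intro n
    rw [Derivation.commutator_apply]
    rcases n with ⟨b, c⟩ | ⟨c, b⟩
    · show pderiv _ (dD i j (mA ι κ b c)) - dD i j (pderiv _ (mA ι κ b c)) = _ 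
      rw [dD_mA, pd_mA]
      have : dD (κ := κ) i j (if (Sum.inl (a, c0) : Sg ι κ) = Sum.inl (b, c) then 1 else 0) = 0 := by
        split_ifs
        · exact Derivation.map_one_eq_zero _
        · exact map_zero _
      rw [this, sub_zero]
      show _ = (if a = i then pderiv (Sum.inl (j, c0)) else 0 : Derivation ℚ (MvPolynomial (Sg ι κ) ℚ) (MvPolynomial (Sg ι κ) ℚ)) (mA ι κ b c)
      by_cases h1 : a = i <;> by_cases h2 : b = j <;> by_cases h3 : c0 = c <;> simp [h1, h2, h3, pd_mA, eq_comm (a := j) (b := b)]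
    · show pderiv _ (dD i j (mB ι κ c b)) - dD i j (pderiv _ (mB ι κ c b)) = (if a = i then pderiv (Sum.inl (j, c0)) else 0 : Derivation ℚ (MvPolynomial (Sg ι κ) ℚ) (MvPolynomial (Sg ι κ) ℚ)) (mB ι κ c b)
      rw [dD_mB, pd_mB]
      by_cases h1 : a = i <;> by_cases h2 : b = i <;> simp [h1, h2, pd_mB]
  have h2 := congrArg (fun d => d x) this
  simp only [Derivation.commutator_apply] at h2
  rw [sub_eq_iff_eq_add'] at h2
  rw [h2]
  congr 1
  split_ifs <;> rfl

lemma comm_eta (a i j : ι) (c0 : κ) (x : MvPolynomial (Sg ι κ) ℚ) :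
    pderiv (Sum.inr (c0, a)) (dD i j x) = dD i j (pderiv (Sum.inr (c0, a)) x)
      - if a = j then pderiv (Sum.inr (c0, i)) x else 0 := by
  have : ⁅pderiv (R := ℚ) (Sum.inr (c0, a) : Sg ι κ), dD (κ := κ) i j⁆ = - if a = j then pderiv (Sum.inr (c0, i)) else 0 := by
    apply MvPolynomial.derivation_ext
    intro n
    rw [Derivation.commutator_apply]
    rcases n with ⟨b, c⟩ | ⟨c, b⟩
    · show pderiv _ (dD i j (mA ι κ b c)) - dD i j (pderiv _ (mA ι κ b c)) = (- if a = j then pderiv (Sum.inr (c0, i)) else 0 : Derivation ℚ (MvPolynomial (Sg ι κ) ℚ) (MvPolynomial (Sg ι κ) ℚ)) (mA ι κ b c)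
      rw [dD_mA, pd_mA]
      by_cases h1 : a = j <;> by_cases h2 : b = j <;> simp [h1, h2, pd_mA]
    · show pderiv _ (dD i j (mB ι κ c b)) - dD i j (pderiv _ (mB ι κ c b)) = _ 
      rw [dD_mB, pd_mB]
      have : dD (κ := κ) i j (if (Sum.inr (c0, a) : Sg ι κ) = Sum.inr (c, b) then 1 else 0) = 0 := by
        split_ifs
        · exact Derivation.map_one_eq_zero _
        · exact map_zero _
      rw [this, sub_zero]
      show _ = (- if a = j then pderiv (Sum.inr (c0, i)) else 0 : Derivation ℚ (MvPolynomial (Sg ι κ) ℚ) (MvPolynomial (Sg ι κ) ℚ)) (mB ι κ c b)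
      by_cases h1 : a = j <;> by_cases h2 : b = i <;> by_cases h3 : c0 = c <;> simp [h1, h2, h3, pd_mB, eq_comm (a := i) (b := b)]
  have h2 := congrArg (fun d => d x) this
  simp only [Derivation.commutator_apply] at h2
  rw [sub_eq_iff_eq_add'] at h2
  rw [h2, sub_eq_add_neg]
  congr 1
  split_ifs <;> simp

end P3d
end NilpPf

namespace NilpPf
section P3e
open Matrix

variable {ι κ : Type} [Fintype ι] [DecidableEq ι] [Fintype κ] [DecidableEq κ]

noncomputable def Lam (T : Matrix ι ι (MvPolynomial (Sg ι κ) ℚ)) (x : MvPolynomial (Sg ι (Option κ)) ℚ) :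
    MvPolynomial (Sg ι κ) ℚ :=
  ∑ a, ∑ b, T a b * eps ι κ (pderiv (Sum.inl (a, none)) (pderiv (Sum.inr (none, b)) x))

lemma Lam_add (T : Matrix ι ι (MvPolynomial (Sg ι κ) ℚ)) (x y : MvPolynomial (Sg ι (Option κ)) ℚ) :
    Lam T (x + y) = Lam T x + Lam T y := by
  simp only [Lam, map_add, mul_add, Finset.sum_add_distrib]

lemma Lam_smul (T : Matrix ι ι (MvPolynomial (Sg ι κ) ℚ)) (r : ℚ) (x : MvPolynomial (Sg ι (Option κ)) ℚ) :
    Lam T (r • x) = r • Lam T x := by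
  simp only [Lam, Derivation.map_smul, map_smul, mul_smul_comm, Finset.smul_sum]

lemma Lam_dD (T : Matrix ι ι (MvPolynomial (Sg ι κ) ℚ)) (hT : Cov T) (i j : ι) (x : MvPolynomial (Sg ι (Option κ)) ℚ) :
    Lam T (dD i j x) = dD i j (Lam T x) := by
  have h1 : ∀ a b, T a b * eps ι κ (pderiv (Sum.inl (a, none)) (pderiv (Sum.inr (none, b)) (dD i j x)))
    = T a b * dD i j (eps ι κ (pderiv (Sum.inl (a, none)) (pderiv (Sum.inr (none, b)) x)))
      + (if a = i then T i b * eps ι κ (pderiv (Sum.inl (j, none)) (pderiv (Sum.inr (none, b)) x)) else 0)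
      - (if b = j then T a j * eps ι κ (pderiv (Sum.inl (a, none)) (pderiv (Sum.inr (none, i)) x)) else 0) := by
    intro a b
    rw [comm_eta, map_sub, comm_xi, map_sub, map_add, eps_dD]
    by_cases h1 : a = i <;> by_cases h2 : b = j <;> simp [h1, h2] <;> ring
  have h2 : ∀ a b, dD i j (T a b * eps ι κ (pderiv (Sum.inl (a, none)) (pderiv (Sum.inr (none, b)) x)))
    = T a b * dD i j (eps ι κ (pderiv (Sum.inl (a, none)) (pderiv (Sum.inr (none, b)) x)))
      + (if a = j then T i b * eps ι κ (pderiv (Sum.inl (j, none)) (pderiv (Sum.inr (none, b)) x)) else 0)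
      - (if b = i then T a j * eps ι κ (pderiv (Sum.inl (a, none)) (pderiv (Sum.inr (none, i)) x)) else 0) := by
    intro a b
    rw [Derivation.leibniz, hT i j a b, smul_eq_mul, smul_eq_mul]
    by_cases h1 : a = j <;> by_cases h2 : b = i <;> simp [h1, h2] <;> ring
  simp only [Lam, map_sum, h1, h2, Finset.sum_add_distrib, Finset.sum_sub_distrib]
  simp [Finset.sum_ite_eq', Finset.sum_ite_irrel]

lemma chain {σ τ : Type} [Fintype σ] (d : Derivation ℚ (MvPolynomial τ ℚ) (MvPolynomial τ ℚ))
    (f : σ → MvPolynomial τ ℚ) (q : MvPolynomial σ ℚ) :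
    d (aeval f q) = ∑ s, aeval f (pderiv s q) * d (f s) := by
  classical
  induction q using MvPolynomial.induction_on with
  | C a =>
    simp only [pderiv_C, map_zero, zero_mul, Finset.sum_const_zero]
    rw [aeval_C]; exact Derivation.map_algebraMap _ _
  | add p q hp hq => simp only [map_add, hp, hq, add_mul, Finset.sum_add_distrib]
  | mul_X p n hp =>
    simp only [map_mul, Derivation.leibniz, map_add, smul_eq_mul, aeval_X, hp, pderiv_X, Pi.single_apply,
      add_mul, Finset.sum_add_distrib]
    congr 1
    · rw [Finset.sum_eq_single n]
      · simp
      · intro b _ hb; simp [Ne.symm hb]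
      · simp
    · rw [Finset.mul_sum]
      exact Finset.sum_congr rfl fun i _ => by ring

lemma pd_eta_BA (b : ι) (c c' : Option κ) :
    pderiv (Sum.inr (none, b)) ((mB ι (Option κ) * mA ι (Option κ)) c c') = if c = none then mA ι (Option κ) b c' else 0 := by
  simp only [Matrix.mul_apply, map_sum, Derivation.leibniz, pd_mA, pd_mB, smul_eq_mul]
  by_cases h : c = none
  · subst h; simp
  · simp [h, Ne.symm h]

lemma pd_xi_BA (a : ι) (c c' : Option κ) :
    pderiv (Sum.inl (a, none)) ((mB ι (Option κ) * mA ι (Option κ)) c c') = if c' = none then mB ι (Option κ) c a else 0 := by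
  simp only [Matrix.mul_apply, map_sum, Derivation.leibniz, pd_mA, pd_mB, smul_eq_mul]
  by_cases h : c' = none
  · subst h; simp
  · simp [h, Ne.symm h]

/-- restriction of polynomials in the bigger generic matrix -/
noncomputable def pis (κ : Type) : MvPolynomial (Option κ × Option κ) ℚ →ₐ[ℚ] MvPolynomial (κ × κ) ℚ :=
  aeval (fun x => x.1.elim 0 (fun c => x.2.elim 0 (fun c' => X (c, c'))))

lemma eps_sub (q : MvPolynomial (Option κ × Option κ) ℚ) : eps ι κ (sub ι (Option κ) q) = sub ι κ (pis κ q) := by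
  have : (eps ι κ).comp (sub ι (Option κ)) = (sub ι κ).comp (pis κ) := by
    apply MvPolynomial.algHom_ext
    rintro ⟨c, c'⟩
    rw [AlgHom.comp_apply, AlgHom.comp_apply, sub, aeval_X, pis, aeval_X, Matrix.mul_apply, map_sum]
    rcases c with _ | c
    · simp [eps_B0]
    · rcases c' with _ | c'
      · simp [eps_A0]
      · simp [eps_A, eps_B, sub, Matrix.mul_apply]
  exact DFunLike.congr_fun this q

lemma Lam_sub (T : Matrix ι ι (MvPolynomial (Sg ι κ) ℚ)) (q : MvPolynomial (Option κ × Option κ) ℚ) :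
    ∃ (p0 : MvPolynomial (κ × κ) ℚ) (p : κ → κ → MvPolynomial (κ × κ) ℚ),
      Lam T (sub ι (Option κ) q) = sub ι κ p0 * T.trace +
        ∑ c, ∑ c', sub ι κ (p c c') * (mB ι κ * T * mA ι κ) c c' := by
  refine ⟨pis κ (pderiv (none, none) q), fun c c' => pis κ (pderiv (some c, none) (pderiv (none, some c') q)), ?_⟩
  have h1 : ∀ b, pderiv (Sum.inr (none, b)) (sub ι (Option κ) q) =
      ∑ c', sub ι (Option κ) (pderiv (none, c') q) * mA ι (Option κ) b c' := by
    intro b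
    rw [sub, chain, Fintype.sum_prod_type, Finset.sum_eq_single none]
    · simp only [pd_eta_BA, if_true]
    · intro c _ hc
      simp [pd_eta_BA, hc]
    · simp
  have h2 : ∀ a (q' : MvPolynomial (Option κ × Option κ) ℚ), pderiv (Sum.inl (a, none)) (sub ι (Option κ) q') =
      ∑ c, sub ι (Option κ) (pderiv (c, none) q') * mB ι (Option κ) c a := by
    intro a q'
    rw [sub, chain, Fintype.sum_prod_type]
    refine Finset.sum_congr rfl fun c _ => ?_
    rw [Finset.sum_eq_single none]
    · simp only [pd_xi_BA, if_true]
    · intro c _ hc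
      simp [pd_xi_BA, hc]
    · simp
  have h3 : ∀ a b, eps ι κ (pderiv (Sum.inl (a, none)) (pderiv (Sum.inr (none, b)) (sub ι (Option κ) q)))
      = (if a = b then sub ι κ (pis κ (pderiv (none, none) q)) else 0)
        + ∑ c', ∑ c, sub ι κ (pis κ (pderiv (some c, none) (pderiv (none, some c') q))) * mB ι κ c a * mA ι κ b c' := by
    intro a b
    rw [h1, map_sum, map_sum, Fintype.sum_option]
    congr 1
    · rw [Derivation.leibniz, map_add, smul_eq_mul, smul_eq_mul, map_mul, map_mul, eps_A0, zero_mul, add_zero, eps_sub, pd_mA]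
      by_cases h : a = b <;> simp [h]
    · refine Finset.sum_congr rfl fun c' _ => ?_
      rw [Derivation.leibniz, map_add, smul_eq_mul, smul_eq_mul, map_mul, map_mul, pd_mA, h2, map_sum, Fintype.sum_option,
        map_mul, eps_B0, mul_zero, zero_add, eps_A]
      simp only [map_mul, eps_B, eps_sub]
      simp only [Sum.inl.injEq, Prod.mk.injEq, reduceCtorEq, and_false, if_false, map_zero, mul_zero, zero_add]
      rw [Finset.mul_sum]
      exact Finset.sum_congr rfl fun c _ => by ring
  simp only [Lam, h3, mul_add, Finset.sum_add_distrib]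
  congr 1
  · simp [Matrix.trace]
    rw [← Finset.sum_mul, mul_comm]
  · simp only [Matrix.mul_apply, Finset.mul_sum, Finset.sum_mul]
    have e1 : ∀ F : ι → ι → κ → κ → MvPolynomial (Sg ι κ) ℚ,
        ∑ a, ∑ b, ∑ c', ∑ c, F a b c c' = ∑ c, ∑ c', ∑ b, ∑ a, F a b c c' := by
      intro F
      calc _ = ∑ a, ∑ c', ∑ b, ∑ c, F a b c c' := Finset.sum_congr rfl fun q _ => Finset.sum_comm
        _ = ∑ c', ∑ a, ∑ b, ∑ c, F a b c c' := Finset.sum_comm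
        _ = ∑ c', ∑ a, ∑ c, ∑ b, F a b c c' := Finset.sum_congr rfl fun q _ => Finset.sum_congr rfl fun q _ => Finset.sum_comm
        _ = ∑ c', ∑ c, ∑ a, ∑ b, F a b c c' := Finset.sum_congr rfl fun q _ => Finset.sum_comm
        _ = ∑ c, ∑ c', ∑ a, ∑ b, F a b c c' := Finset.sum_comm
        _ = _ := Finset.sum_congr rfl fun q _ => Finset.sum_congr rfl fun q _ => Finset.sum_comm
    rw [e1]
    refine Finset.sum_congr rfl fun c _ => Finset.sum_congr rfl fun c' _ => Finset.sum_congr rfl fun b _ => Finset.sum_congr rfl fun a _ => ?_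
    ring

lemma sub_gX_pow (k : ℕ) : ((gX κ) ^ k).map (sub ι κ) = (mB ι κ * mA ι κ) ^ k := by
  have h := map_pow ((sub ι κ).toRingHom.mapMatrix) (gX κ) k
  have h2 : (sub ι κ).toRingHom.mapMatrix (gX κ) = mB ι κ * mA ι κ := by
    ext i j
    simp [gX, sub]
  rw [h2] at h
  exact h

lemma mBTA (k : ℕ) : mB ι κ * (mA ι κ * mB ι κ) ^ k * mA ι κ = (mB ι κ * mA ι κ) ^ (k + 1) := by
  induction k with
  | zero => simp
  | succ k ih =>
    rw [pow_succ (mB ι κ * mA ι κ) (k + 1), ← ih, pow_succ]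
    simp only [Matrix.mul_assoc]

lemma trAB (k : ℕ) (hk : 1 ≤ k) : ((mA ι κ * mB ι κ) ^ k).trace = ((mB ι κ * mA ι κ) ^ k).trace := by
  obtain ⟨k, rfl⟩ : ∃ k', k = k' + 1 := ⟨k - 1, by omega⟩
  rw [← mBTA, Matrix.mul_assoc, Matrix.trace_mul_comm (mB ι κ), pow_succ, Matrix.mul_assoc]

theorem rho_kill {R : Type*} [CommRing R] [Algebra ℚ R] (M : Matrix κ κ R)
    (ρ : MvPolynomial (Sg ι κ) ℚ →ₗ[ℚ] R) (h1 : ∀ q, ρ (sub ι κ q) = aeval (fun x : κ × κ => M x.1 x.2) q)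
    (h2 : ∀ y ∈ imD ι κ, ρ y = 0) (k : ℕ) (hk : 1 ≤ k) (htr : (M ^ k).trace = 0) (hM : M ^ (k + 1) = 0)
    (a b : ι) (g) : ρ (g * ((mA ι κ * mB ι κ) ^ k) a b) = 0 := by
  have hpow : ∀ (j : ℕ) (c c' : κ), aeval (fun x : κ × κ => M x.1 x.2) (((gX κ) ^ j) c c') = (M ^ j) c c' := by
    intro j c c'
    have h := map_pow ((aeval (R := ℚ) (fun x : κ × κ => M x.1 x.2)).toRingHom.mapMatrix) (gX κ) j
    have h2 : (aeval (R := ℚ) (fun x : κ × κ => M x.1 x.2)).toRingHom.mapMatrix (gX κ) = M := by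
      ext i j
      simp [gX]
    rw [h2] at h
    exact congrFun (congrFun h c) c'
  set T := (mA ι κ * mB ι κ) ^ k with hT
  have hsub : ∀ q, ρ (Lam T (sub ι (Option κ) q)) = 0 := by
    intro q
    obtain ⟨p0, p, hp⟩ := Lam_sub T q
    rw [hp, hT, trAB k hk, mBTA, ← sub_gX_pow, ← sub_gX_pow]
    have e1 : ((gX κ ^ k).map (sub ι κ)).trace = sub ι κ ((gX κ ^ k).trace) := by
      simp [Matrix.trace]
    rw [e1, ← map_mul, map_add, h1, map_sum]
    have e2 : aeval (fun x : κ × κ => M x.1 x.2) ((gX κ ^ k).trace) = 0 := by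
      rw [← htr]; simp only [Matrix.trace, map_sum, Matrix.diag_apply, hpow]
    rw [map_mul, e2, mul_zero, zero_add]
    refine Finset.sum_eq_zero fun c _ => ?_
    rw [map_sum]
    refine Finset.sum_eq_zero fun c' _ => ?_
    rw [Matrix.map_apply, ← map_mul, h1, map_mul, hpow, hM]
    simp
  have hall : ∀ x, ρ (Lam T x) = 0 := by
    intro x
    obtain ⟨q, y, hy, rfl⟩ := dec x
    rw [Lam_add, map_add, hsub, zero_add]
    let Ll : MvPolynomial (Sg ι (Option κ)) ℚ →ₗ[ℚ] MvPolynomial (Sg ι κ) ℚ :=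
      { toFun := Lam T, map_add' := Lam_add T, map_smul' := Lam_smul T }
    have : imD ι (Option κ) ≤ (imD ι κ).comap Ll := by
      apply imD_induct
      intro i j f
      show Lam T (dD i j f) ∈ imD ι κ
      rw [Lam_dD T (cov_pow k)]
      exact dD_mem _ _ _
    exact h2 _ (this hy)
  let gh : MvPolynomial (Sg ι (Option κ)) ℚ := rename (Sum.map (Prod.map id some) (Prod.map some id)) g
  have hgh : eps ι κ gh = g := by
    show eps ι κ (rename _ g) = g
    rw [eps, aeval_rename]
    conv_rhs => rw [← aeval_X_left_apply g]
    congr 2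
    funext s
    rcases s with ⟨i, c⟩ | ⟨c, i⟩ <;> rfl
  have := hall (gh * (mB ι (Option κ) none b * mA ι (Option κ) a none))
  rw [← this]
  congr 1
  have h3 : ∀ a' b', eps ι κ (pderiv (Sum.inl (a', none)) (pderiv (Sum.inr (none, b')) (gh * (mB ι (Option κ) none b * mA ι (Option κ) a none))))
      = if a' = a then if b' = b then g else 0 else 0 := by
    intro a' b'
    simp only [Derivation.leibniz, pd_mA, pd_mB, map_add, smul_eq_mul, map_mul, eps_A0, eps_B0]
    by_cases e1 : a' = a <;> by_cases e2 : b' = b <;> simp [e1, e2, eps_A0, eps_B0, hgh, pd_mA, pd_mB, Derivation.leibniz]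
  rw [Lam]
  simp only [h3]
  simp [mul_comm]

end P3e
end NilpPf

namespace NilpPf
section P3f
open Matrix
universe u
variable {ι κ : Type} [Fintype ι] [DecidableEq ι] [Fintype κ] [DecidableEq κ]

noncomputable def rhoE {R : Type u} [CommRing R] [Algebra ℚ R] (ρ : MvPolynomial (Sg ι κ) ℚ →ₗ[ℚ] R) :
    MvPolynomial (Sg ι κ) R →ₗ[R] R :=
  (basisMonomials (Sg ι κ) R).constr R (fun d => ρ (monomial d 1))

lemma rhoE_map {R : Type u} [CommRing R] [Algebra ℚ R] (ρ : MvPolynomial (Sg ι κ) ℚ →ₗ[ℚ] R)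
    (g : MvPolynomial (Sg ι κ) ℚ) : rhoE ρ (MvPolynomial.map (algebraMap ℚ R) g) = ρ g := by
  induction g using MvPolynomial.induction_on' with
  | monomial d q =>
    rw [map_monomial]
    have h1 : (monomial d (algebraMap ℚ R q) : MvPolynomial (Sg ι κ) R) = (algebraMap ℚ R q) • basisMonomials (Sg ι κ) R d := by
      rw [coe_basisMonomials, smul_monomial, smul_eq_mul, mul_one]
    have h2 : (monomial d q : MvPolynomial (Sg ι κ) ℚ) = q • monomial d 1 := by
      rw [smul_monomial, smul_eq_mul, mul_one]
    rw [h1, map_smul, rhoE, Module.Basis.constr_basis, h2, map_smul, smul_eq_mul, Algebra.smul_def]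
  | add p q hp hq => rw [map_add, map_add, map_add, hp, hq]

lemma rhoE_ind {R : Type u} [CommRing R] [Algebra ℚ R] (ρ : MvPolynomial (Sg ι κ) ℚ →ₗ[ℚ] R)
    (x : MvPolynomial (Sg ι κ) R)
    (h : ∀ g : MvPolynomial (Sg ι κ) ℚ, rhoE ρ (MvPolynomial.map (algebraMap ℚ R) g * x) = 0) (g) : rhoE ρ (g * x) = 0 := by
  induction g using MvPolynomial.induction_on' with
  | monomial d r =>
    have : (monomial d r : MvPolynomial (Sg ι κ) R) = r • MvPolynomial.map (algebraMap ℚ R) (monomial d 1) := by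
      rw [map_monomial, smul_monomial, map_one, smul_eq_mul, mul_one]
    rw [this, smul_mul_assoc, map_smul, h, smul_zero]
  | add p q hp hq => rw [add_mul, map_add, hp, hq, add_zero]

theorem key {R : Type u} [CommRing R] [Algebra ℚ R] (M : Matrix κ κ R)
    (hmin : ∀ f g : Fin (Fintype.card ι + 1) → κ, (M.submatrix f g).det = 0)
    (k : ℕ) (hk : 1 ≤ k) (htr : (M ^ k).trace = 0) (hM : M ^ (k + 1) = 0) :
    ∃ (R1 : Type u) (_ : CommRing R1) (_ : Algebra ℚ R1) (φ : R →+* R1) (A : Matrix ι κ R1) (B : Matrix κ ι R1),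
      Function.Injective φ ∧ B * A = M.map φ ∧ (A * B) ^ k = 0 := by
  obtain ⟨ρ, h1, h2⟩ := exists_rho (ι := ι) M hmin
  let f : MvPolynomial (Sg ι κ) ℚ →+* MvPolynomial (Sg ι κ) R := MvPolynomial.map (algebraMap ℚ R)
  let A0 := (mA ι κ).map f
  let B0 := (mB ι κ).map f
  let S : Set (MvPolynomial (Sg ι κ) R) :=
    (Set.range fun x : κ × κ => (B0 * A0) x.1 x.2 - C (M x.1 x.2)) ∪
      Set.range fun x : ι × ι => ((A0 * B0) ^ k) x.1 x.2
  let I := Ideal.span S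
  have hBA : B0 * A0 = (mB ι κ * mA ι κ).map f := (Matrix.map_mul).symm
  have hAB : (A0 * B0) ^ k = ((mA ι κ * mB ι κ) ^ k).map f := by
    have : A0 * B0 = f.mapMatrix (mA ι κ * mB ι κ) := (Matrix.map_mul).symm
    rw [this, ← map_pow]; rfl
  have hgen : ∀ x ∈ S, ∀ g, rhoE ρ (g * x) = 0 := by
    rintro _ (⟨⟨c, c'⟩, rfl⟩ | ⟨⟨a, b⟩, rfl⟩)
    · apply rhoE_ind
      intro g
      dsimp only
      rw [hBA, mul_sub, map_sub, Matrix.map_apply, ← map_mul, rhoE_map, mul_comm g, rho_mul M ρ h1 h2,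
        mul_comm _ (C _), C_mul', map_smul, rhoE_map, smul_eq_mul, sub_self]
    · apply rhoE_ind
      intro g
      dsimp only
      rw [hAB, Matrix.map_apply, ← map_mul, rhoE_map, rho_kill M ρ h1 h2 k hk htr hM]
  have hI : ∀ y ∈ I, ∀ g, rhoE ρ (g * y) = 0 := by
    intro y hy
    induction hy using Submodule.span_induction with
    | mem x h => exact hgen x h
    | zero => intro g; rw [mul_zero, map_zero]
    | add x y _ _ hx hy => intro g; rw [mul_add, map_add, hx, hy, add_zero]
    | smul a x _ hx => intro g; rw [smul_eq_mul, ← mul_assoc, hx]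
  let π := Ideal.Quotient.mk I
  refine ⟨MvPolynomial (Sg ι κ) R ⧸ I, inferInstance, inferInstance, π.comp C, A0.map π, B0.map π, ?_, ?_, ?_⟩
  · rw [injective_iff_map_eq_zero]
    intro r hr
    have hr' : C r ∈ I := Ideal.Quotient.eq_zero_iff_mem.1 hr
    have h3 := hI _ hr' 1
    have h4 : (1 * C r : MvPolynomial (Sg ι κ) R) = r • f 1 := by
      rw [map_one, one_mul, ← C_mul', mul_one]
    have h5 : ρ 1 = 1 := by
      have := h1 1
      rwa [map_one (sub ι κ), map_one (aeval _)] at this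
    rw [h4, map_smul, rhoE_map, h5, smul_eq_mul, mul_one] at h3
    exact h3
  · rw [← Matrix.map_mul]
    ext c c'
    show π _ = π _
    apply Ideal.Quotient.eq.2
    exact Ideal.subset_span (Or.inl ⟨(c, c'), rfl⟩)
  · rw [← Matrix.map_mul]
    have : (A0 * B0).map π ^ k = ((A0 * B0) ^ k).map π := (map_pow π.mapMatrix _ _).symm
    rw [this]
    ext a b
    exact Ideal.Quotient.eq_zero_iff_mem.2 (Ideal.subset_span (Or.inr ⟨(a, b), rfl⟩))

end P3f
end NilpPf

namespace NilpPf
section PT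
open Matrix
universe u

/-- level function on a block sum -/
abbrev lv (N : ℕ) {ν : Type} (lev : ν → ℕ) : Fin N ⊕ ν → ℕ := Sum.elim (fun _ => 0) (fun p => lev p + 1)

lemma card_lv_zero (N : ℕ) {ν : Type} [Fintype ν] (lev : ν → ℕ) :
    Fintype.card {p // lv N lev p = 0} = N := by
  rw [Fintype.card_congr (Equiv.subtypeSum), Fintype.card_sum]
  simp

lemma card_lv_succ (N : ℕ) {ν : Type} [Fintype ν] (lev : ν → ℕ) (i : ℕ) :
    Fintype.card {p // lv N lev p = i + 1} = Fintype.card {p // lev p = i} := by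
  rw [Fintype.card_congr (Equiv.subtypeSum), Fintype.card_sum]
  simp

theorem tower (e : ℕ) : ∀ (N : ℕ) (R : Type u) [CommRing R] [Algebra ℚ R] (M : Matrix (Fin N) (Fin N) R),
    M ^ (e + 1) = 0 → M.charpoly = Polynomial.X ^ N →
    ∃ (R' : Type u) (_ : CommRing R') (_ : Algebra ℚ R') (φ : R →+* R') (ν : Type) (_ : Fintype ν) (_ : DecidableEq ν)
      (lev : ν → ℕ) (A B : Matrix (Fin N ⊕ ν) (Fin N ⊕ ν) R'),
      Function.Injective φ ∧ (∀ p, lev p + 1 < e + 1) ∧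
      (∀ i, (Fintype.card {p // lv N lev p = i + 1} : ℤ) - Fintype.card {p // lv N lev p = i + 2} ≤
        Fintype.card {p // lv N lev p = i} - Fintype.card {p // lv N lev p = i + 1}) ∧
      Fintype.card {p // lv N lev p = 1} + (N + e) / (e + 1) = N ∧
      HasDeg (lv N lev) A 1 ∧ HasDeg (lv N lev) B (-1) ∧
      (∀ p q, lv N lev p = lv N lev q → 1 ≤ lv N lev p → (A * B) p q = (B * A) p q) ∧
      (∀ i j, (B * A) (Sum.inl i) (Sum.inl j) = φ (M i j)) := by
  induction e with
  | zero =>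
    intro N R _ _ M hM hc
    refine ⟨R, inferInstance, inferInstance, RingHom.id R, Empty, inferInstance, inferInstance, Empty.elim, 0, 0,
      Function.injective_id, fun p => p.elim, ?_, ?_, ?_, ?_, ?_, ?_⟩
    · intro i
      rw [card_lv_succ, card_lv_succ]
      simp
    · rw [card_lv_succ]; simp
    · intro p q _; rfl
    · intro p q _; rfl
    · intro p q _ _; rfl
    · intro i j
      rw [zero_add, pow_one] at hM
      simp [hM]
  | succ e ih =>
    intro N R _ _ M hM hc
    set c := (N + (e + 1)) / (e + 1 + 1) with hcdef
    have hc1 : c * (e + 2) ≤ N + (e + 1) := Nat.div_mul_le_self _ _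
    have hc2 : N + (e + 1) < (c + 1) * (e + 2) := by
      have := Nat.lt_div_mul_add (a := N + (e + 1)) (b := e + 1 + 1) (by omega)
      rw [← hcdef] at this
      nlinarith
    have hcN : c ≤ N := by
      by_contra h
      push Not at h
      nlinarith
    set m := N - c with hm
    have hmin : ∀ f g : Fin (Fintype.card (Fin m) + 1) → Fin N, (M.submatrix f g).det = 0 := by
      intro f g
      rcases Nat.eq_zero_or_pos c with h0 | h0
      · exfalso
        rw [h0] at hc2
        have : N = 0 := by omega
        subst this
        exact (f 0).elim0
      · refine Polynomial.nilp_minors (j := c - 1) M (e + 1 + 1) (by omega) hM hc ?_ ?_ f g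
        · obtain ⟨c', hc'⟩ : ∃ c', c = c' + 1 := ⟨c - 1, by omega⟩
          rw [hc'] at hc1 ⊢
          simp only [Nat.add_sub_cancel]
          nlinarith
        · rw [Fintype.card_fin]; omega
    have htr := (Polynomial.charpoly_of_coeff M (e + 1 + 1) (by omega) hM (by
      intro j hj _ hjN
      rw [hc, Polynomial.coeff_X_pow, if_neg (by omega)])).2 (e + 1) (by omega)
    obtain ⟨R1, i1, i2, φ1, A1, B1, hφ1, hBA1, hAB1⟩ := key (ι := Fin m) M hmin (e + 1) (by omega) htr hM
    have hch : (A1 * B1).charpoly = Polynomial.X ^ m := by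
      have h1 := charpoly_mul_comm' A1 B1
      rw [hBA1] at h1
      have h2 : (M.map φ1).charpoly = Polynomial.X ^ N := by
        rw [Matrix.charpoly_map, hc]; simp
      rw [h2, Fintype.card_fin, Fintype.card_fin, mul_comm (Polynomial.X ^ m)] at h1
      exact (Polynomial.isRegular_X_pow _).left.eq_iff.mp h1
    obtain ⟨R2, i3, i4, φ2, ν, i5, i6, lev, A2, B2, hφ2, hlev, hconv, hcard, hA2, hB2, hE, h0⟩ :=
      ih m R1 (A1 * B1) hAB1 hch
    let A3 : Matrix (Fin m ⊕ ν) (Fin N) R2 := fromRows (A1.map φ2) 0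
    let B3 : Matrix (Fin N) (Fin m ⊕ ν) R2 := fromCols (B1.map φ2) 0
    refine ⟨R2, i3, i4, φ2.comp φ1, Fin m ⊕ ν, inferInstance, inferInstance, lv m lev,
      fromBlocks 0 0 A3 A2, fromBlocks 0 B3 0 B2, hφ2.comp hφ1, ?_, ?_, ?_, ?_, ?_, ?_, ?_⟩
    · rintro (p | p)
      · simp
      · have := hlev p; simp; omega
    · intro i
      rw [card_lv_succ, card_lv_succ]
      rcases i with _ | i
      · rw [card_lv_zero, card_lv_zero]
        have h3 : (m + e) / (e + 1) ≤ c := by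
          rw [Nat.div_le_iff_le_mul_add_pred (by omega)]
          have : N ≤ c * (e + 2) := by nlinarith
          have : m + c = N := by omega
          simp only [Nat.add_sub_cancel]
          nlinarith
        simp only [zero_add]
        omega
      · rw [card_lv_succ N (lv m lev) i]
        exact hconv i
    · rw [card_lv_succ, card_lv_zero]; omega
    · rintro (p | p) (q | q) h
      · rfl
      · rfl
      · rcases p with p | p
        · simp at h
        · rfl
      · apply hA2
        simp only [lv, Sum.elim_inr] at h ⊢
        push_cast at h
        omega
    · rintro (p | p) (q | q) h
      · rfl
      · rcases q with q | q
        · simp at h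
        · rfl
      · rfl
      · apply hB2
        simp only [lv, Sum.elim_inr] at h ⊢
        push_cast at h
        omega
    · rintro (p | p) (q | q) h h'
      · simp at h'
      · simp at h'
      · simp at h
      · rw [fromBlocks_multiply, fromBlocks_multiply]
        simp only [fromBlocks_apply₂₂, Matrix.add_apply, Matrix.zero_mul, Matrix.mul_zero, zero_add, Matrix.zero_apply]
        have h2 : lv m lev p = lv m lev q := by simpa using h
        by_cases h3 : 1 ≤ lv m lev p
        · rw [hE p q h2 h3]
          convert zero_add _
          rw [Matrix.mul_apply]
          refine Finset.sum_eq_zero fun x _ => ?_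
          rcases p with p | p
          · simp at h3
          · show (0 : R2) * _ = 0
            rw [zero_mul]
        · rcases p with p | p
          · rcases q with q | q
            · rw [h0]
              have : (A2 * B2) (Sum.inl p) (Sum.inl q) = 0 := by
                rw [Matrix.mul_apply]
                refine Finset.sum_eq_zero fun x _ => ?_
                rw [hA2 _ _ (by simp; omega), zero_mul]
              rw [this, add_zero]
              simp [A3, B3, Matrix.mul_apply]
            · simp at h2
          · simp at h3
    · intro i j
      rw [fromBlocks_multiply]
      simp only [fromBlocks_apply₁₁, Matrix.add_apply, Matrix.zero_mul, Matrix.mul_zero, zero_add, Matrix.zero_apply]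
      have h2 : φ1 (M i j) = (B1 * A1) i j := by rw [hBA1]; rfl
      rw [RingHom.comp_apply, h2]
      simp [A3, B3, Matrix.mul_apply, Fintype.sum_sum_type]

end PT
end NilpPf

namespace NilpPf
section PF
open Matrix
universe u

lemma map_pms {K : Type*} [CommRing K] (n i : ℕ) (hi : i ≤ n) {S : Type*} [CommRing S]
    (f : MvPolynomial (Fin n × Fin n) K →+* S) :
    ((genericMatrix K n).map f).charpoly.coeff (n - i) = (-1) ^ i * f (principalMinorSum K n i) := by
  have h := charpoly_coeff_eq_sum_minors (genericMatrix K n) i (by rwa [Fintype.card_fin])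
  rw [Fintype.card_fin] at h
  rw [Matrix.charpoly_map, Polynomial.coeff_map, h, map_mul, map_pow, map_neg, map_one]
  rfl

/-- powers of `B * A` when the mixed commutation relations hold -/
lemma BA_pow_zero {ν : Type} [Fintype ν] [DecidableEq ν] {lev : ν → ℕ} {R : Type*} [CommRing R]
    (e : ℕ) (hlev : ∀ p, lev p < e) (A B : Matrix ν ν R) (hA : HasDeg lev A 1) (hB : HasDeg lev B (-1))
    (hE : ∀ p q, lev p = lev q → 1 ≤ lev p → (A * B) p q = (B * A) p q) : (B * A) ^ e = 0 := by
  have hc : Commute (B * A) B := by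
    show B * A * B = B * (B * A)
    rw [Matrix.mul_assoc]
    ext p q
    rw [Matrix.mul_apply, Matrix.mul_apply]
    refine Finset.sum_congr rfl fun r _ => ?_
    by_cases h1 : (lev p : ℤ) = lev r + (-1)
    · by_cases h2 : lev r = lev q
      · rw [hE r q h2 (by omega)]
      · rw [(hA.mul hB) r q (by omega), (hB.mul hA) r q (by omega)]
    · rw [hB p r h1, zero_mul, zero_mul]
  have h : ∀ k, (B * A) ^ k = B ^ k * A ^ k := by
    intro k
    induction k with
    | zero => simp
    | succ k ih =>
      rw [pow_succ', ih, ← Matrix.mul_assoc, (hc.pow_right k).eq, pow_succ, pow_succ' A]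
      simp only [Matrix.mul_assoc]
  rw [h, HasDeg.pow_eq_zero (Or.inr rfl) hB e hlev, Matrix.zero_mul]

lemma block_pow {n : ℕ} {ν : Type} [Fintype ν] [DecidableEq ν] {lev : ν → ℕ} {R : Type*} [CommRing R]
    (Z : Matrix (Fin n ⊕ ν) (Fin n ⊕ ν) R) (hZ : HasDeg (lv n lev) Z 0) (k : ℕ) :
    Z.toBlocks₁₁ ^ k = (Z ^ k).toBlocks₁₁ := by
  induction k with
  | zero =>
    ext i j
    simp [Matrix.one_apply, toBlocks₁₁]
  | succ k ih =>
    rw [pow_succ, pow_succ, ih]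
    ext i j
    simp only [toBlocks₁₁, Matrix.of_apply, Matrix.mul_apply, Fintype.sum_sum_type]
    symm
    convert add_zero _
    refine Finset.sum_eq_zero fun q _ => ?_
    rw [hZ (Sum.inr q) (Sum.inl j) (by simp; omega), mul_zero]

theorem hard {K : Type u} [Field K] [IsAlgClosed K] [CharZero K] (n e : ℕ) (hen : e + 1 < n)
    (J : Ideal (MvPolynomial (Fin n × Fin n) K))
    (hJ1 : ∀ i, 1 ≤ i → i ≤ e → principalMinorSum K n i ∈ J)
    (hJ2 : ∀ k l, (genericMatrix K n ^ (e + 1)) k l ∈ J)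
    (f : MvPolynomial (Fin n × Fin n) K)
    (hf : ∀ M : Matrix (Fin n) (Fin n) K, M ^ (e + 1) = 0 → eval (fun p => M p.1 p.2) f = 0) : f ∈ J := by
  let π := Ideal.Quotient.mk J
  let M0 := (genericMatrix K n).map π
  have hM0 : M0 ^ (e + 1) = 0 := by
    have h : M0 ^ (e + 1) = ((genericMatrix K n) ^ (e + 1)).map π := (map_pow π.mapMatrix _ _).symm
    rw [h]
    ext i j
    exact Ideal.Quotient.eq_zero_iff_mem.2 (hJ2 i j)
  have hch : M0.charpoly = Polynomial.X ^ n := by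
    refine (Polynomial.charpoly_of_coeff M0 (e + 1) (by omega) hM0 ?_).1
    intro j h1 h2 h3
    rw [map_pms n j h3, Ideal.Quotient.eq_zero_iff_mem.2 (hJ1 j h1 (by omega)), mul_zero]
  obtain ⟨R', i1, i2, φ, ν, i3, i4, lev, A, B, hφ, hlev, hconv, -, hA, hB, hE, h0⟩ := tower e n _ M0 hM0 hch
  set L := lv n lev with hL
  have hL1 : ∀ p, L p < e + 1 := by
    rintro (p | p)
    · simp [hL]
    · exact hlev p
  let a : Pr L → R' := fun p => A p.1.1 p.1.2
  let b : Pr L → R' := fun p => B p.1.2 p.1.1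
  have ha : toA L a = A := by
    ext p q
    simp only [toA]
    split_ifs with h
    · rfl
    · exact (hA p q (by omega)).symm
  have hb : toB L b = B := by
    ext p q
    simp only [toB, toA, Matrix.transpose_apply]
    split_ifs with h
    · rfl
    · exact (hB p q (by omega)).symm
  let g : MvPolynomial (Fin n × Fin n) K →ₐ[K] MvPolynomial (Pr L ⊕ Pr L) K :=
    aeval (fun x => (gB L K * gA L K) (Sum.inl x.1) (Sum.inl x.2))
  have hgrad : g f ∈ (idE L K).radical := by
    rw [← vanishingIdeal_zeroLocus_eq_radical (K := K), mem_vanishingIdeal_iff]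
    intro x hx
    rw [mem_zeroLocus_iff] at hx
    let ψ : MvPolynomial (Pr L ⊕ Pr L) K →+* K := (aeval x).toRingHom
    have e1 : (gA L K).map ψ = toA L (x ∘ Sum.inl) := by
      rw [gA, toA_map _ (map_zero ψ)]
      congr 1
      funext p
      simp [ψ]
    have e2 : (gB L K).map ψ = toB L (x ∘ Sum.inr) := by
      rw [gB, toB_map _ (map_zero ψ)]
      congr 1
      funext p
      simp [ψ]
    set Ax := toA L (x ∘ Sum.inl)
    set Bx := toB L (x ∘ Sum.inr)
    have hAx : HasDeg L Ax 1 := hasDeg_toA _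
    have hBx : HasDeg L Bx (-1) := hasDeg_toB _
    have e3 : (Bx * Ax) ^ (e + 1) = 0 := by
      refine BA_pow_zero (e + 1) hL1 Ax Bx hAx hBx ?_
      intro p q hpq hp
      have h1 : ψ (gE L K ⟨(p, q), hpq, hp⟩) = 0 := hx _ (Ideal.subset_span ⟨_, rfl⟩)
      rw [gE, map_sub, sub_eq_zero] at h1
      rw [← e1, ← e2, ← Matrix.map_mul, ← Matrix.map_mul]
      exact h1
    have e4 : (Bx * Ax).toBlocks₁₁ ^ (e + 1) = 0 := by
      rw [block_pow _ (by simpa using hBx.mul hAx), e3]; rfl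
    have e5 := hf _ e4
    rw [← e5]
    have e6 : ψ.comp g.toRingHom = (eval (fun p => (Bx * Ax).toBlocks₁₁ p.1 p.2) : MvPolynomial (Fin n × Fin n) K →+* K) := by
      apply MvPolynomial.ringHom_ext
      · intro r; simp [ψ]
      · rintro ⟨i, j⟩
        rw [← e1, ← e2, ← Matrix.map_mul]
        simp [g, toBlocks₁₁]
    exact RingHom.congr_fun e6 f
  have hg := idE_radical (e + 1) hL1 hconv _ hgrad
  let σ : MvPolynomial (Pr L ⊕ Pr L) K →+* R' := eval₂Hom ((φ.comp π).comp C) (Sum.elim a b)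
  have s1 : (gA L K).map σ = A := by
    rw [gA, toA_map _ (map_zero σ), ← ha]
    congr 1
    funext p
    simp [σ]
  have s2 : (gB L K).map σ = B := by
    rw [gB, toB_map _ (map_zero σ), ← hb]
    congr 1
    funext p
    simp [σ]
  have s3 : idE L K ≤ RingHom.ker σ := by
    apply Ideal.span_le.2
    rintro _ ⟨⟨⟨p, q⟩, hpq, hp⟩, rfl⟩
    show σ _ = 0
    have := hE p q hpq hp
    rw [← s1, ← s2, ← Matrix.map_mul, ← Matrix.map_mul] at this
    rw [gE, map_sub, sub_eq_zero]
    exact this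
  have s4 : σ.comp g.toRingHom = φ.comp π := by
    apply MvPolynomial.ringHom_ext
    · intro r; simp [σ]
    · rintro ⟨i, j⟩
      have := h0 i j
      rw [← s1, ← s2, ← Matrix.map_mul] at this
      simp only [RingHom.comp_apply]
      rw [show (X (i, j) : MvPolynomial (Fin n × Fin n) K) = genericMatrix K n i j from rfl]
      refine Eq.trans ?_ this
      simp [g, genericMatrix]
  have s5 : φ (π f) = 0 := by
    have := RingHom.congr_fun s4 f
    rw [RingHom.comp_apply, RingHom.comp_apply] at this
    rw [← this]
    exact s3 hg
  rw [← map_zero φ] at s5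
  exact Ideal.Quotient.eq_zero_iff_mem.1 (hφ s5)

end PF
end NilpPf

theorem ideal_of_e_nilpotent_matrices (K : Type*) [Field K] [IsAlgClosed K] [CharZero K]
    (n e : ℕ) (hn : 1 ≤ n) (he : 1 ≤ e) (hen : e < n) :
    {f : MvPolynomial (Fin n × Fin n) K |
        ∀ M : Matrix (Fin n) (Fin n) K, M ^ e = 0 →
          eval (fun p => M p.1 p.2) f = 0}
      = ↑(Ideal.span
          ({f | ∃ i, 1 ≤ i ∧ i ≤ e - 1 ∧ f = principalMinorSum K n i} ∪
           {f | ∃ k l, f = (genericMatrix K n ^ e) k l})) := by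
  obtain ⟨e, rfl⟩ : ∃ e', e = e' + 1 := ⟨e - 1, by omega⟩
  apply Set.Subset.antisymm
  · intro f hf
    refine NilpPf.hard n e hen _ ?_ ?_ f hf
    · intro i h1 h2
      exact Ideal.subset_span (Or.inl ⟨i, h1, by omega, rfl⟩)
    · intro k l
      exact Ideal.subset_span (Or.inr ⟨k, l, rfl⟩)
  · intro f hf M hM
    let ψ : MvPolynomial (Fin n × Fin n) K →+* K := eval (fun p => M p.1 p.2)
    have hψ : (genericMatrix K n).map ψ = M := by
      ext i j
      simp [ψ, genericMatrix]
    have hle : Ideal.span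
          ({f | ∃ i, 1 ≤ i ∧ i ≤ e + 1 - 1 ∧ f = principalMinorSum K n i} ∪
           {f | ∃ k l, f = (genericMatrix K n ^ (e + 1)) k l}) ≤ RingHom.ker ψ := by
      apply Ideal.span_le.2
      rintro _ (⟨i, h1, h2, rfl⟩ | ⟨k, l, rfl⟩)
      · have h3 := NilpPf.map_pms n i (by omega) ψ
        have h4 := Matrix.isNilpotent_charpoly_sub_pow_of_isNilpotent (M := M) ⟨e + 1, hM⟩
        have h5 : M.charpoly = Polynomial.X ^ n := by
          have := h4.eq_zero
          rwa [sub_eq_zero, Fintype.card_fin] at this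
        rw [hψ, h5, Polynomial.coeff_X_pow, if_neg (by omega)] at h3
        have h6 : ((-1 : K) ^ i) ≠ 0 := pow_ne_zero _ (by norm_num)
        exact (mul_eq_zero.1 h3.symm).resolve_left h6
      · have h : ((genericMatrix K n) ^ (e + 1)).map ψ = M ^ (e + 1) := by
          rw [← hψ]; exact map_pow ψ.mapMatrix _ _
        have h2 := congrFun (congrFun h k) l
        rw [hM] at h2
        exact h2
    exact hle hf
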